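/- In the normalized setting, fix z ∈ (0, 1/3] and let v(x,y) := ∫_{−z}^{z} u(x+s, y) ds. Let d > 0 be such that both A_d^+ and A_d^− are nonempty. Then there exists a constant C > 0, depending only on N, z, d and β (in particular, not on γ or u), such that sup_{[−1,2]×B̄_2(0)} v ≤ C · inf_{[0,1]×B̄_2(0)} u. -/

import Mathlib

open MeasureTheory Set Metric ProbabilityTheory

noncomputable section

/-- `ℝ^{N-1}`, the space of the variable `y`. -/
abbrev Euc (N : ℕ) : Type := EuclideanSpace ℝ (Fin (N - 1))

/-- The partial derivative `∂φ/∂x` of a function on `ℝ × ℝ^{N-1}`. -/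
def dX {N : ℕ} (φ : ℝ × Euc N → ℝ) (p : ℝ × Euc N) : ℝ :=
  fderiv ℝ φ p (1, 0)

/-- The Laplacian `Δ_y` in the `y`-variables. -/
def lapY {N : ℕ} (φ : ℝ × Euc N → ℝ) (p : ℝ × Euc N) : ℝ :=
  ∑ i : Fin (N - 1),
    fderiv ℝ (fun q => fderiv ℝ φ q ((0 : ℝ), EuclideanSpace.single i (1 : ℝ))) p
      ((0 : ℝ), EuclideanSpace.single i (1 : ℝ))

/-- `u` is a distributional solution of `Δ_y u + β(y) u_x + γ(x,y) u = 0` on `S`: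
for every test function `φ ∈ C_c^∞(S)`, `∫_S u · (Δ_y φ − β φ_x + γ φ) = 0`. -/
def IsDistribSolution {N : ℕ} (S : Set (ℝ × Euc N)) (β : Euc N → ℝ)
    (γ u : ℝ × Euc N → ℝ) : Prop :=
  ∀ φ : ℝ × Euc N → ℝ, ContDiff ℝ (⊤ : ℕ∞) φ → HasCompactSupport φ → tsupport φ ⊆ S →
    ∫ p in S, u p * (lapY φ p - β p.2 * dX φ p + γ p * φ p) = 0

/-- The cylinder `(−5,6) × B_3(0)` of the normalized setting. -/
def cylD (N : ℕ) : Set (ℝ × Euc N) := Ioo (-5 : ℝ) 6 ×ˢ ball (0 : Euc N) 3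

/-- `‖β‖_∞ := sup_{B_3(0)} |β|`. -/
def supNormβ {N : ℕ} (β : Euc N → ℝ) : ℝ := sSup ((fun y => |β y|) '' ball (0 : Euc N) 3)

/-- `A_d^+ := {y ∈ B_1(0) | β(y) > d}`. -/
def Aplus {N : ℕ} (β : Euc N → ℝ) (d : ℝ) : Set (Euc N) :=
  {y ∈ ball (0 : Euc N) 1 | d < β y}

/-- `A_d^− := {y ∈ B_1(0) | −β(y) > d}`. -/
def Aminus {N : ℕ} (β : Euc N → ℝ) (d : ℝ) : Set (Euc N) :=
  {y ∈ ball (0 : Euc N) 1 | d < -β y}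

/-- Differentiation under the integral sign over a compact set, for an integrand whose
parameter derivative is jointly continuous. -/
theorem hasDerivAt_setIntegral_of_continuousOn {X : Type*} [TopologicalSpace X]
    [T2Space X] [MeasurableSpace X] [OpensMeasurableSpace X]
    {μ : Measure X} [IsFiniteMeasureOnCompacts μ] {K : Set X}
    (hK : IsCompact K) {J : Set ℝ} (hJ : IsOpen J) {F F' : ℝ → X → ℝ}
    (hF : ContinuousOn (fun q : ℝ × X => F q.1 q.2) (J ×ˢ K))
    (hF' : ContinuousOn (fun q : ℝ × X => F' q.1 q.2) (J ×ˢ K))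
    (hd : ∀ t ∈ J, ∀ y ∈ K, HasDerivAt (fun t => F t y) (F' t y) t) {t : ℝ} (ht : t ∈ J) :
    HasDerivAt (fun t => ∫ y in K, F t y ∂μ) (∫ y in K, F' t y ∂μ) t := by
  obtain ⟨ε, hε, hεJ⟩ := Metric.nhds_basis_closedBall.mem_iff.1 (hJ.mem_nhds ht)
  have hcont : ∀ {G : ℝ → X → ℝ}, ContinuousOn (fun q : ℝ × X => G q.1 q.2) (J ×ˢ K) →
      ∀ s ∈ J, ContinuousOn (G s) K := fun {G} hG s hs =>
    hG.comp (f := fun y => (s, y)) (by fun_prop) (fun y hy => ⟨hs, hy⟩)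
  obtain ⟨b, hb⟩ := ((isCompact_closedBall t ε).prod hK).exists_bound_of_continuousOn
    (hF'.mono (prod_mono hεJ subset_rfl))
  refine (hasDerivAt_integral_of_dominated_loc_of_deriv_le (bound := fun _ => b)
    (closedBall_mem_nhds t hε) ?_ ?_ ?_ ?_ ?_ ?_).2
  · filter_upwards [hJ.mem_nhds ht] with s hs
    exact (hcont hF s hs).aestronglyMeasurable_of_isCompact hK hK.measurableSet
  · exact (hcont hF t ht).integrableOn_compact hK
  · exact (hcont hF' t ht).aestronglyMeasurable_of_isCompact hK hK.measurableSet
  · exact (ae_restrict_iff' hK.measurableSet).2 (Filter.Eventually.of_forall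
      fun y hy s hs => hb (s, y) ⟨hs, hy⟩)
  · exact integrableOn_const hK.measure_lt_top.ne
  · exact (ae_restrict_iff' hK.measurableSet).2 (Filter.Eventually.of_forall
      fun y hy s hs => hd s (hεJ hs) y hy)

/-- The positive part to a power `k + 2` is differentiable. -/
theorem hasDerivAt_max_zero_pow (k : ℕ) (w : ℝ) :
    HasDerivAt (fun w : ℝ => max w 0 ^ (k + 2)) ((k + 2) * max w 0 ^ (k + 1)) w := by
  rcases lt_trichotomy w 0 with h | h | h
  · have : (fun w : ℝ => max w 0 ^ (k + 2)) =ᶠ[nhds w] fun _ => 0 := by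
      filter_upwards [gt_mem_nhds h] with v hv
      simp [max_eq_right (le_of_lt hv)]
    simpa [max_eq_right h.le] using (hasDerivAt_const w (0 : ℝ)).congr_of_eventuallyEq this
  · subst h
    simp only [max_self, ne_eq, Nat.add_eq_zero_iff, one_ne_zero, and_false, not_false_eq_true,
      zero_pow, mul_zero]
    rw [hasDerivAt_iff_isLittleO_nhds_zero]
    have h1 : (fun h : ℝ => h ^ (k + 2)) =o[nhds 0] fun h => h :=
      Asymptotics.IsLittleO.of_bound (fun c hc => by
        have : Filter.Tendsto (fun h : ℝ => |h| ^ (k + 1)) (nhds 0) (nhds 0) := by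
          have : Continuous fun h : ℝ => |h| ^ (k + 1) := by fun_prop
          simpa using this.tendsto 0
        filter_upwards [this.eventually (gt_mem_nhds hc)] with h hh
        rw [norm_pow, Real.norm_eq_abs, pow_succ]
        gcongr)
    refine (Asymptotics.isBigO_of_le _ fun h => ?_).trans_isLittleO h1
    simp only [zero_add, max_self, ne_eq, Nat.add_eq_zero_iff, OfNat.ofNat_ne_zero, and_false,
      not_false_eq_true, zero_pow, sub_zero, smul_zero, norm_pow, Real.norm_eq_abs]
    refine pow_le_pow_left₀ (abs_nonneg _) ?_ _
    rcases le_total h 0 with h0 | h0 <;> simp [h0]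
  · have : (fun w : ℝ => max w 0 ^ (k + 2)) =ᶠ[nhds w] fun v => v ^ (k + 2) := by
      filter_upwards [lt_mem_nhds h] with v hv
      simp [max_eq_left (le_of_lt hv)]
    have h2 := (hasDerivAt_pow (k + 2) w).congr_of_eventuallyEq this
    rw [max_eq_left h.le]
    simpa using h2

/-- Integration by parts along a direction against a compactly supported function. -/
theorem integral_mul_lineDeriv_eq_neg {E : Type*} [NormedAddCommGroup E] [NormedSpace ℝ E]
    [FiniteDimensional ℝ E] [MeasurableSpace E] [BorelSpace E] {μ : Measure E}
    [μ.IsAddHaarMeasure] {F F' G G' : E → ℝ} {v : E} {K : Set E} (hK : IsCompact K)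
    (hF : Continuous F) (hF' : Continuous F') (hG : Continuous G) (hG' : Continuous G')
    (hGK : ∀ y ∉ K, G y = 0) (hGK' : ∀ y ∉ K, G' y = 0)
    (hFd : ∀ y, HasLineDerivAt ℝ F (F' y) y v) (hGd : ∀ y, HasLineDerivAt ℝ G (G' y) y v) :
    ∫ y, F' y * G y ∂μ = -∫ y, F y * G' y ∂μ := by
  have hi : ∀ {A B : E → ℝ}, Continuous A → Continuous B → (∀ y ∉ K, B y = 0) →
      Integrable (fun y => A y * B y) μ := fun {A B} hA hB hBK =>
    (hA.mul hB).integrable_of_hasCompactSupport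
      (HasCompactSupport.intro hK fun y hy => by simp [hBK y hy])
  have := integral_bilinear_hasLineDerivAt_right_eq_neg_left_of_integrable
    (B := ContinuousLinearMap.mul ℝ ℝ) (μ := μ) (hi hF' hG hGK) (hi hF hG' hGK') (hi hF hG hGK)
    (fun y _ => hFd y) (fun y _ => hGd y)
  simp only [ContinuousLinearMap.mul_apply'] at this
  rw [this, neg_neg]

section Calculus
variable {N : ℕ}

theorem hasLineDerivAt_slice {U : ℝ × Euc N → ℝ} (hU : Differentiable ℝ U) (x : ℝ)
    (y v : Euc N) :
    HasLineDerivAt ℝ (fun y => U (x, y)) (fderiv ℝ U (x, y) (0, v)) y v := by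
  have h := (hU (x, y)).hasFDerivAt.comp y (hasFDerivAt_prodMk_right (𝕜 := ℝ) x y)
  have h2 := h.hasLineDerivAt v
  simp only [ContinuousLinearMap.comp_apply, ContinuousLinearMap.inr_apply] at h2
  exact h2

theorem hasDerivAt_fst_slice {U : ℝ × Euc N → ℝ} (hU : Differentiable ℝ U) (x : ℝ)
    (y : Euc N) : HasDerivAt (fun x => U (x, y)) (dX U (x, y)) x := by
  have h := (hU (x, y)).hasFDerivAt.comp x (hasFDerivAt_prodMk_left (𝕜 := ℝ) x y)
  have h2 := h.hasDerivAt
  simp only [ContinuousLinearMap.comp_apply, ContinuousLinearMap.inl_apply] at h2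
  exact h2

theorem hasLineDerivAt_radial {h : ℝ → ℝ} {h' : ℝ} (c y v : Euc N)
    (hh : HasDerivAt h h' (‖y - c‖ ^ 2)) :
    HasLineDerivAt ℝ (fun y => h (‖y - c‖ ^ 2)) (2 * inner ℝ (y - c) v * h') y v := by
  have h1 : HasDerivAt (fun t : ℝ => ‖(y + t • v) - c‖ ^ 2) (2 * inner ℝ (y - c) v) 0 := by
    have h2 : HasDerivAt (fun t : ℝ => (y + t • v) - c) v 0 := by
      simpa using (((hasDerivAt_id (0 : ℝ)).smul_const v).const_add y).sub_const c
    simpa using h2.norm_sq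
  have h3 : HasDerivAt h h' (‖(y + (0 : ℝ) • v) - c‖ ^ 2) := by simpa using hh
  have := h3.comp (0 : ℝ) h1
  rw [mul_comm] at this
  exact this

theorem hasLineDerivAt_radial_single {h h' : ℝ → ℝ} (hh : ∀ s, HasDerivAt h (h' s) s)
    (c : Euc N) (i : Fin (N - 1)) (y : Euc N) :
    HasLineDerivAt ℝ (fun y => h (‖y - c‖ ^ 2)) (2 * (y - c) i * h' (‖y - c‖ ^ 2)) y
      (EuclideanSpace.single i (1 : ℝ)) := by
  simpa [EuclideanSpace.inner_single_right] using
    hasLineDerivAt_radial c y (EuclideanSpace.single i (1 : ℝ)) (hh (‖y - c‖ ^ 2))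

theorem hasLineDerivAt_radial_single_single {h' h'' : ℝ → ℝ}
    (hh' : ∀ s, HasDerivAt h' (h'' s) s) (c : Euc N) (i : Fin (N - 1)) (y : Euc N) :
    HasLineDerivAt ℝ (fun y => 2 * (y - c) i * h' (‖y - c‖ ^ 2))
      (2 * h' (‖y - c‖ ^ 2) + 4 * ((y - c) i) ^ 2 * h'' (‖y - c‖ ^ 2)) y
      (EuclideanSpace.single i (1 : ℝ)) := by
  have h1 := hasLineDerivAt_radial c y (EuclideanSpace.single i (1 : ℝ)) (hh' (‖y - c‖ ^ 2))
  have h2 : HasLineDerivAt ℝ (fun y : Euc N => 2 * (y - c) i) 2 y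
      (EuclideanSpace.single i (1 : ℝ)) := by
    have : HasDerivAt (fun t : ℝ => 2 * ((y i + t * 1) - c i)) (2 * (1 * 1)) 0 :=
      ((((hasDerivAt_id (0 : ℝ)).mul_const 1).const_add (y i)).sub_const (c i)).const_mul 2
    simpa [HasLineDerivAt] using this
  have h3 := HasDerivAt.mul h2 h1
  simp only [HasLineDerivAt]
  refine h3.congr_deriv ?_
  simp [EuclideanSpace.inner_single_right]
  ring

theorem sum_two_mul_add_four_mul_sq (w : Euc N) (p q : ℝ) :
    ∑ i, (2 * p + 4 * (w i) ^ 2 * q) = 4 * ‖w‖ ^ 2 * q + 2 * (N - 1 : ℕ) * p := by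
  rw [Finset.sum_add_distrib, Finset.sum_const, Finset.card_univ, Fintype.card_fin,
    nsmul_eq_mul, ← Finset.sum_mul, ← Finset.mul_sum, EuclideanSpace.norm_sq_eq]
  simp only [Real.norm_eq_abs, sq_abs]
  ring

theorem contDiff_fderiv_apply_const {U : ℝ × Euc N → ℝ} (hU : ContDiff ℝ (⊤ : ℕ∞) U)
    (v : ℝ × Euc N) : ContDiff ℝ (⊤ : ℕ∞) fun p => fderiv ℝ U p v :=
  (hU.fderiv_right (m := (⊤ : ℕ∞)) (by simp)).clm_apply contDiff_const

theorem continuous_dX {U : ℝ × Euc N → ℝ} (hU : ContDiff ℝ (⊤ : ℕ∞) U) : Continuous (dX U) :=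
  (contDiff_fderiv_apply_const hU _).continuous

theorem continuous_lapY {U : ℝ × Euc N → ℝ} (hU : ContDiff ℝ (⊤ : ℕ∞) U) :
    Continuous (lapY U) :=
  continuous_finsetSum _ fun _ _ =>
    (contDiff_fderiv_apply_const (contDiff_fderiv_apply_const hU _) _).continuous

/-- Green's formula on a slice against a radial compactly supported function. -/
theorem integral_lapY_mul_radial {U : ℝ × Euc N → ℝ} (hU : ContDiff ℝ (⊤ : ℕ∞) U) (x : ℝ)
    (c : Euc N) {R : ℝ} (hR : 0 ≤ R) {h h' h'' : ℝ → ℝ} (hh : ∀ s, HasDerivAt h (h' s) s)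
    (hh' : ∀ s, HasDerivAt h' (h'' s) s) (hc : Continuous h'')
    (h0 : ∀ s, R ^ 2 ≤ s → h s = 0) (h0' : ∀ s, R ^ 2 ≤ s → h' s = 0)
    (h0'' : ∀ s, R ^ 2 ≤ s → h'' s = 0) :
    ∫ y in closedBall c R, lapY U (x, y) * h (‖y - c‖ ^ 2) =
      ∫ y in closedBall c R, U (x, y) *
        (4 * ‖y - c‖ ^ 2 * h'' (‖y - c‖ ^ 2) + 2 * (N - 1 : ℕ) * h' (‖y - c‖ ^ 2)) := by
  have hch : Continuous h := continuous_iff_continuousAt.2 fun s => (hh s).continuousAt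
  have hch' : Continuous h' := continuous_iff_continuousAt.2 fun s => (hh' s).continuousAt
  have hUc : Continuous U := hU.continuous
  have hout : ∀ y ∉ closedBall c R, R ^ 2 ≤ ‖y - c‖ ^ 2 := fun y hy => by
    rw [mem_closedBall, dist_eq_norm, not_le] at hy
    gcongr
  have hz : ∀ y ∉ closedBall c R, h (‖y - c‖ ^ 2) = 0 := fun y hy => h0 _ (hout y hy)
  have hz' : ∀ y ∉ closedBall c R, h' (‖y - c‖ ^ 2) = 0 := fun y hy => h0' _ (hout y hy)
  have hz'' : ∀ y ∉ closedBall c R, h'' (‖y - c‖ ^ 2) = 0 := fun y hy => h0'' _ (hout y hy)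
  rw [setIntegral_eq_integral_of_forall_compl_eq_zero (fun y hy => by simp [hz y hy]),
    setIntegral_eq_integral_of_forall_compl_eq_zero (fun y hy => by simp [hz' y hy, hz'' y hy])]
  have hK := isCompact_closedBall c R
  have hinteg : ∀ {A B : Euc N → ℝ}, Continuous A → Continuous B →
      (∀ y ∉ closedBall c R, B y = 0) → Integrable (fun y => A y * B y) :=
    fun {A B} hA hB hBK => (hA.mul hB).integrable_of_hasCompactSupport
      (HasCompactSupport.intro hK fun y hy => by simp [hBK y hy])
  have key : ∀ i : Fin (N - 1),
      ∫ y, fderiv ℝ (fun q => fderiv ℝ U q ((0 : ℝ), EuclideanSpace.single i (1 : ℝ))) (x, y)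
        ((0 : ℝ), EuclideanSpace.single i (1 : ℝ)) * h (‖y - c‖ ^ 2) =
      ∫ y, U (x, y) * (2 * h' (‖y - c‖ ^ 2) + 4 * ((y - c) i) ^ 2 * h'' (‖y - c‖ ^ 2)) := by
    intro i
    have hU1 := contDiff_fderiv_apply_const hU ((0 : ℝ), EuclideanSpace.single i (1 : ℝ))
    have hU2 := contDiff_fderiv_apply_const hU1 ((0 : ℝ), EuclideanSpace.single i (1 : ℝ))
    have hg := hasLineDerivAt_radial_single hh c i
    have hg' := hasLineDerivAt_radial_single_single hh' c i
    have c1 : Continuous fun y : Euc N => h (‖y - c‖ ^ 2) := hch.comp (by fun_prop)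
    have c2 : Continuous fun y : Euc N => h' (‖y - c‖ ^ 2) := hch'.comp (by fun_prop)
    have c3 : Continuous fun y : Euc N => h'' (‖y - c‖ ^ 2) := hc.comp (by fun_prop)
    have s0 : Continuous fun y : Euc N => U (x, y) := by fun_prop
    have s1 : Continuous fun y : Euc N =>
        fderiv ℝ U (x, y) ((0 : ℝ), EuclideanSpace.single i (1 : ℝ)) :=
      hU1.continuous.comp (by fun_prop)
    have s2 : Continuous fun y : Euc N =>
        fderiv ℝ (fun q => fderiv ℝ U q ((0 : ℝ), EuclideanSpace.single i (1 : ℝ))) (x, y)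
        ((0 : ℝ), EuclideanSpace.single i (1 : ℝ)) := hU2.continuous.comp (by fun_prop)
    rw [integral_mul_lineDeriv_eq_neg hK s1 s2 c1
      (show Continuous fun y : Euc N => 2 * (y - c) i * h' (‖y - c‖ ^ 2) by fun_prop)
      hz (fun y hy => by simp [hz' y hy])
      (fun y => hasLineDerivAt_slice (hU1.differentiable (by simp)) x y _) hg,
      integral_mul_lineDeriv_eq_neg hK s0 s1 (show Continuous fun y : Euc N =>
      2 * (y - c) i * h' (‖y - c‖ ^ 2) by fun_prop) (by fun_prop)
      (fun y hy => by simp [hz' y hy]) (fun y hy => by simp [hz' y hy, hz'' y hy])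
      (fun y => hasLineDerivAt_slice (hU.differentiable (by simp)) x y _) hg', neg_neg]
  simp only [lapY, Finset.sum_mul]
  rw [integral_finsetSum]
  swap
  · intro i _
    have h2 := (contDiff_fderiv_apply_const (contDiff_fderiv_apply_const hU
      ((0 : ℝ), EuclideanSpace.single i (1 : ℝ)))
      ((0 : ℝ), EuclideanSpace.single i (1 : ℝ))).continuous
    exact hinteg (h2.comp (by fun_prop)) (hch.comp (by fun_prop)) hz
  simp_rw [key]
  rw [← integral_finsetSum _ fun i _ => hinteg (by fun_prop) (by fun_prop)
    (fun y hy => by simp [hz' y hy, hz'' y hy])]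
  refine integral_congr_ae (Filter.Eventually.of_forall fun y => ?_)
  simp only
  rw [← Finset.mul_sum, sum_two_mul_add_four_mul_sq]

end Calculus

section Slices
variable {N : ℕ}

/-- Derivative bound for the functional `t ↦ ∫ β(y) U(ξ(t), y) H(t, |y - c|²) dy` of a
supersolution `U`. -/
theorem exists_hasDerivAt_slice_functional_le {β : Euc N → ℝ} (hβ : Continuous β)
    {U : ℝ × Euc N → ℝ} (hU : ContDiff ℝ (⊤ : ℕ∞) U) {c : Euc N} {R : ℝ} (hR : 0 ≤ R)
    {J : Set ℝ} (hJ : IsOpen J) {ξ ξ' : ℝ → ℝ} (hξ : ∀ t ∈ J, HasDerivAt ξ (ξ' t) t)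
    (hξc : ContinuousOn ξ' J) (hξ0 : ∀ t ∈ J, 0 ≤ ξ' t) {H Ht Hs Hss : ℝ → ℝ → ℝ}
    (hHt : ∀ t ∈ J, ∀ s, HasDerivAt (fun t => H t s) (Ht t s) t)
    (hHc : ContinuousOn (fun q : ℝ × ℝ => H q.1 q.2) (J ×ˢ univ))
    (hHtc : ContinuousOn (fun q : ℝ × ℝ => Ht q.1 q.2) (J ×ˢ univ))
    (hHs : ∀ t ∈ J, ∀ s, HasDerivAt (H t) (Hs t s) s)
    (hHss : ∀ t ∈ J, ∀ s, HasDerivAt (Hs t) (Hss t s) s)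
    (hHssc : ∀ t ∈ J, Continuous (Hss t))
    (hz : ∀ t ∈ J, ∀ s, R ^ 2 ≤ s → H t s = 0) (hzs : ∀ t ∈ J, ∀ s, R ^ 2 ≤ s → Hs t s = 0)
    (hzss : ∀ t ∈ J, ∀ s, R ^ 2 ≤ s → Hss t s = 0) (hH0 : ∀ t ∈ J, ∀ s, 0 ≤ H t s)
    (hS : ∀ t ∈ J, ∀ y ∈ closedBall c R,
      lapY U (ξ t, y) + β y * dX U (ξ t, y) ≤ U (ξ t, y)) :
    ∀ t ∈ J, ∃ D, HasDerivAt
      (fun t => ∫ y in closedBall c R, β y * U (ξ t, y) * H t (‖y - c‖ ^ 2)) D t ∧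
      D ≤ -∫ y in closedBall c R, U (ξ t, y) *
        (ξ' t * (4 * ‖y - c‖ ^ 2 * Hss t (‖y - c‖ ^ 2) + 2 * (N - 1 : ℕ) * Hs t (‖y - c‖ ^ 2)
          - H t (‖y - c‖ ^ 2)) - β y * Ht t (‖y - c‖ ^ 2)) := by
  intro t ht
  have hUc := hU.continuous
  have hdX := continuous_dX hU
  have hlap := continuous_lapY hU
  have hK := isCompact_closedBall c R
  have hξcont : ContinuousOn ξ J := fun t ht => (hξ t ht).continuousAt.continuousWithinAt
  have hq : MapsTo (fun q : ℝ × Euc N => (q.1, ‖q.2 - c‖ ^ 2)) (J ×ˢ closedBall c R)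
      (J ×ˢ univ) := fun q hq => ⟨hq.1, mem_univ _⟩
  have hfst : MapsTo (fun q : ℝ × Euc N => q.1) (J ×ˢ closedBall c R) J := fun q hq => hq.1
  have cH := hHc.comp (f := fun q : ℝ × Euc N => (q.1, ‖q.2 - c‖ ^ 2)) (by fun_prop) hq
  have cHt := hHtc.comp (f := fun q : ℝ × Euc N => (q.1, ‖q.2 - c‖ ^ 2)) (by fun_prop) hq
  have cξ := hξcont.comp (f := fun q : ℝ × Euc N => q.1) (by fun_prop) hfst
  have cξ' := hξc.comp (f := fun q : ℝ × Euc N => q.1) (by fun_prop) hfst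
  have cp : ContinuousOn (fun q : ℝ × Euc N => (ξ q.1, q.2)) (J ×ˢ closedBall c R) :=
    cξ.prodMk continuousOn_snd
  have cU := hUc.comp_continuousOn cp
  have cX := hdX.comp_continuousOn cp
  have cβ : ContinuousOn (fun q : ℝ × Euc N => β q.2) (J ×ˢ closedBall c R) := by fun_prop
  have hD := hasDerivAt_setIntegral_of_continuousOn (μ := volume) hK hJ
    (F := fun t y => β y * U (ξ t, y) * H t (‖y - c‖ ^ 2))
    (F' := fun t y => β y * (dX U (ξ t, y) * ξ' t) * H t (‖y - c‖ ^ 2) +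
      β y * U (ξ t, y) * Ht t (‖y - c‖ ^ 2))
    ((cβ.mul cU).mul cH) (((cβ.mul (cX.mul cξ')).mul cH).add ((cβ.mul cU).mul cHt))
    (fun t ht y _ => ((((hasDerivAt_fst_slice (hU.differentiable (by simp)) (ξ t) y).comp t
      (hξ t ht)).const_mul (β y)).mul (hHt t ht _))) ht
  refine ⟨_, hD, ?_⟩
  have hgreen := integral_lapY_mul_radial hU (ξ t) c hR (hHs t ht) (hHss t ht) (hHssc t ht)
    (hz t ht) (hzs t ht) (hzss t ht)
  have k1 : Continuous (H t) := continuous_iff_continuousAt.2 fun s => (hHs t ht s).continuousAt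
  have k2 : Continuous (Hs t) :=
    continuous_iff_continuousAt.2 fun s => (hHss t ht s).continuousAt
  have k3 := hHssc t ht
  have k4 : Continuous (Ht t) := by
    rw [← continuousOn_univ]
    exact hHtc.comp (f := fun s => (t, s)) (by fun_prop) fun s _ => ⟨ht, mem_univ _⟩
  have I : ∀ {f : Euc N → ℝ}, Continuous f → IntegrableOn f (closedBall c R) :=
    fun hf => hf.continuousOn.integrableOn_compact hK
  rw [← sub_nonpos, sub_neg_eq_add, ← integral_add (I (by fun_prop)) (I (by fun_prop))]
  have e1 : ∫ y in closedBall c R, (β y * (dX U (ξ t, y) * ξ' t) * H t (‖y - c‖ ^ 2) +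
      β y * U (ξ t, y) * Ht t (‖y - c‖ ^ 2) + U (ξ t, y) *
        (ξ' t * (4 * ‖y - c‖ ^ 2 * Hss t (‖y - c‖ ^ 2) + 2 * (N - 1 : ℕ) * Hs t (‖y - c‖ ^ 2)
          - H t (‖y - c‖ ^ 2)) - β y * Ht t (‖y - c‖ ^ 2))) =
      ξ' t * (∫ y in closedBall c R, (β y * dX U (ξ t, y) - U (ξ t, y)) * H t (‖y - c‖ ^ 2)) +
      ξ' t * ∫ y in closedBall c R, U (ξ t, y) * (4 * ‖y - c‖ ^ 2 * Hss t (‖y - c‖ ^ 2) +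
        2 * (N - 1 : ℕ) * Hs t (‖y - c‖ ^ 2)) := by
    rw [← integral_const_mul, ← integral_const_mul,
      ← integral_add (I (by fun_prop)) (I (by fun_prop))]
    refine integral_congr_ae (Filter.Eventually.of_forall fun y => ?_)
    simp only
    ring
  rw [e1, ← hgreen, ← mul_add, ← integral_add (I (by fun_prop)) (I (by fun_prop))]
  refine mul_nonpos_of_nonneg_of_nonpos (hξ0 t ht) ?_
  refine setIntegral_nonpos hK.measurableSet fun y hy => ?_
  have := hS t ht y hy
  nlinarith [mul_nonneg (sub_nonneg.2 this) (hH0 t ht (‖y - c‖ ^ 2))]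

/-- Monotonicity of the slice functional when the weight is a subsolution of the dual
equation. -/
theorem antitoneOn_slice_functional {β : Euc N → ℝ} (hβ : Continuous β)
    {U : ℝ × Euc N → ℝ} (hU : ContDiff ℝ (⊤ : ℕ∞) U) (hU0 : ∀ p, 0 ≤ U p)
    {c : Euc N} {R : ℝ} (hR : 0 ≤ R)
    {J : Set ℝ} (hJ : IsOpen J) {ξ ξ' : ℝ → ℝ} (hξ : ∀ t ∈ J, HasDerivAt ξ (ξ' t) t)
    (hξc : ContinuousOn ξ' J) (hξ0 : ∀ t ∈ J, 0 ≤ ξ' t) {H Ht Hs Hss : ℝ → ℝ → ℝ}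
    (hHt : ∀ t ∈ J, ∀ s, HasDerivAt (fun t => H t s) (Ht t s) t)
    (hHc : ContinuousOn (fun q : ℝ × ℝ => H q.1 q.2) (J ×ˢ univ))
    (hHtc : ContinuousOn (fun q : ℝ × ℝ => Ht q.1 q.2) (J ×ˢ univ))
    (hHs : ∀ t ∈ J, ∀ s, HasDerivAt (H t) (Hs t s) s)
    (hHss : ∀ t ∈ J, ∀ s, HasDerivAt (Hs t) (Hss t s) s)
    (hHssc : ∀ t ∈ J, Continuous (Hss t))
    (hz : ∀ t ∈ J, ∀ s, R ^ 2 ≤ s → H t s = 0) (hzs : ∀ t ∈ J, ∀ s, R ^ 2 ≤ s → Hs t s = 0)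
    (hzss : ∀ t ∈ J, ∀ s, R ^ 2 ≤ s → Hss t s = 0) (hH0 : ∀ t ∈ J, ∀ s, 0 ≤ H t s)
    (hS : ∀ t ∈ J, ∀ y ∈ closedBall c R,
      lapY U (ξ t, y) + β y * dX U (ξ t, y) ≤ U (ξ t, y))
    (hsub : ∀ t ∈ J, ∀ y ∈ closedBall c R, β y * Ht t (‖y - c‖ ^ 2) ≤
      ξ' t * (4 * ‖y - c‖ ^ 2 * Hss t (‖y - c‖ ^ 2) + 2 * (N - 1 : ℕ) * Hs t (‖y - c‖ ^ 2)
          - H t (‖y - c‖ ^ 2)))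
    {a b : ℝ} (hab : a ≤ b) (hJab : Icc a b ⊆ J) :
    ∫ y in closedBall c R, β y * U (ξ b, y) * H b (‖y - c‖ ^ 2) ≤
      ∫ y in closedBall c R, β y * U (ξ a, y) * H a (‖y - c‖ ^ 2) := by
  choose! D hD hDle using exists_hasDerivAt_slice_functional_le hβ hU hR hJ hξ hξc hξ0 hHt hHc
    hHtc hHs hHss hHssc hz hzs hzss hH0 hS
  have hanti : AntitoneOn
      (fun t => ∫ y in closedBall c R, β y * U (ξ t, y) * H t (‖y - c‖ ^ 2)) (Icc a b) := by
    refine antitoneOn_of_hasDerivWithinAt_nonpos (f' := D) (convex_Icc a b)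
      (fun t ht => (hD t (hJab ht)).continuousAt.continuousWithinAt)
      (fun t ht => (hD t (hJab (interior_subset ht))).hasDerivWithinAt) (fun t ht => ?_)
    have ht := hJab (interior_subset ht)
    refine (hDle t ht).trans (neg_nonpos.2 ?_)
    exact setIntegral_nonneg (isCompact_closedBall c R).measurableSet fun y hy =>
      mul_nonneg (hU0 _) (sub_nonneg.2 (hsub t ht y hy))
  exact hanti (left_mem_Icc.2 hab) (right_mem_Icc.2 hab) hab

end Slices

section Barrier
variable {N : ℕ}

theorem HasLineDerivAt.hasDerivAt_add_smul {E : Type*} [AddCommGroup E] [Module ℝ E]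
    {f : E → ℝ} {f' t : ℝ} {y v : E} (h : HasLineDerivAt ℝ f f' (y + t • v) v) :
    HasDerivAt (fun τ : ℝ => f (y + τ • v)) f' t := by
  have h1 : HasDerivAt (fun τ : ℝ => f (y + t • v + τ • v)) f' (t - t) := by
    rw [sub_self]; exact h
  have h2 := h1.comp_sub_const t t
  refine h2.congr_of_eventuallyEq (Filter.Eventually.of_forall fun τ => ?_)
  simp only [add_assoc, ← add_smul, add_sub_cancel]

theorem second_deriv_nonneg_of_isLocalMin {f f' : ℝ → ℝ} {f'' x : ℝ} (hmin : IsLocalMin f x)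
    (hf : ∀ t, HasDerivAt f (f' t) t) (hf' : HasDerivAt f' f'' x) : 0 ≤ f'' := by
  by_contra! hneg
  have e : deriv f = f' := funext fun t => (hf t).deriv
  have hmax : IsLocalMax f x := by
    refine isLocalMax_of_deriv_deriv_neg ?_ ?_ (hf x).continuousAt
    · rw [e, hf'.deriv]; exact hneg
    · exact hmin.deriv_eq_zero
  have hconst : f =ᶠ[nhds x] fun _ => f x := by
    filter_upwards [hmin, hmax] with t h1 h2 using le_antisymm h2 h1
  have h1 : f' =ᶠ[nhds x] fun _ => 0 := by
    filter_upwards [hconst.eventuallyEq_nhds] with t ht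
    exact (hf t).unique ((hasDerivAt_const t (f x)).congr_of_eventuallyEq ht)
  exact hneg.ne (hf'.unique ((hasDerivAt_const x (0 : ℝ)).congr_of_eventuallyEq h1))

theorem second_lineDeriv_nonneg_of_isLocalMin {E : Type*} [AddCommGroup E] [Module ℝ E]
    [TopologicalSpace E] [ContinuousAdd E] [ContinuousSMul ℝ E]
    {f f' : E → ℝ} {f'' : ℝ} {y v : E}
    (hmin : IsLocalMin f y) (hf : ∀ y, HasLineDerivAt ℝ f (f' y) y v)
    (hf' : HasLineDerivAt ℝ f' f'' y v) : 0 ≤ f'' := by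
  refine second_deriv_nonneg_of_isLocalMin (f := fun t : ℝ => f (y + t • v))
    (f' := fun t : ℝ => f' (y + t • v)) (x := 0) ?_ (fun t => (hf _).hasDerivAt_add_smul) hf'
  have hc : Filter.Tendsto (fun t : ℝ => y + t • v) (nhds 0) (nhds y) := by
    have : Continuous fun t : ℝ => y + t • v := by fun_prop
    simpa using this.tendsto 0
  simpa [IsLocalMin, IsMinFilter] using hc.eventually hmin

theorem continuous_slice_integral {F : ℝ × Euc N → ℝ} (hF : Continuous F) {K : Set (Euc N)}
    (hK : IsCompact K) : Continuous fun x => ∫ y in K, F (x, y) :=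
  continuous_parametric_integral_of_continuous (f := fun x y => F (x, y))
    (by simpa [Function.uncurry_def] using hF) hK

/-- A `C¹` function vanishing on `[a, b]` and at least one outside `(a - δ, b + δ)`. -/
def edge (a b δ x : ℝ) : ℝ := (max (a - x) 0 ^ 2 + max (x - b) 0 ^ 2) / δ ^ 2

/-- The derivative of `edge`. -/
def edgeDeriv (a b δ x : ℝ) : ℝ := (-(2 * max (a - x) 0) + 2 * max (x - b) 0) / δ ^ 2

theorem continuous_edge (a b δ : ℝ) : Continuous (edge a b δ) := by
  unfold edge; fun_prop

theorem continuous_edgeDeriv (a b δ : ℝ) : Continuous (edgeDeriv a b δ) := by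
  unfold edgeDeriv; fun_prop

theorem edge_nonneg (a b δ x : ℝ) : 0 ≤ edge a b δ x := by unfold edge; positivity

theorem edge_eq_zero {a b x : ℝ} (δ : ℝ) (hx : x ∈ Icc a b) : edge a b δ x = 0 := by
  simp [edge, max_eq_right (sub_nonpos.2 hx.1), max_eq_right (sub_nonpos.2 hx.2)]

theorem mem_Ioo_of_edge_lt_one {a b δ x : ℝ} (hδ : 0 < δ) (hx : edge a b δ x < 1) :
    x ∈ Ioo (a - δ) (b + δ) := by
  rw [edge, div_lt_one (by positivity)] at hx
  have h1 : max (a - x) 0 < δ := lt_of_pow_lt_pow_left₀ 2 hδ.le (by nlinarith [sq_nonneg (max (x - b) 0)])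
  have h2 : max (x - b) 0 < δ := lt_of_pow_lt_pow_left₀ 2 hδ.le (by nlinarith [sq_nonneg (max (a - x) 0)])
  constructor <;> linarith [le_max_left (a - x) 0, le_max_left (x - b) 0]

theorem abs_edgeDeriv_le {a b δ x : ℝ} (hδ : 0 < δ) (hx : edge a b δ x < 1) :
    |edgeDeriv a b δ x| ≤ 2 / δ := by
  have hx' := mem_Ioo_of_edge_lt_one hδ hx
  have h1 : max (a - x) 0 ≤ δ := max_le (by linarith [hx'.1]) hδ.le
  have h2 : max (x - b) 0 ≤ δ := max_le (by linarith [hx'.2]) hδ.le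
  have h3 := le_max_right (a - x) 0
  have h4 := le_max_right (x - b) 0
  rw [edgeDeriv, abs_div, abs_of_pos (by positivity : 0 < δ ^ 2),
    div_le_div_iff₀ (by positivity) hδ]
  have : |-(2 * max (a - x) 0) + 2 * max (x - b) 0| ≤ 2 * δ := by
    rw [abs_le]; constructor <;> linarith
  nlinarith

theorem hasDerivAt_edge (a b δ x : ℝ) : HasDerivAt (edge a b δ) (edgeDeriv a b δ x) x := by
  have h1 := (hasDerivAt_max_zero_pow 0 (a - x)).comp x ((hasDerivAt_id x).const_sub a)
  have h2 := (hasDerivAt_max_zero_pow 0 (x - b)).comp x ((hasDerivAt_id x).sub_const b)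
  refine ((h1.add h2).div_const (δ ^ 2)).congr_deriv ?_
  simp [edgeDeriv]

/-- The base of the barrier `max (1 - κ(x) - s / R²) 0 ^ (k + 4)`. -/
def barrierBase (a b δ R x s : ℝ) : ℝ := max (1 - edge a b δ x - s / R ^ 2) 0

theorem continuous_barrierBase (a b δ R : ℝ) :
    Continuous fun q : ℝ × ℝ => barrierBase a b δ R q.1 q.2 := by
  have := continuous_edge a b δ
  unfold barrierBase
  fun_prop

theorem barrierBase_nonneg (a b δ R x s : ℝ) : 0 ≤ barrierBase a b δ R x s := le_max_right _ _

theorem barrierBase_le_one (a b δ R x : ℝ) {s : ℝ} (hs : 0 ≤ s) :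
    barrierBase a b δ R x s ≤ 1 :=
  max_le (by linarith [edge_nonneg a b δ x, div_nonneg hs (sq_nonneg R)]) zero_le_one

theorem hasDerivAt_barrierBase_pow_left (a b δ R x s : ℝ) (k : ℕ) :
    HasDerivAt (fun x => barrierBase a b δ R x s ^ (k + 2))
      (-((k + 2) * edgeDeriv a b δ x * barrierBase a b δ R x s ^ (k + 1))) x := by
  have h1 := ((hasDerivAt_edge a b δ x).const_sub 1).sub_const (s / R ^ 2)
  refine ((hasDerivAt_max_zero_pow k _).comp x h1).congr_deriv ?_
  simp only [barrierBase]
  ring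

theorem hasDerivAt_barrierBase_pow_right (a b δ R x s : ℝ) (k : ℕ) :
    HasDerivAt (fun s => barrierBase a b δ R x s ^ (k + 2))
      (-((k + 2) / R ^ 2 * barrierBase a b δ R x s ^ (k + 1))) s := by
  have h1 := ((hasDerivAt_id s).div_const (R ^ 2)).const_sub (1 - edge a b δ x)
  refine ((hasDerivAt_max_zero_pow k _).comp s h1).congr_deriv ?_
  simp only [barrierBase, id]
  ring

theorem edge_lt_one_of_barrierBase_ne_zero {a b δ R x s : ℝ} (hs : 0 ≤ s)
    (h : barrierBase a b δ R x s ≠ 0) : edge a b δ x < 1 ∧ s / R ^ 2 < 1 := by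
  have h1 : 0 < barrierBase a b δ R x s := (barrierBase_nonneg a b δ R x s).lt_of_ne' h
  have h2 : 0 < 1 - edge a b δ x - s / R ^ 2 := by
    by_contra! hc
    exact h (max_eq_right hc)
  constructor <;> linarith [edge_nonneg a b δ x, div_nonneg hs (sq_nonneg R)]

/-- The value of the dual operator on the barrier, in terms of `w = barrierBase` and
`q = ± β κ'`. -/
def barrierOp (n : ℕ) (R : ℝ) (k : ℕ) (s w q : ℝ) : ℝ :=
  4 * s * ((k + 4) * (k + 3) / R ^ 4 * w ^ (k + 2)) +
    2 * n * (-((k + 4) / R ^ 2 * w ^ (k + 3))) - w ^ (k + 4) + (k + 4) * q * w ^ (k + 3)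

theorem exists_barrierOp_bounds (n : ℕ) {R r Q : ℝ} (hR : 0 < R) (hr : 0 < r) (hQ : 0 ≤ Q) :
    ∃ k : ℕ, ∃ C > 0, ∀ s w q : ℝ, 0 ≤ s → 0 ≤ w → w ≤ 1 → (w ≠ 0 → |q| ≤ Q) →
      (r ^ 2 ≤ s → w ^ (k + 2) ≤ barrierOp n R k s w q) ∧ -C ≤ barrierOp n R k s w q := by
  obtain ⟨k, hk⟩ := exists_nat_ge ((2 * n / R ^ 2 + Q + 2) * R ^ 4 / (4 * r ^ 2))
  rw [div_le_iff₀ (by positivity)] at hk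
  refine ⟨k, (k + 4) * (2 * n / R ^ 2 + Q) + 1, by positivity, fun s w q hs hw hw1 hq => ?_⟩
  rcases eq_or_ne w 0 with rfl | hw0
  · simp only [barrierOp, ne_eq, Nat.add_eq_zero_iff, OfNat.ofNat_ne_zero, and_false,
      not_false_eq_true, zero_pow, mul_zero, neg_zero, add_zero, sub_zero, le_refl, implies_true,
      true_and, Left.neg_nonpos_iff]
    positivity
  have hq := hq hw0
  have e : barrierOp n R k s w q = w ^ (k + 2) * (4 * s * ((k + 4) * (k + 3) / R ^ 4) -
      (k + 4) * (2 * n / R ^ 2 - q) * w - w ^ 2) := by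
    unfold barrierOp; field_simp; ring
  have h0 : 0 ≤ 2 * n / R ^ 2 := by positivity
  have hk4 : (0 : ℝ) < k + 4 := by positivity
  have h1 : (k + 4) * (2 * n / R ^ 2 - q) * w ≤ (k + 4) * (2 * n / R ^ 2 + Q) := by
    have h2 : (2 * n / R ^ 2 - q) * w ≤ 2 * n / R ^ 2 + Q := by
      have := (abs_le.1 hq).1
      calc (2 * n / R ^ 2 - q) * w ≤ (2 * n / R ^ 2 + Q) * w := by gcongr; linarith
        _ ≤ (2 * n / R ^ 2 + Q) * 1 := by gcongr
        _ = _ := mul_one _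
    rw [mul_assoc]; gcongr
  have h3 : w ^ 2 ≤ 1 := pow_le_one₀ hw hw1
  have hp : 0 ≤ w ^ (k + 2) := by positivity
  have hp1 : w ^ (k + 2) ≤ 1 := pow_le_one₀ hw hw1
  have h5 : 0 ≤ (k + 4) * (2 * n / R ^ 2 + Q) := by positivity
  rw [e]
  constructor
  · intro hrs
    have h4 : (k + 4) * (2 * n / R ^ 2 + Q + 2) ≤ 4 * s * ((k + 4) * (k + 3) / R ^ 4) := by
      rw [mul_div_assoc', le_div_iff₀ (by positivity)]
      have h6 : (k : ℝ) * (4 * r ^ 2) ≤ (k + 3) * (4 * s) := by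
        have : (0 : ℝ) ≤ k := by positivity
        nlinarith [sq_nonneg r]
      nlinarith [mul_le_mul_of_nonneg_left (hk.trans h6) hk4.le]
    have hk0 : (0 : ℝ) ≤ k := by positivity
    refine le_mul_of_one_le_right hp ?_
    nlinarith
  · have h7 : 0 ≤ 4 * s * ((k + 4) * (k + 3) / R ^ 4) := by positivity
    nlinarith

end Barrier

section Spread
variable {N : ℕ}

/-- The mass of a nonnegative supersolution on a large ball is controlled by its mass on a
small concentric ball. -/
theorem exists_integral_le_integral_smaller_ball {β : Euc N → ℝ} (hβ : Continuous β) {B : ℝ}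
    (hB : ∀ y, |β y| ≤ B) (c : Euc N) {r R' R : ℝ} (hr : 0 < r) (hrR : r ≤ R) (hR'0 : 0 ≤ R')
    (hR' : R' < R)
    {a b δ : ℝ} (hab : a ≤ b) (hδ : 0 < δ) :
    ∃ C > 0, ∀ U : ℝ × Euc N → ℝ, ContDiff ℝ (⊤ : ℕ∞) U → (∀ p, 0 ≤ U p) →
      (∀ x ∈ Icc (a - δ) (b + δ), ∀ y ∈ closedBall c R,
        lapY U (x, y) + β y * dX U (x, y) ≤ U (x, y)) →
      ∫ x in a..b, ∫ y in closedBall c R', U (x, y) ≤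
        C * ∫ x in (a - δ)..(b + δ), ∫ y in closedBall c r, U (x, y) := by
  have hR : 0 < R := hr.trans_le hrR
  have hB0 : 0 ≤ B := (abs_nonneg _).trans (hB 0)
  obtain ⟨k, C, hC, hbar⟩ := exists_barrierOp_bounds (N - 1) hR hr
    (mul_nonneg hB0 (by positivity : 0 ≤ 2 / δ))
  set c0 : ℝ := (1 - R' ^ 2 / R ^ 2) ^ (k + 2) with hc0
  have hRR : R' ^ 2 / R ^ 2 < 1 := by
    rw [div_lt_one (by positivity)]; gcongr
  have hRR0 : 0 ≤ R' ^ 2 / R ^ 2 := by positivity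
  have hc0' : 0 < c0 := pow_pos (by linarith) _
  have hc01 : c0 ≤ 1 := pow_le_one₀ (by linarith) (by linarith)
  refine ⟨(C + 1) / c0, by positivity, fun U hU hU0 hS => ?_⟩
  have hUc := hU.continuous
  set W := barrierBase a b δ R with hW
  have hWc : Continuous fun q : ℝ × ℝ => W q.1 q.2 := continuous_barrierBase a b δ R
  have hκc := continuous_edgeDeriv a b δ
  set L : ℝ × Euc N → ℝ := fun p => barrierOp (N - 1) R k (‖p.2 - c‖ ^ 2)
    (W p.1 (‖p.2 - c‖ ^ 2)) (β p.2 * edgeDeriv a b δ p.1) with hL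
  have hWc' : Continuous fun p : ℝ × Euc N => W p.1 (‖p.2 - c‖ ^ 2) :=
    hWc.comp (f := fun p : ℝ × Euc N => (p.1, ‖p.2 - c‖ ^ 2)) (by fun_prop)
  have hLc : Continuous L := by simp only [hL, barrierOp]; fun_prop
  have hWz : ∀ t s, R ^ 2 ≤ s → W t s = 0 := fun t s hs => by
    refine max_eq_right ?_
    have : 1 ≤ s / R ^ 2 := (one_le_div (by positivity)).2 hs
    linarith [edge_nonneg a b δ t]
  have hop : ∀ x y, (r ^ 2 ≤ ‖y - c‖ ^ 2 → W x (‖y - c‖ ^ 2) ^ (k + 2) ≤ L (x, y)) ∧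
      -C ≤ L (x, y) := fun x y => by
    refine hbar _ _ _ (by positivity) (barrierBase_nonneg _ _ _ _ _ _)
      (barrierBase_le_one _ _ _ _ _ (by positivity)) fun hne => ?_
    rw [abs_mul]
    have := (edge_lt_one_of_barrierBase_ne_zero (by positivity) hne).1
    exact mul_le_mul (hB y) (abs_edgeDeriv_le hδ this) (abs_nonneg _) hB0
  have hderiv := exists_hasDerivAt_slice_functional_le hβ hU (c := c) hR.le
    (J := Ioo (a - δ) (b + δ)) isOpen_Ioo (ξ := fun t => t) (ξ' := fun _ => 1)
    (fun t _ => hasDerivAt_id t) continuousOn_const (fun _ _ => zero_le_one)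
    (H := fun t s => W t s ^ (k + 4))
    (Ht := fun t s => -((k + 4) * edgeDeriv a b δ t * W t s ^ (k + 3)))
    (Hs := fun t s => -((k + 4) / R ^ 2 * W t s ^ (k + 3)))
    (Hss := fun t s => (k + 4) * (k + 3) / R ^ 4 * W t s ^ (k + 2))
    (fun t _ s => by
      refine (hasDerivAt_barrierBase_pow_left a b δ R t s (k + 2)).congr_deriv ?_
      push_cast; ring)
    (by fun_prop) (by fun_prop)
    (fun t _ s => by
      refine (hasDerivAt_barrierBase_pow_right a b δ R t s (k + 2)).congr_deriv ?_
      push_cast; ring)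
    (fun t _ s => by
      refine (((hasDerivAt_barrierBase_pow_right a b δ R t s (k + 1)).const_mul
        ((k + 4) / R ^ 2)).neg).congr_deriv ?_
      push_cast; field_simp; ring)
    (fun t _ => by
      have : Continuous fun s => W t s := hWc.comp (f := fun s => (t, s)) (by fun_prop)
      fun_prop)
    (fun t _ s hs => by simp [hWz t s hs]) (fun t _ s hs => by simp [hWz t s hs])
    (fun t _ s hs => by simp [hWz t s hs])
    (fun t _ s => pow_nonneg (barrierBase_nonneg _ _ _ _ _ _) _)
    (fun t ht y hy => hS t (Ioo_subset_Icc_self ht) y hy)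
  choose! D hD hDle using hderiv
  set A : ℝ → ℝ := fun t => ∫ y in closedBall c R, β y * U (t, y) * W t (‖y - c‖ ^ 2) ^ (k + 4)
    with hA
  have hAc : Continuous A := continuous_slice_integral
    (F := fun p => β p.2 * U p * W p.1 (‖p.2 - c‖ ^ 2) ^ (k + 4)) (by fun_prop)
    (isCompact_closedBall c R)
  have hle : a - δ ≤ b + δ := by linarith
  have hAend : ∀ t, t ∉ Ioo (a - δ) (b + δ) → A t = 0 := fun t ht => by
    have : ∀ y, W t (‖y - c‖ ^ 2) = 0 := fun y => by
      by_contra hne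
      exact ht (mem_Ioo_of_edge_lt_one hδ
        (edge_lt_one_of_barrierBase_ne_zero (by positivity) hne).1)
    simp [hA, this]
  set G : ℝ → ℝ := fun x => ∫ y in closedBall c R, U (x, y) * L (x, y) with hG
  have hGc : Continuous G := continuous_slice_integral (F := fun p => U p * L p) (by fun_prop)
    (isCompact_closedBall c R)
  have hGneg : ∫ x in (a - δ)..(b + δ), G x ≤ 0 := by
    have h1 := intervalIntegral.sub_le_integral_of_hasDeriv_right_of_le (φ := fun x => -G x) hle
      hAc.continuousOn (fun x hx => (hD x hx).hasDerivWithinAt)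
      (hGc.neg.continuousOn.integrableOn_Icc) (fun x hx => by
        refine (hDle x hx).trans (neg_le_neg (le_of_eq ?_))
        refine integral_congr_ae (Filter.Eventually.of_forall fun y => ?_)
        simp only [hL, barrierOp]
        ring)
    rw [hAend _ (by simp), hAend _ (by simp), intervalIntegral.integral_neg] at h1
    linarith
  set P : ℝ → ℝ := fun x => ∫ y in closedBall c r, U (x, y) with hP
  have hPc : Continuous P := continuous_slice_integral hUc (isCompact_closedBall c r)
  have hpt : ∀ x, ∀ y, 0 ≤
      (closedBall c r).indicator (fun y => (C + 1) * U (x, y)) y + U (x, y) * L (x, y) ∧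
      (x ∈ Icc a b → y ∈ closedBall c R' → c0 * U (x, y) ≤
      (closedBall c r).indicator (fun y => (C + 1) * U (x, y)) y + U (x, y) * L (x, y)) := by
    intro x y
    have hU0 := hU0 (x, y)
    by_cases hy : y ∈ closedBall c r
    · rw [indicator_of_mem hy]
      have h1 : U (x, y) ≤ (C + 1) * U (x, y) + U (x, y) * L (x, y) := by
        nlinarith [mul_nonneg hU0 (by linarith [(hop x y).2] : 0 ≤ C + L (x, y))]
      refine ⟨hU0.trans h1, fun _ _ => le_trans ?_ h1⟩
      exact mul_le_of_le_one_left hU0 hc01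
    · rw [indicator_of_notMem hy, zero_add]
      rw [mem_closedBall, dist_eq_norm, not_le] at hy
      have h1 := (hop x y).1 (by gcongr)
      refine ⟨mul_nonneg hU0 ((pow_nonneg (barrierBase_nonneg _ _ _ _ _ _) _).trans h1),
        fun hx hy' => ?_⟩
      rw [mul_comm]
      refine mul_le_mul_of_nonneg_left (le_trans ?_ h1) hU0
      rw [mem_closedBall, dist_eq_norm] at hy'
      have h2 : 1 - R' ^ 2 / R ^ 2 ≤ W x (‖y - c‖ ^ 2) := by
        refine le_trans ?_ (le_max_left _ _)
        rw [edge_eq_zero δ hx, sub_zero]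
        gcongr
      exact pow_le_pow_left₀ (by linarith) h2 _
  have i1 : ∀ x, IntegrableOn (fun y => (closedBall c r).indicator
      (fun y => (C + 1) * U (x, y)) y) (closedBall c R) := fun x =>
    ((by fun_prop : Continuous fun y => (C + 1) * U (x, y)).continuousOn.integrableOn_compact
      (isCompact_closedBall c R)).indicator measurableSet_closedBall
  have i2 : ∀ x, IntegrableOn (fun y => U (x, y) * L (x, y)) (closedBall c R) := fun x =>
    (by fun_prop : Continuous fun y => U (x, y) * L (x, y)).continuousOn.integrableOn_compact
      (isCompact_closedBall c R)
  have hPG : ∀ x, (C + 1) * P x + G x = ∫ y in closedBall c R, ((closedBall c r).indicator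
      (fun y => (C + 1) * U (x, y)) y + U (x, y) * L (x, y)) := fun x => by
    rw [integral_add (i1 x) (i2 x),
      setIntegral_indicator measurableSet_closedBall,
      inter_eq_self_of_subset_right (closedBall_subset_closedBall hrR), integral_const_mul]
  set Q : ℝ → ℝ := fun x => ∫ y in closedBall c R', U (x, y) with hQ
  have hQc : Continuous Q := continuous_slice_integral hUc (isCompact_closedBall c R')
  have hQle : ∀ x ∈ Icc a b, c0 * Q x ≤ (C + 1) * P x + G x := fun x hx => by
    rw [hPG, hQ, ← integral_const_mul]
    calc ∫ y in closedBall c R', c0 * U (x, y)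
        ≤ ∫ y in closedBall c R', ((closedBall c r).indicator
          (fun y => (C + 1) * U (x, y)) y + U (x, y) * L (x, y)) := by
          refine setIntegral_mono_on ((by fun_prop :
            Continuous fun y => c0 * U (x, y)).continuousOn.integrableOn_compact
            (isCompact_closedBall c R')) ?_ measurableSet_closedBall
            fun y hy => (hpt x y).2 hx hy
          exact ((i1 x).add (i2 x)).mono_set (closedBall_subset_closedBall hR'.le)
      _ ≤ _ := setIntegral_mono_set ((i1 x).add (i2 x))
          (Filter.Eventually.of_forall fun y => (hpt x y).1)
          (Filter.Eventually.of_forall (closedBall_subset_closedBall hR'.le))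
  have hnn : ∀ x, 0 ≤ (C + 1) * P x + G x := fun x => by
    rw [hPG]; exact setIntegral_nonneg measurableSet_closedBall fun y _ => (hpt x y).1
  have hmain : c0 * ∫ x in a..b, Q x ≤ (C + 1) * ∫ x in (a - δ)..(b + δ), P x := by
    calc c0 * ∫ x in a..b, Q x = ∫ x in a..b, c0 * Q x := by
          rw [intervalIntegral.integral_const_mul]
      _ ≤ ∫ x in a..b, ((C + 1) * P x + G x) :=
          intervalIntegral.integral_mono_on hab ((hQc.const_mul c0).intervalIntegrable _ _)
            (((hPc.const_mul _).add hGc).intervalIntegrable _ _) hQle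
      _ ≤ ∫ x in (a - δ)..(b + δ), ((C + 1) * P x + G x) :=
          intervalIntegral.integral_mono_interval (by linarith) hab (by linarith)
            (Filter.Eventually.of_forall hnn)
            (((hPc.const_mul _).add hGc).intervalIntegrable _ _)
      _ ≤ _ := by
          rw [intervalIntegral.integral_add ((hPc.const_mul _).intervalIntegrable _ _)
            (hGc.intervalIntegrable _ _), intervalIntegral.integral_const_mul]
          linarith
  rw [div_mul_eq_mul_div, le_div_iff₀ hc0']
  linarith

theorem lapY_sub_radial_nonneg_of_isLocalMin {U : ℝ × Euc N → ℝ}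
    (hU : ContDiff ℝ (⊤ : ℕ∞) U) (x : ℝ) (c y : Euc N) (m : ℝ) {h h' h'' : ℝ → ℝ}
    (hh : ∀ s, HasDerivAt h (h' s) s) (hh' : ∀ s, HasDerivAt h' (h'' s) s)
    (hmin : IsLocalMin (fun y => U (x, y) - m * h (‖y - c‖ ^ 2)) y) :
    0 ≤ lapY U (x, y) - m * (4 * ‖y - c‖ ^ 2 * h'' (‖y - c‖ ^ 2) +
      2 * (N - 1 : ℕ) * h' (‖y - c‖ ^ 2)) := by
  rw [← sum_two_mul_add_four_mul_sq, Finset.mul_sum, lapY, ← Finset.sum_sub_distrib]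
  refine Finset.sum_nonneg fun i _ => ?_
  have hU1 := contDiff_fderiv_apply_const hU ((0 : ℝ), EuclideanSpace.single i (1 : ℝ))
  have d1 : ∀ y, HasLineDerivAt ℝ (fun y => U (x, y) - m * h (‖y - c‖ ^ 2))
      (fderiv ℝ U (x, y) ((0 : ℝ), EuclideanSpace.single i (1 : ℝ)) -
        m * (2 * (y - c) i * h' (‖y - c‖ ^ 2))) y (EuclideanSpace.single i (1 : ℝ)) := fun y =>
    HasDerivAt.sub (hasLineDerivAt_slice (hU.differentiable (by simp)) x y _)
      (HasDerivAt.const_mul m (hasLineDerivAt_radial_single hh c i y))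
  refine second_lineDeriv_nonneg_of_isLocalMin hmin d1 ?_
  exact HasDerivAt.sub (hasLineDerivAt_slice (hU1.differentiable (by simp)) x y _)
      (HasDerivAt.const_mul m (hasLineDerivAt_radial_single_single hh' c i y))

/-- Pointwise lower bounds of a nonnegative supersolution spread from a small ball to a large
concentric ball. -/
theorem exists_le_of_le_on_smaller_ball {β : Euc N → ℝ} {B : ℝ}
    (hB : ∀ y, |β y| ≤ B) (c : Euc N) {r R' R : ℝ} (hr : 0 < r) (hrR : r ≤ R) (hR'0 : 0 ≤ R')
    (hR' : R' < R) {δ : ℝ} (hδ : 0 < δ) :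
    ∃ ε > 0, ∀ a b, ∀ U : ℝ × Euc N → ℝ, ContDiff ℝ (⊤ : ℕ∞) U → (∀ p, 0 ≤ U p) →
      (∀ x ∈ Icc (a - δ) (b + δ), ∀ y ∈ closedBall c R,
        lapY U (x, y) + β y * dX U (x, y) ≤ U (x, y)) →
      ∀ m ≥ 0, (∀ x ∈ Icc (a - δ) (b + δ), ∀ y ∈ closedBall c r, m ≤ U (x, y)) →
      ∀ x ∈ Icc a b, ∀ y ∈ closedBall c R', ε * m ≤ U (x, y) := by
  have hR : 0 < R := hr.trans_le hrR
  have hB0 : 0 ≤ B := (abs_nonneg _).trans (hB 0)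
  obtain ⟨k, C, hC, hbar⟩ := exists_barrierOp_bounds (N - 1) hR hr
    (mul_nonneg hB0 (by positivity : 0 ≤ 2 / δ))
  have hc0 : 0 < 1 - R' ^ 2 / R ^ 2 := by
    have : R' ^ 2 / R ^ 2 < 1 := by
      rw [div_lt_one (by positivity)]; gcongr
    linarith
  refine ⟨(1 - R' ^ 2 / R ^ 2) ^ (k + 4), by positivity,
    fun a b U hU hU0 hS m hm hmU x hx y hy => ?_⟩
  have hUc := hU.continuous
  have hUd : Differentiable ℝ U := hU.differentiable (by simp)
  set W := barrierBase a b δ R with hW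
  have hWc : Continuous fun q : ℝ × ℝ => W q.1 q.2 := continuous_barrierBase a b δ R
  have hWc' : Continuous fun p : ℝ × Euc N => W p.1 (‖p.2 - c‖ ^ 2) :=
    hWc.comp (f := fun p : ℝ × Euc N => (p.1, ‖p.2 - c‖ ^ 2)) (by fun_prop)
  set f : ℝ × Euc N → ℝ := fun p => U p - m * W p.1 (‖p.2 - c‖ ^ 2) ^ (k + 4) with hf
  have hfc : Continuous f := by fun_prop
  suffices hfnn : 0 ≤ f (x, y) by
    have h2 : 1 - R' ^ 2 / R ^ 2 ≤ W x (‖y - c‖ ^ 2) := by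
      rw [mem_closedBall, dist_eq_norm] at hy
      refine le_trans ?_ (le_max_left _ _)
      rw [edge_eq_zero δ hx, sub_zero]
      gcongr
    have h3 := pow_le_pow_left₀ hc0.le h2 (k + 4)
    simp only [hf] at hfnn
    nlinarith
  have hxy : (x, y) ∈ Icc (a - δ) (b + δ) ×ˢ closedBall c R :=
    ⟨⟨by linarith [hx.1], by linarith [hx.2]⟩, closedBall_subset_closedBall hR'.le hy⟩
  obtain ⟨⟨x₁, y₁⟩, hp, hmin⟩ := (isCompact_Icc.prod (isCompact_closedBall c R)).exists_isMinOn
    ⟨_, hxy⟩ hfc.continuousOn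
  refine le_trans ?_ (hmin hxy)
  by_contra! hneg
  set s := ‖y₁ - c‖ ^ 2 with hs
  have hs0 : 0 ≤ s := by positivity
  set w := W x₁ s with hw
  have hneg' : U (x₁, y₁) < m * w ^ (k + 4) := by simpa [hf, hw, hs] using hneg
  have hw0 : w ≠ 0 := fun h => by
    rw [h] at hneg'
    simp at hneg'
    exact absurd hneg' (not_lt.2 (hU0 _))
  have hw1 : w ≤ 1 := barrierBase_le_one _ _ _ _ _ hs0
  have hwn : 0 ≤ w := barrierBase_nonneg _ _ _ _ _ _
  obtain ⟨hedge, hsR⟩ := edge_lt_one_of_barrierBase_ne_zero hs0 hw0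
  have hx₁ := mem_Ioo_of_edge_lt_one hδ hedge
  have hy₁ : y₁ ∈ ball c R := by
    rw [mem_ball, dist_eq_norm]
    rw [div_lt_one (by positivity)] at hsR
    exact lt_of_pow_lt_pow_left₀ 2 hR.le hsR
  have hrs : r ^ 2 ≤ s := by
    by_contra! hlt
    have : y₁ ∈ closedBall c r := by
      rw [mem_closedBall, dist_eq_norm]
      exact (lt_of_pow_lt_pow_left₀ 2 hr.le hlt).le
    have h1 := hmU x₁ hp.1 y₁ this
    have h2 : w ^ (k + 4) ≤ 1 := pow_le_one₀ hwn hw1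
    nlinarith
  have hloc : IsLocalMin f (x₁, y₁) := by
    refine hmin.isLocalMin (Filter.mem_of_superset ((isOpen_Ioo.prod isOpen_ball).mem_nhds
      ⟨hx₁, hy₁⟩) (prod_mono Ioo_subset_Icc_self ball_subset_closedBall))
  have hdx : dX U (x₁, y₁) + m * ((k + 4) * edgeDeriv a b δ x₁ * w ^ (k + 3)) = 0 := by
    have h1 : IsLocalMin (fun t => f (t, y₁)) x₁ :=
      (by fun_prop : Continuous fun t : ℝ => (t, y₁)).tendsto x₁ |>.eventually hloc
    have h2 := (hasDerivAt_fst_slice hUd x₁ y₁).sub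
      ((hasDerivAt_barrierBase_pow_left a b δ R x₁ s (k + 2)).const_mul m)
    have h3 := h1.hasDerivAt_eq_zero h2
    push_cast at h3
    rw [← h3]
    ring
  have hlap : 0 ≤ lapY U (x₁, y₁) - m * (4 * s * ((k + 4) * (k + 3) / R ^ 4 * w ^ (k + 2)) +
      2 * (N - 1 : ℕ) * (-((k + 4) / R ^ 2 * w ^ (k + 3)))) := by
    have h1 : IsLocalMin (fun y => f (x₁, y)) y₁ :=
      (by fun_prop : Continuous fun y : Euc N => (x₁, y)).tendsto y₁ |>.eventually hloc
    refine lapY_sub_radial_nonneg_of_isLocalMin hU x₁ c y₁ m (h := fun s => W x₁ s ^ (k + 4))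
      (h' := fun s => -((k + 4) / R ^ 2 * W x₁ s ^ (k + 3)))
      (h'' := fun s => (k + 4) * (k + 3) / R ^ 4 * W x₁ s ^ (k + 2))
      (fun s => ?_) (fun s => ?_) h1
    · refine (hasDerivAt_barrierBase_pow_right a b δ R x₁ s (k + 2)).congr_deriv ?_
      push_cast; ring
    · refine (((hasDerivAt_barrierBase_pow_right a b δ R x₁ s (k + 1)).const_mul
        ((k + 4) / R ^ 2)).neg).congr_deriv ?_
      push_cast; field_simp; ring
  have hop := (hbar s w (-(β y₁ * edgeDeriv a b δ x₁)) hs0 hwn hw1 (fun _ => by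
    rw [abs_neg, abs_mul]
    exact mul_le_mul (hB y₁) (abs_edgeDeriv_le hδ hedge) (abs_nonneg _) hB0)).1 hrs
  have hop' := mul_nonneg hm ((pow_nonneg hwn _).trans hop)
  have hsup := hS x₁ hp.1 y₁ hp.2
  have hβx : β y₁ * dX U (x₁, y₁) =
      -(m * ((k + 4) * (β y₁ * edgeDeriv a b δ x₁) * w ^ (k + 3))) := by
    linear_combination β y₁ * hdx
  rw [hβx] at hsup
  rw [barrierOp] at hop'
  linarith

end Spread

section Parabolic
variable {N : ℕ}

/-- The rate `(b / 4) (τ⁻⁴ + C τ⁻³)` of the approximate heat kernel. -/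
def kernelRate (b C τ : ℝ) : ℝ := b / 4 * ((τ ^ 4)⁻¹ + C * (τ ^ 3)⁻¹)

/-- The Gaussian factor of the approximate heat kernel. -/
def kernelExp (n : ℕ) (M b C τ s : ℝ) : ℝ :=
  Real.exp (-(2 * n * Real.log τ) - M * τ - kernelRate b C τ * s)

/-- The cutoff factor of the approximate heat kernel. -/
def kernelCut (τ s : ℝ) : ℝ := max (1 - s / τ ^ 2) 0

theorem hasDerivAt_kernelRate (b C : ℝ) {τ : ℝ} (hτ : 0 < τ) :
    HasDerivAt (kernelRate b C) (-(b / 4 * (4 * (τ ^ 5)⁻¹ + 3 * C * (τ ^ 4)⁻¹))) τ := by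
  have h1 := (hasDerivAt_pow 4 τ).inv (by positivity)
  have h2 := ((hasDerivAt_pow 3 τ).inv (by positivity)).const_mul C
  refine ((h1.add h2).const_mul (b / 4)).congr_deriv ?_
  push_cast
  field_simp
  ring

theorem hasDerivAt_kernelExp_left (n : ℕ) (M b C s : ℝ) {τ : ℝ} (hτ : 0 < τ) :
    HasDerivAt (fun τ => kernelExp n M b C τ s)
      (kernelExp n M b C τ s * (-(2 * n / τ) - M +
        b / 4 * (4 * (τ ^ 5)⁻¹ + 3 * C * (τ ^ 4)⁻¹) * s)) τ := by
  have h1 := ((((Real.hasDerivAt_log hτ.ne').const_mul (2 * n : ℝ)).neg.sub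
    ((hasDerivAt_id τ).const_mul M)).sub ((hasDerivAt_kernelRate b C hτ).mul_const s)).exp
  refine h1.congr_deriv ?_
  simp only [kernelExp, id]
  congr 1
  ring

theorem hasDerivAt_kernelExp_right (n : ℕ) (M b C τ s : ℝ) :
    HasDerivAt (fun s => kernelExp n M b C τ s)
      (-(kernelRate b C τ * kernelExp n M b C τ s)) s := by
  have h1 := (((hasDerivAt_id s).const_mul (kernelRate b C τ)).const_sub
    (-(2 * n * Real.log τ) - M * τ)).exp
  refine h1.congr_deriv ?_
  simp only [kernelExp, id]
  ring

theorem hasDerivAt_kernelCut_pow_left (k : ℕ) (s : ℝ) {τ : ℝ} (hτ : 0 < τ) :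
    HasDerivAt (fun τ => kernelCut τ s ^ (k + 2))
      ((k + 2) * (2 * s / τ ^ 3) * kernelCut τ s ^ (k + 1)) τ := by
  have h1 := (((hasDerivAt_pow 2 τ).inv (by positivity)).const_mul s).const_sub 1
  refine ((hasDerivAt_max_zero_pow k (1 - s / τ ^ 2)).comp τ h1).congr_deriv ?_
  simp only [kernelCut]
  push_cast
  field_simp

theorem hasDerivAt_kernelCut_pow_right (k : ℕ) (τ s : ℝ) :
    HasDerivAt (fun s => kernelCut τ s ^ (k + 2))
      (-((k + 2) / τ ^ 2 * kernelCut τ s ^ (k + 1))) s := by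
  have h1 := ((hasDerivAt_id s).div_const (τ ^ 2)).const_sub 1
  refine ((hasDerivAt_max_zero_pow k _).comp s h1).congr_deriv ?_
  simp only [kernelCut, id]
  ring

theorem continuousOn_kernelExp (n : ℕ) (M b C : ℝ) {J : Set ℝ} (hJ : J ⊆ Ioi 0) :
    ContinuousOn (fun q : ℝ × ℝ => kernelExp n M b C q.1 q.2) (J ×ˢ univ) := by
  have h0 : ∀ q ∈ J ×ˢ (univ : Set ℝ), q.1 ≠ 0 := fun q hq => (hJ hq.1).ne'
  have h1 : ContinuousOn (fun q : ℝ × ℝ => Real.log q.1) (J ×ˢ univ) :=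
    continuousOn_fst.log h0
  have h2 : ContinuousOn (fun q : ℝ × ℝ => (q.1 ^ 4)⁻¹) (J ×ˢ univ) :=
    (continuousOn_fst.pow 4).inv₀ fun q hq => pow_ne_zero _ (h0 q hq)
  have h3 : ContinuousOn (fun q : ℝ × ℝ => (q.1 ^ 3)⁻¹) (J ×ˢ univ) :=
    (continuousOn_fst.pow 3).inv₀ fun q hq => pow_ne_zero _ (h0 q hq)
  unfold kernelExp kernelRate
  fun_prop

theorem continuousOn_kernelCut {J : Set ℝ} (hJ : J ⊆ Ioi 0) :
    ContinuousOn (fun q : ℝ × ℝ => kernelCut q.1 q.2) (J ×ˢ univ) := by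
  have h1 : ContinuousOn (fun q : ℝ × ℝ => q.2 / q.1 ^ 2) (J ×ˢ univ) :=
    continuousOn_snd.div (continuousOn_fst.pow 2) fun q hq => pow_ne_zero _ (hJ hq.1).ne'
  unfold kernelCut
  exact (continuousOn_const.sub h1).sup continuousOn_const

/-- The algebraic inequality making the approximate heat kernel a subsolution. -/
theorem kernel_subsolution_inequality (n : ℕ) {L B d b β τ D : ℝ} (hL : 0 ≤ L)
    (hd : 0 < d) (hb : d ≤ b) (hbB : b ≤ B) (hβ : d ≤ β) (hτ : 0 < τ) (hτ1 : τ ≤ 1)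
    (hβb : |β - b| ≤ L * τ) (hD : 0 ≤ D) (hD1 : D ≤ 1) :
    β * ((-(2 * n / τ) - (2 * n * L + 2 * n * B * (L / d) + 3 / 2 * (n + 4) ^ 2 + 4) / d +
        b / 4 * (4 * (τ ^ 5)⁻¹ + 3 * (L / d) * (τ ^ 4)⁻¹) * (τ ^ 2 * (1 - D))) * D ^ 3 +
        3 * (2 * (τ ^ 2 * (1 - D)) / τ ^ 3) * D ^ 2) ≤
      4 * τ ^ 3 * (4 * (τ ^ 2 * (1 - D)) * (kernelRate b (L / d) τ ^ 2 * D ^ 3 +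
        6 * kernelRate b (L / d) τ / τ ^ 2 * D ^ 2 + 6 / τ ^ 4 * D) +
        2 * n * (-(kernelRate b (L / d) τ * D ^ 3) - 3 / τ ^ 2 * D ^ 2) - D ^ 3) := by
  set C := L / d with hC
  have hCd : C * d = L := by rw [hC]; field_simp
  have hC0 : 0 ≤ C := by positivity
  set K : ℝ := 2 * n * L + 2 * n * B * C + 3 / 2 * (n + 4) ^ 2 + 4 with hK
  have hβ0 : 0 < β := hd.trans_le hβ
  have hb0 : 0 < b := hd.trans_le hb
  have hσ : 0 ≤ 1 - D := by linarith
  obtain ⟨hlo, hhi⟩ := abs_le.1 hβb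
  have hA : β ≤ b * (1 + C * τ) := by
    have := mul_nonneg (mul_nonneg hC0 hτ.le) (sub_nonneg.2 hb)
    rw [← hCd] at hhi
    linarith
  rw [← sub_nonneg]
  have e : 4 * τ ^ 3 * (4 * (τ ^ 2 * (1 - D)) * (kernelRate b C τ ^ 2 * D ^ 3 +
        6 * kernelRate b C τ / τ ^ 2 * D ^ 2 + 6 / τ ^ 4 * D) +
        2 * n * (-(kernelRate b C τ * D ^ 3) - 3 / τ ^ 2 * D ^ 2) - D ^ 3) -
      β * ((-(2 * n / τ) - K / d +
        b / 4 * (4 * (τ ^ 5)⁻¹ + 3 * C * (τ ^ 4)⁻¹) * (τ ^ 2 * (1 - D))) * D ^ 3 +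
        3 * (2 * (τ ^ 2 * (1 - D)) / τ ^ 3) * D ^ 2) =
      D * (b * (1 - D) * D ^ 2 / τ ^ 3 * (b * (1 + C * τ) ^ 2 - β * (1 + 3 / 4 * (C * τ))) +
        (24 * (b * (1 + C * τ)) - 6 * β) * ((1 - D) * D / τ) +
        (2 * n * ((β - b * (1 + C * τ)) / τ) + K * (β / d) - 4 * τ ^ 3) * D ^ 2 +
        96 * τ * (1 - D) - 24 * n * τ * D) := by
    unfold kernelRate
    field_simp
    ring
  rw [e]
  refine mul_nonneg hD ?_
  have hn : (0 : ℝ) ≤ n := by positivity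
  have hCτ : 0 ≤ C * τ := by positivity
  have t1 : 0 ≤ b * (1 - D) * D ^ 2 / τ ^ 3 *
      (b * (1 + C * τ) ^ 2 - β * (1 + 3 / 4 * (C * τ))) := by
    refine mul_nonneg (by positivity) ?_
    nlinarith [mul_le_mul_of_nonneg_right hA (by positivity : 0 ≤ 1 + C * τ),
      mul_nonneg hβ0.le hCτ]
  have t2 : 0 ≤ (24 * (b * (1 + C * τ)) - 6 * β) * ((1 - D) * D / τ) :=
    mul_nonneg (by linarith) (by positivity)
  have hKpos : 0 ≤ K := by
    have : 0 ≤ B := hb0.le.trans hbB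
    positivity
  have t3 : 3 / 2 * (n + 4) ^ 2 * τ ≤
      2 * n * ((β - b * (1 + C * τ)) / τ) + K * (β / d) - 4 * τ ^ 3 := by
    have h1 : K ≤ K * (β / d) := le_mul_of_one_le_right hKpos ((one_le_div hd).2 hβ)
    have h2 : -(L + B * C) ≤ (β - b * (1 + C * τ)) / τ := by
      rw [le_div_iff₀ hτ]
      linarith [mul_le_mul_of_nonneg_right hbB hCτ]
    have h3 : 2 * n * -(L + B * C) ≤ 2 * n * ((β - b * (1 + C * τ)) / τ) := by gcongr
    have h4 : τ ^ 3 ≤ 1 := pow_le_one₀ hτ.le hτ1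
    have h5 : 3 / 2 * ((n : ℝ) + 4) ^ 2 * τ ≤ 3 / 2 * (n + 4) ^ 2 * 1 := by gcongr
    rw [hK] at h1 ⊢
    linarith
  have t4 := mul_le_mul_of_nonneg_right t3 (sq_nonneg D)
  have t5 : 0 ≤ 3 / 2 * τ * (8 - (n + 4) * D) ^ 2 := by positivity
  linarith

/-- Monotonicity of the approximate heat kernel average of a supersolution. -/
theorem kernel_average_antitone {β : Euc N → ℝ} (hβ : Continuous β) {L B d : ℝ} (hL : 0 ≤ L)
    (hLip : ∀ y y', |β y - β y'| ≤ L * ‖y - y'‖) (hB : ∀ y, |β y| ≤ B) (hd : 0 < d)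
    {y₀ : Euc N} {R : ℝ} (hR : 0 < R) (hR1 : R ≤ 1) (hβd : ∀ y ∈ closedBall y₀ R, d ≤ β y)
    {U : ℝ × Euc N → ℝ} (hU : ContDiff ℝ (⊤ : ℕ∞) U) (hU0 : ∀ p, 0 ≤ U p) {x₀ : ℝ}
    (hS : ∀ x ∈ Ioo x₀ (x₀ + R ^ 4), ∀ y ∈ closedBall y₀ R,
        lapY U (x, y) + β y * dX U (x, y) ≤ U (x, y))
    {M : ℝ} (hM : M = (2 * (N - 1 : ℕ) * L + 2 * (N - 1 : ℕ) * B * (L / d) +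
      3 / 2 * ((N - 1 : ℕ) + 4) ^ 2 + 4) / d) {τ τ₀ : ℝ} (hτ : 0 < τ) (hττ : τ ≤ τ₀)
    (hτ₀ : τ₀ < R) :
    ∫ y in closedBall y₀ R, β y * U (x₀ + τ₀ ^ 4, y) *
        (kernelExp (N - 1) M (β y₀) (L / d) τ₀ (‖y - y₀‖ ^ 2) *
          kernelCut τ₀ (‖y - y₀‖ ^ 2) ^ 3) ≤
      ∫ y in closedBall y₀ R, β y * U (x₀ + τ ^ 4, y) *
        (kernelExp (N - 1) M (β y₀) (L / d) τ (‖y - y₀‖ ^ 2) *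
          kernelCut τ (‖y - y₀‖ ^ 2) ^ 3) := by
  set b := β y₀ with hb
  set C := L / d with hC
  have hJ : Ioo 0 R ⊆ Ioi (0 : ℝ) := Ioo_subset_Ioi_self
  have cE := continuousOn_kernelExp (N - 1) M b C hJ
  have cD := continuousOn_kernelCut hJ
  have h0 : ∀ q ∈ Ioo 0 R ×ˢ (univ : Set ℝ), q.1 ≠ 0 := fun q hq => (hJ hq.1).ne'
  have hz : ∀ t ∈ Ioo 0 R, ∀ s, t ^ 2 ≤ s → kernelCut t s = 0 := fun t ht s hs =>
    max_eq_right (by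
      have : 1 ≤ s / t ^ 2 := (one_le_div (by have := ht.1; positivity)).2 hs
      linarith)
  have hz' : ∀ t ∈ Ioo 0 R, ∀ s, R ^ 2 ≤ s → kernelCut t s = 0 := fun t ht s hs =>
    hz t ht s ((pow_le_pow_left₀ ht.1.le ht.2.le 2).trans hs)
  refine antitoneOn_slice_functional hβ hU hU0 hR.le (J := Ioo 0 R) isOpen_Ioo
    (ξ := fun t => x₀ + t ^ 4) (ξ' := fun t => 4 * t ^ 3)
    (H := fun t s => kernelExp (N - 1) M b C t s * kernelCut t s ^ 3)
    (Ht := fun t s => kernelExp (N - 1) M b C t s * ((-(2 * (N - 1 : ℕ) / t) - M +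
        b / 4 * (4 * (t ^ 5)⁻¹ + 3 * C * (t ^ 4)⁻¹) * s) * kernelCut t s ^ 3 +
        3 * (2 * s / t ^ 3) * kernelCut t s ^ 2))
    (Hs := fun t s => kernelExp (N - 1) M b C t s *
      (-(kernelRate b C t * kernelCut t s ^ 3) - 3 / t ^ 2 * kernelCut t s ^ 2))
    (Hss := fun t s => kernelExp (N - 1) M b C t s *
      (kernelRate b C t ^ 2 * kernelCut t s ^ 3 +
        6 * kernelRate b C t / t ^ 2 * kernelCut t s ^ 2 + 6 / t ^ 4 * kernelCut t s))
    ?_ (by fun_prop) ?_ ?_ (cE.mul (cD.pow 3)) ?_ ?_ ?_ ?_ ?_ ?_ ?_ ?_ ?_ ?_ hττ ?_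
  · intro t _
    refine ((hasDerivAt_pow 4 t).const_add x₀).congr_deriv ?_
    norm_num
  · intro t ht
    have := ht.1
    positivity
  · intro t ht s
    refine ((hasDerivAt_kernelExp_left (N - 1) M b C s ht.1).mul
      (hasDerivAt_kernelCut_pow_left 1 s ht.1)).congr_deriv ?_
    push_cast
    ring
  · have c1 : ContinuousOn (fun q : ℝ × ℝ => (2 * (N - 1 : ℕ) : ℝ) / q.1) (Ioo 0 R ×ˢ univ) :=
      continuousOn_const.div continuousOn_fst h0
    have c2 : ∀ k, ContinuousOn (fun q : ℝ × ℝ => (q.1 ^ k)⁻¹) (Ioo 0 R ×ˢ univ) := fun k =>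
      (continuousOn_fst.pow k).inv₀ fun q hq => pow_ne_zero _ (h0 q hq)
    have c4 := c2 4
    have c5 := c2 5
    have c3 : ContinuousOn (fun q : ℝ × ℝ => 2 * q.2 / q.1 ^ 3) (Ioo 0 R ×ˢ univ) :=
      (by fun_prop : ContinuousOn (fun q : ℝ × ℝ => 2 * q.2) _).div (by fun_prop)
        fun q hq => pow_ne_zero _ (h0 q hq)
    fun_prop
  · intro t ht s
    refine ((hasDerivAt_kernelExp_right (N - 1) M b C t s).mul
      (hasDerivAt_kernelCut_pow_right 1 t s)).congr_deriv ?_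
    push_cast
    ring
  · intro t ht s
    have ht0 := ht.1
    refine ((hasDerivAt_kernelExp_right (N - 1) M b C t s).mul
      (((hasDerivAt_kernelCut_pow_right 1 t s).const_mul (kernelRate b C t)).neg.sub
        ((hasDerivAt_kernelCut_pow_right 0 t s).const_mul (3 / t ^ 2)))).congr_deriv ?_
    simp only [Pi.sub_apply, Pi.neg_apply]
    push_cast
    field_simp
    ring
  · intro t ht
    have k1 : Continuous fun s => kernelExp (N - 1) M b C t s :=
      continuous_iff_continuousAt.2 fun s =>
        (hasDerivAt_kernelExp_right (N - 1) M b C t s).continuousAt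
    have k2 : Continuous fun s => kernelCut t s := by unfold kernelCut; fun_prop
    fun_prop
  · intro t ht s hs
    simp [hz' t ht s hs]
  · intro t ht s hs
    simp [hz' t ht s hs]
  · intro t ht s hs
    simp [hz' t ht s hs]
  · intro t ht s
    exact mul_nonneg (Real.exp_pos _).le (pow_nonneg (le_max_right _ _) _)
  · intro t ht y hy
    refine hS _ ⟨?_, ?_⟩ y hy
    · have := ht.1
      have : 0 < t ^ 4 := by positivity
      linarith
    · have := pow_lt_pow_left₀ ht.2 ht.1.le (by norm_num : 4 ≠ 0)
      linarith
  · intro t ht y hy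
    have ht0 := ht.1
    set s := ‖y - y₀‖ ^ 2 with hs
    set D := kernelCut t s with hD
    by_cases hlt : t ^ 2 ≤ s
    · have hD0 : D = 0 := hz t ht s hlt
      simp [hD0]
    push Not at hlt
    have hs0 : 0 ≤ s := by positivity
    have hD0 : 0 ≤ D := le_max_right _ _
    have hDe : D = 1 - s / t ^ 2 := max_eq_left (by
      have : s / t ^ 2 ≤ 1 := (div_le_one (by positivity)).2 hlt.le
      linarith)
    have hD1 : D ≤ 1 := by rw [hDe]; linarith [div_nonneg hs0 (sq_nonneg t)]
    have hse : s = t ^ 2 * (1 - D) := by rw [hDe]; field_simp; ring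
    have hyt : ‖y - y₀‖ ≤ t := le_of_lt (lt_of_pow_lt_pow_left₀ 2 ht0.le hlt)
    have key := kernel_subsolution_inequality (N - 1) (β := β y) hL hd
      (hβd y₀ (mem_closedBall_self hR.le)) ((le_abs_self _).trans (hB y₀)) (hβd y hy) ht0
      (ht.2.le.trans hR1) ((hLip y y₀).trans (by gcongr)) hD0 hD1
    rw [← hse, ← hM] at key
    have := mul_le_mul_of_nonneg_left key (Real.exp_pos (-(2 * (N - 1 : ℕ) * Real.log t) - M * t -
      kernelRate b C t * s)).le
    change kernelExp (N - 1) M b C t s * _ ≤ kernelExp (N - 1) M b C t s * _ at this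
    refine le_trans (le_of_eq ?_) (this.trans (le_of_eq ?_)) <;> ring
  · intro t ht
    exact ⟨hτ.trans_le ht.1, ht.2.trans_lt hτ₀⟩

theorem integrable_rexp_neg_mul_sq_norm_sub {k : ℝ} (hk : 0 < k) (y₀ : Euc N) :
    Integrable fun y : Euc N => Real.exp (-k * ‖y - y₀‖ ^ 2) := by
  have h : Integrable fun y : Euc N => Real.exp (-k * ‖y‖ ^ 2) := by
    refine Integrable.of_integral_ne_zero ?_
    rw [GaussianFourier.integral_rexp_neg_mul_sq_norm hk]
    positivity
  exact h.comp_sub_right y₀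

theorem kernelExp_pos (n : ℕ) (M b C τ s : ℝ) : 0 < kernelExp n M b C τ s := Real.exp_pos _

theorem integral_kernelExp_le {M b C d τ : ℝ} (hM : 0 ≤ M) (hd : 0 < d) (hb : d ≤ b)
    (hC : 0 ≤ C) (hτ : 0 < τ) (y₀ : Euc N) (K : Set (Euc N)) :
    IntegrableOn (fun y => kernelExp (N - 1) M b C τ (‖y - y₀‖ ^ 2)) K ∧
    ∫ y in K, kernelExp (N - 1) M b C τ (‖y - y₀‖ ^ 2) ≤
      (4 * Real.pi / d) ^ (((N - 1 : ℕ) : ℝ) / 2) := by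
  set k : ℝ := d / 4 * (τ ^ 4)⁻¹ with hk
  have hk0 : 0 < k := by positivity
  have hle : ∀ y, kernelExp (N - 1) M b C τ (‖y - y₀‖ ^ 2) ≤
      Real.exp (-(2 * (N - 1 : ℕ) * Real.log τ)) * Real.exp (-k * ‖y - y₀‖ ^ 2) := fun y => by
    rw [kernelExp, ← Real.exp_add, Real.exp_le_exp]
    have h1 : k ≤ kernelRate b C τ := by
      unfold kernelRate
      have : 0 ≤ C * (τ ^ 3)⁻¹ := by positivity
      rw [hk]
      exact mul_le_mul (by linarith) (le_add_of_nonneg_right this) (by positivity)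
        (by linarith)
    have h2 : k * ‖y - y₀‖ ^ 2 ≤ kernelRate b C τ * ‖y - y₀‖ ^ 2 := by gcongr
    have h3 : 0 ≤ M * τ := by positivity
    linarith
  have hinteg := (integrable_rexp_neg_mul_sq_norm_sub hk0 y₀).const_mul
    (Real.exp (-(2 * (N - 1 : ℕ) * Real.log τ)))
  have hcont : Continuous fun y : Euc N => kernelExp (N - 1) M b C τ (‖y - y₀‖ ^ 2) := by
    unfold kernelExp; fun_prop
  have hinteg' : Integrable fun y : Euc N => kernelExp (N - 1) M b C τ (‖y - y₀‖ ^ 2) := by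
    refine hinteg.mono hcont.aestronglyMeasurable (Filter.Eventually.of_forall fun y => ?_)
    rw [Real.norm_of_nonneg (kernelExp_pos _ _ _ _ _ _).le, Real.norm_of_nonneg (by positivity)]
    exact hle y
  refine ⟨hinteg'.integrableOn, ?_⟩
  calc ∫ y in K, kernelExp (N - 1) M b C τ (‖y - y₀‖ ^ 2)
      ≤ ∫ y, kernelExp (N - 1) M b C τ (‖y - y₀‖ ^ 2) :=
        setIntegral_le_integral hinteg' (Filter.Eventually.of_forall fun y => (Real.exp_pos _).le)
    _ ≤ ∫ y, Real.exp (-(2 * (N - 1 : ℕ) * Real.log τ)) * Real.exp (-k * ‖y - y₀‖ ^ 2) :=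
        integral_mono hinteg' hinteg hle
    _ = (4 * Real.pi / d) ^ (((N - 1 : ℕ) : ℝ) / 2) := by
        rw [integral_const_mul,
          integral_sub_right_eq_self (fun y : Euc N => Real.exp (-k * ‖y‖ ^ 2)) y₀,
          GaussianFourier.integral_rexp_neg_mul_sq_norm hk0, finrank_euclideanSpace,
          Fintype.card_fin]
        have e : Real.pi / k = 4 * Real.pi / d * τ ^ 4 := by rw [hk]; field_simp
        rw [e, Real.mul_rpow (by positivity) (by positivity),
          Real.rpow_def_of_pos (by positivity : 0 < τ ^ 4), Real.log_pow, mul_left_comm,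
          ← Real.exp_add]
        have : -(2 * ((N - 1 : ℕ) : ℝ) * Real.log τ) +
            ((4 : ℕ) : ℝ) * Real.log τ * (((N - 1 : ℕ) : ℝ) / 2) = 0 := by
          push_cast; ring
        rw [this, Real.exp_zero, mul_one]

/-- A supersolution is bounded below at a point by its mass on a later slice, where `β` is
positive. -/
theorem exists_slice_mass_le_value {β : Euc N → ℝ} (hβ : Continuous β) {L B d : ℝ}
    (hL : 0 ≤ L) (hLip : ∀ y y', |β y - β y'| ≤ L * ‖y - y'‖) (hB : ∀ y, |β y| ≤ B)
    (hd : 0 < d) {R τ₀ : ℝ} (hτ₀ : 0 < τ₀) (hτ₀R : τ₀ < R) (hR1 : R ≤ 1) :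
    ∃ C > 0, ∀ y₀ : Euc N, (∀ y ∈ closedBall y₀ R, d ≤ β y) →
      ∀ U : ℝ × Euc N → ℝ, ContDiff ℝ (⊤ : ℕ∞) U → (∀ p, 0 ≤ U p) → ∀ x₀,
      (∀ x ∈ Ioo x₀ (x₀ + R ^ 4), ∀ y ∈ closedBall y₀ R,
        lapY U (x, y) + β y * dX U (x, y) ≤ U (x, y)) →
      ∫ y in closedBall y₀ (3 / 4 * τ₀), U (x₀ + τ₀ ^ 4, y) ≤ C * U (x₀, y₀) := by
  have hR : 0 < R := hτ₀.trans hτ₀R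
  have hB0 : 0 ≤ B := (abs_nonneg _).trans (hB 0)
  set M : ℝ := (2 * (N - 1 : ℕ) * L + 2 * (N - 1 : ℕ) * B * (L / d) +
      3 / 2 * ((N - 1 : ℕ) + 4) ^ 2 + 4) / d with hM
  have hM0 : 0 ≤ M := by positivity
  set G : ℝ := (4 * Real.pi / d) ^ (((N - 1 : ℕ) : ℝ) / 2) with hG
  have hG0 : 0 < G := by positivity
  set e₀ : ℝ := kernelExp (N - 1) M B (L / d) τ₀ (τ₀ ^ 2) with he₀
  have he₀pos : 0 < e₀ := Real.exp_pos _
  set κ : ℝ := d * (e₀ * (7 / 16) ^ 3) with hκ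
  have hκ0 : 0 < κ := by positivity
  refine ⟨(B + 1) * G / κ, by positivity, fun y₀ hβd U hU hU0 x₀ hS => ?_⟩
  have hUc := hU.continuous
  have hb : d ≤ β y₀ := hβd y₀ (mem_closedBall_self hR.le)
  have hbB : β y₀ ≤ B := (le_abs_self _).trans (hB y₀)
  have hcut0 : ∀ τ s, 0 ≤ kernelCut τ s := fun τ s => le_max_right _ _
  have hcont : ∀ τ, Continuous fun y : Euc N =>
      kernelExp (N - 1) M (β y₀) (L / d) τ (‖y - y₀‖ ^ 2) * kernelCut τ (‖y - y₀‖ ^ 2) ^ 3 :=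
    fun τ => by unfold kernelExp kernelCut; fun_prop
  have hI : ∀ τ, IntegrableOn (fun y : Euc N => β y * U (x₀ + τ ^ 4, y) *
      (kernelExp (N - 1) M (β y₀) (L / d) τ (‖y - y₀‖ ^ 2) * kernelCut τ (‖y - y₀‖ ^ 2) ^ 3))
      (closedBall y₀ R) := fun τ => by
    have := hcont τ
    exact (by fun_prop : Continuous fun y : Euc N => β y * U (x₀ + τ ^ 4, y) *
      (kernelExp (N - 1) M (β y₀) (L / d) τ (‖y - y₀‖ ^ 2) *
        kernelCut τ (‖y - y₀‖ ^ 2) ^ 3)).continuousOn.integrableOn_compact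
      (isCompact_closedBall y₀ R)
  have hsubset : closedBall y₀ (3 / 4 * τ₀) ⊆ closedBall y₀ R :=
    closedBall_subset_closedBall (by linarith)
  have hlower : κ * ∫ y in closedBall y₀ (3 / 4 * τ₀), U (x₀ + τ₀ ^ 4, y) ≤
      ∫ y in closedBall y₀ R, β y * U (x₀ + τ₀ ^ 4, y) *
        (kernelExp (N - 1) M (β y₀) (L / d) τ₀ (‖y - y₀‖ ^ 2) *
          kernelCut τ₀ (‖y - y₀‖ ^ 2) ^ 3) := by
    rw [← integral_const_mul]
    refine le_trans (setIntegral_mono_on ?_ ((hI τ₀).mono_set hsubset) measurableSet_closedBall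
      fun y hy => ?_) (setIntegral_mono_set (hI τ₀) ?_ (Filter.Eventually.of_forall hsubset))
    · exact (by fun_prop : Continuous fun y : Euc N =>
        κ * U (x₀ + τ₀ ^ 4, y)).continuousOn.integrableOn_compact (isCompact_closedBall _ _)
    · have hβy := hβd y (hsubset hy)
      rw [mem_closedBall, dist_eq_norm] at hy
      have h1 : ‖y - y₀‖ ^ 2 ≤ (3 / 4 * τ₀) ^ 2 := by gcongr
      have h2 : e₀ ≤ kernelExp (N - 1) M (β y₀) (L / d) τ₀ (‖y - y₀‖ ^ 2) := by
        rw [he₀, kernelExp, kernelExp, Real.exp_le_exp]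
        have h3 : kernelRate (β y₀) (L / d) τ₀ ≤ kernelRate B (L / d) τ₀ := by
          unfold kernelRate; gcongr
        have h4 : 0 ≤ kernelRate B (L / d) τ₀ := by unfold kernelRate; positivity
        have h5 : ‖y - y₀‖ ^ 2 ≤ τ₀ ^ 2 := h1.trans (by gcongr; linarith)
        have := mul_le_mul h3 h5 (by positivity) h4
        linarith
      have h6 : 7 / 16 ≤ kernelCut τ₀ (‖y - y₀‖ ^ 2) := by
        refine le_trans ?_ (le_max_left _ _)
        have : ‖y - y₀‖ ^ 2 / τ₀ ^ 2 ≤ 9 / 16 := by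
          rw [div_le_iff₀ (by positivity)]; linarith
        linarith
      have h9 := kernelExp_pos (N - 1) M (β y₀) (L / d) τ₀ (‖y - y₀‖ ^ 2)
      have h7 : e₀ * (7 / 16) ^ 3 ≤ kernelExp (N - 1) M (β y₀) (L / d) τ₀ (‖y - y₀‖ ^ 2) *
          kernelCut τ₀ (‖y - y₀‖ ^ 2) ^ 3 := by gcongr
      have h8 := hU0 (x₀ + τ₀ ^ 4, y)
      calc κ * U (x₀ + τ₀ ^ 4, y) = d * U (x₀ + τ₀ ^ 4, y) * (e₀ * (7 / 16) ^ 3) := by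
            rw [hκ]; ring
        _ ≤ _ := by gcongr; exact mul_nonneg (hd.le.trans hβy) h8
    · refine (ae_restrict_iff' measurableSet_closedBall).2 (Filter.Eventually.of_forall ?_)
      intro y hy
      have := hd.le.trans (hβd y hy)
      exact mul_nonneg (mul_nonneg this (hU0 _))
        (mul_nonneg (Real.exp_pos _).le (pow_nonneg (hcut0 _ _) _))
  have hupper : ∀ ε > 0, ∫ y in closedBall y₀ R, β y * U (x₀ + τ₀ ^ 4, y) *
        (kernelExp (N - 1) M (β y₀) (L / d) τ₀ (‖y - y₀‖ ^ 2) *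
          kernelCut τ₀ (‖y - y₀‖ ^ 2) ^ 3) ≤ B * (U (x₀, y₀) + ε) * G := by
    intro ε hε
    obtain ⟨η, hη, hnear⟩ := Metric.continuousAt_iff.1 (hUc.continuousAt (x := (x₀, y₀))) ε hε
    obtain ⟨τ, hτ0, hτη⟩ : ∃ τ, 0 < τ ∧ τ < η ∧ τ ≤ τ₀ :=
      ⟨min (η / 2) τ₀, by positivity, (min_le_left _ _).trans_lt (by linarith), min_le_right _ _⟩
    have hτ1 : τ ≤ 1 := hτη.2.trans (hτ₀R.le.trans hR1)
    refine (kernel_average_antitone hβ hL hLip hB hd hR hR1 hβd hU hU0 hS hM hτ0 hτη.2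
      hτ₀R).trans ?_
    obtain ⟨hEi, hEle⟩ := integral_kernelExp_le (N := N) hM0 hd hb
      (by positivity : 0 ≤ L / d) hτ0 y₀
      (closedBall y₀ R)
    have hUε : 0 ≤ U (x₀, y₀) + ε := add_nonneg (hU0 _) hε.le
    calc _ ≤ ∫ y in closedBall y₀ R, B * (U (x₀, y₀) + ε) *
          kernelExp (N - 1) M (β y₀) (L / d) τ (‖y - y₀‖ ^ 2) := by
          refine setIntegral_mono_on (hI τ) (hEi.const_mul _) measurableSet_closedBall
            fun y hy => ?_
          have hE0 : 0 < kernelExp (N - 1) M (β y₀) (L / d) τ (‖y - y₀‖ ^ 2) := Real.exp_pos _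
          by_cases hyτ : ‖y - y₀‖ < τ
          · have h1 : U (x₀ + τ ^ 4, y) ≤ U (x₀, y₀) + ε := by
              have : dist (x₀ + τ ^ 4, y) (x₀, y₀) < η := by
                rw [Prod.dist_eq, max_lt_iff]
                constructor
                · rw [Real.dist_eq, add_sub_cancel_left, abs_of_pos (by positivity)]
                  exact (pow_le_of_le_one hτ0.le hτ1 (by norm_num)).trans_lt hτη.1
                · rw [dist_eq_norm]; exact hyτ.trans hτη.1
              have := hnear this
              rw [Real.dist_eq] at this
              linarith [(abs_lt.1 this).2]
            have h2 : kernelCut τ (‖y - y₀‖ ^ 2) ^ 3 ≤ 1 := by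
              refine pow_le_one₀ (hcut0 _ _) (max_le ?_ zero_le_one)
              have : 0 ≤ ‖y - y₀‖ ^ 2 / τ ^ 2 := by positivity
              linarith
            have h3 : β y ≤ B := (le_abs_self _).trans (hB y)
            have h4 := hU0 (x₀ + τ ^ 4, y)
            have h5 := hE0.le
            have h6 := pow_nonneg (hcut0 τ (‖y - y₀‖ ^ 2)) 3
            refine mul_le_mul (mul_le_mul h3 h1 h4 hB0) (mul_le_of_le_one_right h5 h2)
              (mul_nonneg h5 h6) (by positivity)
          · have : kernelCut τ (‖y - y₀‖ ^ 2) = 0 := by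
              refine max_eq_right ?_
              have : 1 ≤ ‖y - y₀‖ ^ 2 / τ ^ 2 := by
                rw [one_le_div (by positivity)]
                exact pow_le_pow_left₀ hτ0.le (not_lt.1 hyτ) 2
              linarith
            rw [this]
            simp only [ne_eq, OfNat.ofNat_ne_zero, not_false_eq_true, zero_pow, mul_zero]
            positivity
      _ ≤ B * (U (x₀, y₀) + ε) * G := by
          rw [integral_const_mul]
          gcongr
  have hfin : κ * ∫ y in closedBall y₀ (3 / 4 * τ₀), U (x₀ + τ₀ ^ 4, y) ≤
      B * G * U (x₀, y₀) := by
    refine le_of_forall_pos_le_add fun ε hε => ?_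
    have hBG : 0 < B * G + 1 := by positivity
    have := hlower.trans (hupper (ε / (B * G + 1)) (by positivity))
    have h2 : B * G * (ε / (B * G + 1)) ≤ ε := by
      rw [mul_div_assoc', div_le_iff₀ hBG]
      nlinarith
    linarith
  rw [div_mul_eq_mul_div (_ * _), le_div_iff₀ hκ0]
  nlinarith [mul_nonneg hG0.le (hU0 (x₀, y₀))]

/-- Backward propagation of the mass of a supersolution where `β` is positive. -/
theorem exists_slice_mass_le_slice_mass {β : Euc N → ℝ} (hβ : Continuous β) {B d : ℝ}
    (hB : ∀ y, |β y| ≤ B) (hd : 0 < d) {c : Euc N} {ρ : ℝ} (hρ : 0 < ρ)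
    (hβd : ∀ y ∈ closedBall c ρ, d ≤ β y) (T : ℝ) :
    ∃ C > 0, ∀ U : ℝ × Euc N → ℝ, ContDiff ℝ (⊤ : ℕ∞) U → (∀ p, 0 ≤ U p) → ∀ p q,
      (∀ x ∈ Ioo p q, ∀ y ∈ closedBall c ρ,
        lapY U (x, y) + β y * dX U (x, y) ≤ U (x, y)) →
      ∀ x' x, p < x' → x' ≤ x → x < q → x - x' ≤ T →
      ∫ y in closedBall c (ρ / 2), U (x, y) ≤ C * ∫ y in closedBall c ρ, U (x', y) := by
  have hB0 : 0 ≤ B := (abs_nonneg _).trans (hB 0)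
  set l : ℝ := (1 + 3 / 8 * ((N - 1 : ℕ) + 4) ^ 2 / ρ ^ 2) / d with hl
  have hl0 : 0 < l := by positivity
  set κ : ℝ := d * (3 / 4) ^ 3 with hκ
  have hκ0 : 0 < κ := by positivity
  refine ⟨(B + 1) * Real.exp (l * T) / κ, by positivity,
    fun U hU hU0 p q hS x' x hp hx'x hq hT => ?_⟩
  have hUc := hU.continuous
  have hz : ∀ s, ρ ^ 2 ≤ s → kernelCut ρ s = 0 := fun s hs =>
    max_eq_right (by
      have : 1 ≤ s / ρ ^ 2 := (one_le_div (by positivity)).2 hs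
      linarith)
  have hcut0 : ∀ s, 0 ≤ kernelCut ρ s := fun s => le_max_right _ _
  have cD : Continuous (kernelCut ρ) := by unfold kernelCut; fun_prop
  have hanti := antitoneOn_slice_functional hβ hU hU0 hρ.le (c := c) (J := Ioo p q) isOpen_Ioo
    (ξ := fun t => t) (ξ' := fun _ => 1)
    (H := fun t s => Real.exp (-(l * t)) * kernelCut ρ s ^ 3)
    (Ht := fun t s => -l * (Real.exp (-(l * t)) * kernelCut ρ s ^ 3))
    (Hs := fun t s => Real.exp (-(l * t)) * (-(3 / ρ ^ 2 * kernelCut ρ s ^ 2)))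
    (Hss := fun t s => Real.exp (-(l * t)) * (6 / ρ ^ 4 * kernelCut ρ s))
    (fun t _ => hasDerivAt_id t) continuousOn_const (fun _ _ => zero_le_one)
    (fun t _ s => by
      have := ((hasDerivAt_id t).const_mul l).neg.exp.mul_const (kernelCut ρ s ^ 3)
      refine this.congr_deriv ?_
      simp only [Pi.neg_apply, id]
      ring)
    (by fun_prop) (by fun_prop)
    (fun t _ s => by
      refine ((hasDerivAt_kernelCut_pow_right 1 ρ s).const_mul _).congr_deriv ?_
      push_cast; ring)
    (fun t _ s => by
      refine (((hasDerivAt_kernelCut_pow_right 0 ρ s).const_mul (3 / ρ ^ 2)).neg.const_mul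
        _).congr_deriv ?_
      push_cast; field_simp; ring)
    (fun t _ => by fun_prop)
    (fun t _ s hs => by simp [hz s hs]) (fun t _ s hs => by simp [hz s hs])
    (fun t _ s hs => by simp [hz s hs])
    (fun t _ s => mul_nonneg (Real.exp_pos _).le (pow_nonneg (hcut0 s) _)) hS
    (fun t ht y hy => by
      set s := ‖y - c‖ ^ 2 with hs
      set D := kernelCut ρ s with hD
      have hs0 : 0 ≤ s := by positivity
      have hD0 : 0 ≤ D := hcut0 s
      have hβy := hβd y hy
      rw [mem_closedBall, dist_eq_norm] at hy
      have hsρ : s ≤ ρ ^ 2 := by rw [hs]; gcongr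
      have hDe : D = 1 - s / ρ ^ 2 := max_eq_left (by
        have : s / ρ ^ 2 ≤ 1 := (div_le_one (by positivity)).2 hsρ
        linarith)
      have hse : s = ρ ^ 2 * (1 - D) := by rw [hDe]; field_simp; ring
      have h1 : 1 + 3 / 8 * (((N - 1 : ℕ) : ℝ) + 4) ^ 2 / ρ ^ 2 ≤ β y * l := by
        rw [hl, mul_div_assoc', le_div_iff₀ hd, mul_comm]
        gcongr
      have h2 : 0 ≤ D / ρ ^ 2 * (3 / 8 * (8 - (((N - 1 : ℕ) : ℝ) + 4) * D) ^ 2) := by positivity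
      have h3 := mul_le_mul_of_nonneg_right h1 (pow_nonneg hD0 3)
      have e : 4 * s * (6 / ρ ^ 4 * D) + 2 * (N - 1 : ℕ) * (-(3 / ρ ^ 2 * D ^ 2)) - D ^ 3 +
          (1 + 3 / 8 * (((N - 1 : ℕ) : ℝ) + 4) ^ 2 / ρ ^ 2) * D ^ 3 =
          D / ρ ^ 2 * (3 / 8 * (8 - (((N - 1 : ℕ) : ℝ) + 4) * D) ^ 2) := by
        rw [hse]; field_simp; ring
      have h4 : -(β y * l * D ^ 3) ≤
          4 * s * (6 / ρ ^ 4 * D) + 2 * (N - 1 : ℕ) * (-(3 / ρ ^ 2 * D ^ 2)) - D ^ 3 := by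
        linarith
      have := mul_le_mul_of_nonneg_left h4 (Real.exp_pos (-(l * t))).le
      refine le_trans (le_of_eq ?_) (this.trans (le_of_eq ?_)) <;> ring)
    hx'x (fun t ht => ⟨hp.trans_le ht.1, ht.2.trans_lt hq⟩)
  have e : ∀ t, ∫ y in closedBall c ρ, β y * U (t, y) *
      (Real.exp (-(l * t)) * kernelCut ρ (‖y - c‖ ^ 2) ^ 3) =
      Real.exp (-(l * t)) * ∫ y in closedBall c ρ, β y * U (t, y) *
        kernelCut ρ (‖y - c‖ ^ 2) ^ 3 := fun t => by
    rw [← integral_const_mul]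
    congr 1 with y
    ring
  simp only [e] at hanti
  have hI : ∀ t, IntegrableOn (fun y => β y * U (t, y) * kernelCut ρ (‖y - c‖ ^ 2) ^ 3)
      (closedBall c ρ) := fun t =>
    (by fun_prop : Continuous fun y : Euc N =>
      β y * U (t, y) * kernelCut ρ (‖y - c‖ ^ 2) ^ 3).continuousOn.integrableOn_compact
      (isCompact_closedBall _ _)
  have hUI : ∀ (k : ℝ) t ρ, IntegrableOn (fun y => k * U (t, y)) (closedBall c ρ) := fun k t ρ =>
    (by fun_prop : Continuous fun y : Euc N => k * U (t, y)).continuousOn.integrableOn_compact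
      (isCompact_closedBall _ _)
  have hsubset : closedBall c (ρ / 2) ⊆ closedBall c ρ :=
    closedBall_subset_closedBall (by linarith)
  have hlower : κ * ∫ y in closedBall c (ρ / 2), U (x, y) ≤
      ∫ y in closedBall c ρ, β y * U (x, y) * kernelCut ρ (‖y - c‖ ^ 2) ^ 3 := by
    rw [← integral_const_mul]
    refine le_trans (setIntegral_mono_on (hUI _ _ _) ((hI x).mono_set hsubset)
      measurableSet_closedBall
      fun y hy => ?_) (setIntegral_mono_set (hI x) ?_ (Filter.Eventually.of_forall hsubset))
    · have hβy := hβd y (hsubset hy)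
      rw [mem_closedBall, dist_eq_norm] at hy
      have h1 : ‖y - c‖ ^ 2 ≤ (ρ / 2) ^ 2 := by gcongr
      have h6 : 3 / 4 ≤ kernelCut ρ (‖y - c‖ ^ 2) := by
        refine le_trans ?_ (le_max_left _ _)
        have : ‖y - c‖ ^ 2 / ρ ^ 2 ≤ 1 / 4 := by
          rw [div_le_iff₀ (by positivity)]; linarith
        linarith
      have h8 := hU0 (x, y)
      calc κ * U (x, y) = d * U (x, y) * (3 / 4) ^ 3 := by
            rw [hκ]; ring
        _ ≤ _ := by gcongr; exact mul_nonneg (hd.le.trans hβy) h8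
    · refine (ae_restrict_iff' measurableSet_closedBall).2 (Filter.Eventually.of_forall ?_)
      intro y hy
      have := hd.le.trans (hβd y hy)
      exact mul_nonneg (mul_nonneg this (hU0 _)) (pow_nonneg (hcut0 _) _)
  have hupper : ∫ y in closedBall c ρ, β y * U (x', y) * kernelCut ρ (‖y - c‖ ^ 2) ^ 3 ≤
      (B + 1) * ∫ y in closedBall c ρ, U (x', y) := by
    rw [← integral_const_mul]
    refine setIntegral_mono_on (hI x') (hUI _ _ _) measurableSet_closedBall fun y hy => ?_
    have h2 : kernelCut ρ (‖y - c‖ ^ 2) ^ 3 ≤ 1 := by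
      refine pow_le_one₀ (hcut0 _) (max_le ?_ zero_le_one)
      have : 0 ≤ ‖y - c‖ ^ 2 / ρ ^ 2 := by positivity
      linarith
    have h3 : β y ≤ B + 1 := ((le_abs_self _).trans (hB y)).trans (by linarith)
    have h4 := hU0 (x', y)
    have h5 := hd.le.trans (hβd y hy)
    calc β y * U (x', y) * kernelCut ρ (‖y - c‖ ^ 2) ^ 3 ≤ β y * U (x', y) :=
          mul_le_of_le_one_right (mul_nonneg h5 h4) h2
      _ ≤ _ := by gcongr
  have hP0 : 0 ≤ ∫ y in closedBall c ρ, U (x', y) :=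
    setIntegral_nonneg measurableSet_closedBall fun y _ => hU0 _
  have hexp : ∫ y in closedBall c ρ, β y * U (x, y) * kernelCut ρ (‖y - c‖ ^ 2) ^ 3 ≤
      Real.exp (l * (x - x')) *
        ∫ y in closedBall c ρ, β y * U (x', y) * kernelCut ρ (‖y - c‖ ^ 2) ^ 3 := by
    have := mul_le_mul_of_nonneg_left hanti (Real.exp_pos (l * x)).le
    rw [← mul_assoc, ← mul_assoc, ← Real.exp_add, ← Real.exp_add, add_neg_cancel,
      Real.exp_zero, one_mul] at this
    refine this.trans (le_of_eq ?_)
    congr 2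
    ring
  rw [div_mul_eq_mul_div (_ * _), le_div_iff₀ hκ0, mul_comm]
  calc _ ≤ _ := hlower
    _ ≤ _ := hexp
    _ ≤ Real.exp (l * (x - x')) * ((B + 1) * ∫ y in closedBall c ρ, U (x', y)) := by gcongr
    _ ≤ Real.exp (l * T) * ((B + 1) * ∫ y in closedBall c ρ, U (x', y)) := by gcongr
    _ = _ := by ring

/-- A supersolution is bounded below at a point by its mass on a later cylinder, where `β` is
positive. -/
theorem exists_mass_le_value {β : Euc N → ℝ} (hβ : Continuous β) {L B d : ℝ}
    (hL : 0 ≤ L) (hLip : ∀ y y', |β y - β y'| ≤ L * ‖y - y'‖) (hB : ∀ y, |β y| ≤ B)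
    (hd : 0 < d) {c : Euc N} {r₀ : ℝ} (hr₀ : 0 < r₀) (hβd : ∀ y ∈ closedBall c r₀, d ≤ β y)
    {δ : ℝ} (hδ : 0 < δ) {T : ℝ} (hT : 0 < T) :
    ∃ r > 0, r ≤ r₀ ∧ ∃ C > 0, ∀ U : ℝ × Euc N → ℝ, ContDiff ℝ (⊤ : ℕ∞) U → (∀ p, 0 ≤ U p) →
      ∀ p q, (∀ x ∈ Ioo p q, ∀ y ∈ closedBall c r₀,
        lapY U (x, y) + β y * dX U (x, y) ≤ U (x, y)) →
      ∀ x₀ a b, p ≤ x₀ → x₀ + δ ≤ a → a ≤ b → b < q → b - x₀ ≤ T → ∀ y₀ ∈ closedBall c r,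
      ∫ x in a..b, ∫ y in closedBall c r, U (x, y) ≤ C * U (x₀, y₀) := by
  set R : ℝ := min (min 1 (r₀ / 2)) δ with hR
  have hR0 : 0 < R := by positivity
  have hR1 : R ≤ 1 := (min_le_left _ _).trans (min_le_left _ _)
  have hRr : R ≤ r₀ / 2 := (min_le_left _ _).trans (min_le_right _ _)
  have hRδ : R ≤ δ := min_le_right _ _
  have hR4 : R ^ 4 ≤ δ := (pow_le_of_le_one hR0.le hR1 (by norm_num)).trans hRδ
  obtain ⟨C₁, hC₁, h1⟩ := exists_slice_mass_le_value hβ hL hLip hB hd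
    (by linarith : 0 < R / 2) (by linarith : R / 2 < R) hR1
  obtain ⟨C₂, hC₂, h2⟩ := exists_slice_mass_le_slice_mass hβ hB hd (c := c)
    (by linarith : 0 < R / 4)
    (fun y hy => hβd y (closedBall_subset_closedBall (by linarith) hy)) T
  refine ⟨R / 8, by linarith, by linarith, T * (C₂ * C₁), by positivity,
    fun U hU hU0 p q hS x₀ a b hp ha hab hq hbT y₀ hy₀ => ?_⟩
  have hUc := hU.continuous
  have hball : ∀ {s t : ℝ}, R / 8 + s ≤ t → closedBall y₀ s ⊆ closedBall c t := fun {s t} hst =>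
    closedBall_subset_closedBall' (by rw [mem_closedBall] at hy₀; linarith)
  have hball' : closedBall c (R / 4) ⊆ closedBall y₀ (3 / 4 * (R / 2)) :=
    closedBall_subset_closedBall' (by rw [mem_closedBall, dist_comm] at hy₀; linarith)
  have hτ4 : (R / 2) ^ 4 ≤ δ := (by gcongr; linarith : (R / 2) ^ 4 ≤ R ^ 4).trans hR4
  have hτpos : 0 < (R / 2) ^ 4 := by positivity
  have hV := h1 y₀ (fun y hy => hβd y (hball (by linarith) hy)) U hU hU0 x₀
    (fun x hx y hy => hS x ⟨by linarith [hx.1], by linarith [hx.2]⟩ y (hball (by linarith) hy))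
  have hslice : ∀ x ∈ Icc a b, ∫ y in closedBall c (R / 8), U (x, y) ≤
      C₂ * C₁ * U (x₀, y₀) := fun x hx => by
    have h3 := h2 U hU hU0 p q (fun x hx y hy => hS x hx y
      (closedBall_subset_closedBall (by linarith) hy)) (x₀ + (R / 2) ^ 4) x (by linarith)
      (by linarith [hx.1]) (by linarith [hx.2]) (by linarith [hx.2])
    rw [show R / 4 / 2 = R / 8 by ring] at h3
    refine h3.trans ?_
    rw [mul_assoc]
    gcongr
    refine le_trans (setIntegral_mono_set ?_ ?_ (Filter.Eventually.of_forall hball')) hV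
    · exact (by fun_prop : Continuous fun y : Euc N =>
        U (x₀ + (R / 2) ^ 4, y)).continuousOn.integrableOn_compact (isCompact_closedBall _ _)
    · exact Filter.Eventually.of_forall fun y => hU0 _
  calc ∫ x in a..b, ∫ y in closedBall c (R / 8), U (x, y)
      ≤ ∫ x in a..b, C₂ * C₁ * U (x₀, y₀) :=
        intervalIntegral.integral_mono_on hab
          ((continuous_slice_integral hUc (isCompact_closedBall _ _)).intervalIntegrable _ _)
          (by simp) hslice
    _ = (b - a) * (C₂ * C₁ * U (x₀, y₀)) := by
        rw [intervalIntegral.integral_const, smul_eq_mul]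
    _ ≤ T * (C₂ * C₁ * U (x₀, y₀)) := by
        have := mul_nonneg (mul_pos hC₂ hC₁).le (hU0 (x₀, y₀))
        gcongr
        linarith
    _ = _ := by ring

end Parabolic

section MeanValue
variable {N : ℕ}

theorem hasLineDerivAt_comp_dilation {g : ℝ × Euc N → ℝ} (hg : Differentiable ℝ g) (c : Euc N)
    (ρ : ℝ) (p v : ℝ × Euc N) :
    HasLineDerivAt ℝ (fun p : ℝ × Euc N => g (p.1, c + ρ • p.2))
      (fderiv ℝ g (p.1, c + ρ • p.2) (v.1, ρ • v.2)) p v := by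
  have h1 : HasDerivAt (fun t : ℝ => (p.1 + t * v.1, c + ρ • (p.2 + t • v.2)))
      (v.1, ρ • v.2) 0 := by
    refine HasDerivAt.prodMk ?_ ?_
    · simpa using ((hasDerivAt_id (0 : ℝ)).mul_const v.1).const_add p.1
    · simpa using ((((hasDerivAt_id (0 : ℝ)).smul_const v.2).const_add p.2).const_smul ρ).const_add c
  have h2 : HasFDerivAt g (fderiv ℝ g (p.1, c + ρ • p.2))
      ((fun t : ℝ => (p.1 + t * v.1, c + ρ • (p.2 + t • v.2))) 0) := by
    simpa using (hg (p.1, c + ρ • p.2)).hasFDerivAt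
  exact h2.comp_hasDerivAt (0 : ℝ) h1

theorem sum_coord_mul_fderiv (U : ℝ × Euc N → ℝ) (p : ℝ × Euc N) (y : Euc N) :
    ∑ i, y i * fderiv ℝ U p (0, EuclideanSpace.single i (1 : ℝ)) = fderiv ℝ U p (0, y) := by
  have hy : ((0 : ℝ), y) = ∑ i, y i • ((0 : ℝ), EuclideanSpace.single i (1 : ℝ)) := by
    refine Prod.ext (by simp [Prod.fst_sum]) ?_
    ext j
    simp [Prod.snd_sum, Finset.sum_apply, Pi.single_apply]
  rw [hy, map_sum]
  simp only [map_smul, smul_eq_mul]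

/-- The derivative of a weighted average of a subsolution over dilated balls is nonnegative. -/
theorem integral_dilation_deriv_nonneg {β : Euc N → ℝ} (hβ : Continuous β) {B : ℝ}
    (hB : ∀ y, |β y| ≤ B) {U : ℝ × Euc N → ℝ} (hU : ContDiff ℝ (⊤ : ℕ∞) U)
    (hU0 : ∀ p, 0 ≤ U p) {a b ρ : ℝ} (hρ : 0 ≤ ρ) (c : Euc N)
    (hS : ∀ x ∈ Icc a b, ∀ y ∈ closedBall c ρ, -U (x, y) ≤ lapY U (x, y) + β y * dX U (x, y))
    {η η' θ : ℝ → ℝ} (hη : ∀ x, HasDerivAt η (η' x) x) (hη'c : Continuous η')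
    (hθ : Continuous θ) (hη0 : ∀ x, 0 ≤ η x) (hηz : ∀ x ∉ Icc a b, η x = 0)
    (hη'z : ∀ x ∉ Icc a b, η' x = 0)
    (hηθ : ∀ x ∈ Icc a b, ρ * (B * |η' x| + η x) ≤ 4 * θ x) :
    0 ≤ ∫ p in Icc a b ×ˢ closedBall (0 : Euc N) 1,
      (θ p.1 * U (p.1, c + ρ • p.2) + η p.1 * fderiv ℝ U (p.1, c + ρ • p.2) (0, p.2)) *
        (4 * max (1 - ‖p.2‖ ^ 2) 0) := by
  set Q : Set (ℝ × Euc N) := Icc a b ×ˢ closedBall (0 : Euc N) 1 with hQ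
  have : (volume : Measure (ℝ × Euc N)).IsAddHaarMeasure :=
    Measure.prod.instIsAddHaarMeasure _ _
  have hQc : IsCompact Q := isCompact_Icc.prod (isCompact_closedBall _ _)
  have hQm : MeasurableSet Q := hQc.measurableSet
  have hηc : Continuous η := continuous_iff_continuousAt.2 fun s => (hη s).continuousAt
  have hUc := hU.continuous
  have hdU := hU.differentiable (by simp)
  have hD : ∀ p : ℝ × Euc N, p ∉ Q → p.1 ∈ Icc a b → max (1 - ‖p.2‖ ^ 2) 0 = 0 := by
    intro p hp hx
    have : ¬ ‖p.2‖ ≤ 1 := fun h => hp ⟨hx, by simpa using h⟩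
    exact max_eq_right (by nlinarith)
  have hzero : ∀ {e : ℝ → ℝ}, (∀ x ∉ Icc a b, e x = 0) → ∀ p ∉ Q,
      e p.1 * max (1 - ‖p.2‖ ^ 2) 0 = 0 := by
    intro e he p hp
    by_cases hx : p.1 ∈ Icc a b
    · rw [hD p hp hx, mul_zero]
    · rw [he _ hx, zero_mul]
  have hzη := hzero hηz
  have hzη' := hzero hη'z
  have hK : ∀ s : ℝ, HasDerivAt (fun s : ℝ => max (1 - s) 0 ^ 2) (-2 * max (1 - s) 0) s := by
    intro s
    have := (hasDerivAt_max_zero_pow 0 (1 - s)).comp s ((hasDerivAt_id s).const_sub 1)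
    refine this.congr_deriv ?_
    norm_num
  have hgreen : ∫ p in Q, η p.1 * fderiv ℝ U (p.1, c + ρ • p.2) (0, p.2) *
      (4 * max (1 - ‖p.2‖ ^ 2) 0) =
      ∫ p in Q, ρ * lapY U (p.1, c + ρ • p.2) * (η p.1 * max (1 - ‖p.2‖ ^ 2) 0 ^ 2) := by
    have key : ∀ i : Fin (N - 1),
        ∫ p : ℝ × Euc N, ρ * fderiv ℝ (fun q => fderiv ℝ U q ((0 : ℝ),
          EuclideanSpace.single i (1 : ℝ))) (p.1, c + ρ • p.2)
          ((0 : ℝ), EuclideanSpace.single i (1 : ℝ)) * (η p.1 * max (1 - ‖p.2‖ ^ 2) 0 ^ 2) =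
        -∫ p : ℝ × Euc N, fderiv ℝ U (p.1, c + ρ • p.2)
          ((0 : ℝ), EuclideanSpace.single i (1 : ℝ)) *
          (η p.1 * (2 * p.2 i * (-2 * max (1 - ‖p.2‖ ^ 2) 0))) := by
      intro i
      have hU1 := contDiff_fderiv_apply_const hU ((0 : ℝ), EuclideanSpace.single i (1 : ℝ))
      have hU2 := contDiff_fderiv_apply_const hU1 ((0 : ℝ), EuclideanSpace.single i (1 : ℝ))
      refine integral_mul_lineDeriv_eq_neg (v := ((0 : ℝ), EuclideanSpace.single i (1 : ℝ))) hQc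
        (hU1.continuous.comp (by fun_prop))
        (continuous_const.mul (hU2.continuous.comp (by fun_prop))) (by fun_prop) (by fun_prop)
        (fun p hp => ?_) (fun p hp => ?_) (fun p => ?_) (fun p => ?_)
      · rw [sq, ← mul_assoc, hzη p hp, zero_mul]
      · linear_combination (-4 * p.2 i) * hzη p hp
      · have := hasLineDerivAt_comp_dilation (hU1.differentiable (by simp)) c ρ p
          ((0 : ℝ), EuclideanSpace.single i (1 : ℝ))
        have e : ((0 : ℝ), ρ • (EuclideanSpace.single i (1 : ℝ) : Euc N)) =
            ρ • ((0 : ℝ), EuclideanSpace.single i (1 : ℝ)) := by simp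
        rw [e, map_smul, smul_eq_mul] at this
        exact this
      · have := hasLineDerivAt_radial_single hK 0 i p.2
        simp only [sub_zero] at this
        have h2 := HasDerivAt.const_mul (η p.1) this
        simp only [HasLineDerivAt]
        simpa using h2
    have hinteg : ∀ {A G : ℝ × Euc N → ℝ}, Continuous A → Continuous G → (∀ p ∉ Q, G p = 0) →
        Integrable (fun p => A p * G p) := fun {A G} hA hG hGQ =>
      (hA.mul hG).integrable_of_hasCompactSupport
        (HasCompactSupport.intro hQc fun y hy => by simp [hGQ y hy])
    rw [setIntegral_eq_integral_of_forall_compl_eq_zero (fun p hp => by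
        linear_combination (4 * fderiv ℝ U (p.1, c + ρ • p.2) (0, p.2)) * hzη p hp),
      setIntegral_eq_integral_of_forall_compl_eq_zero (fun p hp => by
        linear_combination (ρ * lapY U (p.1, c + ρ • p.2) * max (1 - ‖p.2‖ ^ 2) 0) * hzη p hp)]
    simp only [lapY, Finset.mul_sum, Finset.sum_mul]
    rw [integral_finsetSum]
    swap
    · intro i _
      have h2 := (contDiff_fderiv_apply_const (contDiff_fderiv_apply_const hU
        ((0 : ℝ), EuclideanSpace.single i (1 : ℝ)))
        ((0 : ℝ), EuclideanSpace.single i (1 : ℝ))).continuous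
      exact hinteg (continuous_const.mul (h2.comp (by fun_prop))) (by fun_prop)
        fun p hp => by rw [sq, ← mul_assoc, hzη p hp, zero_mul]
    simp_rw [key]
    rw [Finset.sum_neg_distrib, ← integral_finsetSum, ← integral_neg]
    · refine integral_congr_ae (Filter.Eventually.of_forall fun p => ?_)
      simp only
      rw [← sum_coord_mul_fderiv, Finset.mul_sum, Finset.sum_mul, ← Finset.sum_neg_distrib]
      refine Finset.sum_congr rfl fun i _ => ?_
      ring
    · intro i _
      have h2 := (contDiff_fderiv_apply_const hU
        ((0 : ℝ), EuclideanSpace.single i (1 : ℝ))).continuous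
      exact hinteg (h2.comp (by fun_prop)) (by fun_prop)
        fun p hp => by linear_combination (-4 * p.2 i) * hzη p hp
  have hparts : ∫ p in Q, dX U (p.1, c + ρ • p.2) *
      (β (c + ρ • p.2) * (η p.1 * max (1 - ‖p.2‖ ^ 2) 0 ^ 2)) =
      -∫ p in Q, U (p.1, c + ρ • p.2) *
        (β (c + ρ • p.2) * (η' p.1 * max (1 - ‖p.2‖ ^ 2) 0 ^ 2)) := by
    rw [setIntegral_eq_integral_of_forall_compl_eq_zero (fun p hp => by
        rw [sq, ← mul_assoc (η _), hzη p hp]; ring),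
      setIntegral_eq_integral_of_forall_compl_eq_zero (fun p hp => by
        rw [sq, ← mul_assoc (η' _), hzη' p hp]; ring)]
    refine integral_mul_lineDeriv_eq_neg (v := ((1 : ℝ), (0 : Euc N))) hQc
        (by fun_prop)
        ((continuous_dX hU).comp (by fun_prop)) (by fun_prop) (by fun_prop)
        (fun p hp => ?_) (fun p hp => ?_) (fun p => ?_) (fun p => ?_)
    · rw [sq, ← mul_assoc (η _), hzη p hp]; ring
    · rw [sq, ← mul_assoc (η' _), hzη' p hp]; ring
    · have := hasLineDerivAt_comp_dilation hdU c ρ p ((1 : ℝ), (0 : Euc N))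
      rw [smul_zero] at this
      exact this
    · have h1 : HasDerivAt (fun t : ℝ => p.1 + t) 1 0 := (hasDerivAt_id (0 : ℝ)).const_add _
      have h2 : HasDerivAt η (η' p.1) (p.1 + 0) := by simpa using hη p.1
      have h3 := (((h2.comp (0 : ℝ) h1).mul_const (max (1 - ‖p.2‖ ^ 2) 0 ^ 2)).const_mul
        (β (c + ρ • p.2)))
      simp only [HasLineDerivAt]
      simpa [Function.comp_def] using h3
  have cdX := continuous_dX hU
  have clap := continuous_lapY hU
  have cfd : Continuous fun p : ℝ × Euc N => fderiv ℝ U (p.1, c + ρ • p.2) (0, p.2) :=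
    ((hU.continuous_fderiv (by simp)).comp (by fun_prop)).clm_apply (by fun_prop)
  have hi : ∀ {G : ℝ × Euc N → ℝ}, Continuous G → IntegrableOn G Q := fun hG =>
    hG.continuousOn.integrableOn_compact hQc
  have c1 : Continuous fun p : ℝ × Euc N =>
    θ p.1 * U (p.1, c + ρ • p.2) * (4 * max (1 - ‖p.2‖ ^ 2) 0) := by fun_prop
  have c2 : Continuous fun p : ℝ × Euc N =>
    U (p.1, c + ρ • p.2) * (β (c + ρ • p.2) * (η' p.1 * max (1 - ‖p.2‖ ^ 2) 0 ^ 2)) := by fun_prop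
  have c3 : Continuous fun p : ℝ × Euc N =>
    U (p.1, c + ρ • p.2) * (η p.1 * max (1 - ‖p.2‖ ^ 2) 0 ^ 2) := by fun_prop
  have c4 : Continuous fun p : ℝ × Euc N =>
    dX U (p.1, c + ρ • p.2) * (β (c + ρ • p.2) * (η p.1 * max (1 - ‖p.2‖ ^ 2) 0 ^ 2)) := by
    fun_prop
  have c5 : Continuous fun p : ℝ × Euc N =>
    ρ * lapY U (p.1, c + ρ • p.2) * (η p.1 * max (1 - ‖p.2‖ ^ 2) 0 ^ 2) := by fun_prop
  have c6 : Continuous fun p : ℝ × Euc N =>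
    η p.1 * fderiv ℝ U (p.1, c + ρ • p.2) (0, p.2) * (4 * max (1 - ‖p.2‖ ^ 2) 0) := by fun_prop
  have hmem : ∀ p ∈ Q, c + ρ • p.2 ∈ closedBall c ρ := by
    intro p hp
    have h1 : ‖p.2‖ ≤ 1 := by simpa using hp.2
    rw [mem_closedBall, dist_eq_norm, add_sub_cancel_left, norm_smul, Real.norm_eq_abs,
      abs_of_nonneg hρ]
    exact mul_le_of_le_one_right hρ h1
  have hlower : ∫ p in Q, -ρ * (dX U (p.1, c + ρ • p.2) *
      (β (c + ρ • p.2) * (η p.1 * max (1 - ‖p.2‖ ^ 2) 0 ^ 2))) +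
      -ρ * (U (p.1, c + ρ • p.2) * (η p.1 * max (1 - ‖p.2‖ ^ 2) 0 ^ 2)) ≤
      ∫ p in Q, ρ * lapY U (p.1, c + ρ • p.2) * (η p.1 * max (1 - ‖p.2‖ ^ 2) 0 ^ 2) := by
    refine setIntegral_mono_on (hi (by fun_prop)) (hi c5) hQm fun p hp => ?_
    have h1 := hS p.1 hp.1 _ (hmem p hp)
    have h2 : 0 ≤ ρ * (η p.1 * max (1 - ‖p.2‖ ^ 2) 0 ^ 2) :=
      mul_nonneg hρ (mul_nonneg (hη0 _) (by positivity))
    linarith [mul_le_mul_of_nonneg_right h1 h2]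
  rw [integral_add (hi (by fun_prop)) (hi (by fun_prop)), integral_const_mul,
    integral_const_mul, hparts] at hlower
  have hfinal : 0 ≤ ∫ p in Q, (θ p.1 * U (p.1, c + ρ • p.2) * (4 * max (1 - ‖p.2‖ ^ 2) 0) +
      ρ * (U (p.1, c + ρ • p.2) * (β (c + ρ • p.2) * (η' p.1 * max (1 - ‖p.2‖ ^ 2) 0 ^ 2)))) +
      -ρ * (U (p.1, c + ρ • p.2) * (η p.1 * max (1 - ‖p.2‖ ^ 2) 0 ^ 2)) := by
    refine setIntegral_nonneg hQm fun p hp => ?_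
    set D := max (1 - ‖p.2‖ ^ 2) 0 with hDdef
    have hD0 : 0 ≤ D := le_max_right _ _
    have hD1 : D ≤ 1 := max_le (by nlinarith [sq_nonneg ‖p.2‖]) zero_le_one
    have hDD : D ^ 2 ≤ D := by nlinarith
    have h1 := hηθ p.1 hp.1
    have h2 : -(B * |η' p.1|) ≤ β (c + ρ • p.2) * η' p.1 := by
      have := mul_le_mul_of_nonneg_right (hB (c + ρ • p.2)) (abs_nonneg (η' p.1))
      rw [← abs_mul] at this
      linarith [neg_abs_le (β (c + ρ • p.2) * η' p.1)]
    have h3 : 0 ≤ B * |η' p.1| + η p.1 :=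
      add_nonneg (mul_nonneg ((abs_nonneg _).trans (hB 0)) (abs_nonneg _)) (hη0 _)
    have h4 : 0 ≤ θ p.1 * (4 * D) + ρ * (β (c + ρ • p.2) * η' p.1) * D ^ 2
        - ρ * η p.1 * D ^ 2 := by
      have e1 := mul_le_mul_of_nonneg_right h1 hD0
      have e2 := mul_le_mul_of_nonneg_left hDD (mul_nonneg hρ h3)
      have e3 := mul_le_mul_of_nonneg_left h2 (mul_nonneg hρ (sq_nonneg D))
      linarith
    have := mul_nonneg (hU0 (p.1, c + ρ • p.2)) h4
    linarith
  rw [integral_add (hi (by fun_prop)) (hi (by fun_prop)),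
    integral_add (hi (by fun_prop)) (hi (by fun_prop)), integral_const_mul,
    integral_const_mul] at hfinal
  have hsplit : ∫ p in Q,
      (θ p.1 * U (p.1, c + ρ • p.2) + η p.1 * fderiv ℝ U (p.1, c + ρ • p.2) (0, p.2)) *
        (4 * max (1 - ‖p.2‖ ^ 2) 0) =
      (∫ p in Q, θ p.1 * U (p.1, c + ρ • p.2) * (4 * max (1 - ‖p.2‖ ^ 2) 0)) +
      ∫ p in Q, η p.1 * fderiv ℝ U (p.1, c + ρ • p.2) (0, p.2) *
        (4 * max (1 - ‖p.2‖ ^ 2) 0) := by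
    rw [← integral_add (hi c1) (hi c6)]
    simp only [add_mul]
  rw [hsplit, hgreen]
  linarith

theorem setIntegral_closedBall_dilation (f : Euc N → ℝ) (c : Euc N) {ρ : ℝ} (hρ : 0 < ρ) :
    ∫ y in closedBall (0 : Euc N) 1, f (c + ρ • y) =
      (ρ ^ Module.finrank ℝ (Euc N))⁻¹ * ∫ y in closedBall c ρ, f y := by
  rw [Measure.setIntegral_comp_smul_of_pos volume (fun y => f (c + y)) _ hρ, smul_eq_mul,
    _root_.smul_closedBall _ _ zero_le_one]
  have h := (measurePreserving_add_left (volume : Measure (Euc N)) c).setIntegral_preimage_emb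
    (measurableEmbedding_addLeft c) f (closedBall c ρ)
  have e : (fun y => c + y) ⁻¹' closedBall c ρ =
      closedBall (ρ • (0 : Euc N)) (‖ρ‖ * 1) := by
    ext y
    simp [mem_closedBall, dist_eq_norm, abs_of_pos hρ]
  rw [← e, h]

set_option maxHeartbeats 800000 in
/-- The local mean value inequality for subsolutions averaged in `x`. -/
theorem exists_average_le_integral {β : Euc N → ℝ} (hβ : Continuous β) {B : ℝ}
    (hB : ∀ y, |β y| ≤ B) {z : ℝ} (hz0 : 0 < z) (hz : z ≤ 1 / 3) :
    ∃ C > (0 : ℝ), ∀ U : ℝ × Euc N → ℝ, ContDiff ℝ (⊤ : ℕ∞) U → (∀ p, 0 ≤ U p) →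
      ∀ (x₁ : ℝ) (c : Euc N),
      (∀ x ∈ Icc (x₁ - 1 / 2) (x₁ + 1 / 2), ∀ y ∈ closedBall c (1 / 2),
        -U (x, y) ≤ lapY U (x, y) + β y * dX U (x, y)) →
      ∫ s in (-z)..z, U (x₁ + s, c) ≤
        C * ∫ x in (x₁ - 1 / 2)..(x₁ + 1 / 2), ∫ y in closedBall c (1 / 2), U (x, y) := by
  have hB0 : 0 ≤ B := (abs_nonneg _).trans (hB 0)
  set c₂ : ℝ := B / 8 + 1 with hc₂
  have hc₂1 : 1 ≤ c₂ := by linarith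
  set ρ₀ : ℝ := 1 / (4 * c₂) with hρ₀
  have hρ₀0 : 0 < ρ₀ := by positivity
  have hρc : 4 * c₂ * ρ₀ = 1 := by rw [hρ₀]; field_simp
  have hρ₀4 : ρ₀ ≤ 1 / 4 := by nlinarith
  set κ : ℝ := ∫ y in closedBall (0 : Euc N) 1, 4 * max (1 - ‖y‖ ^ 2) 0 with hκ
  have hDc : Continuous fun y : Euc N => 4 * max (1 - ‖y‖ ^ 2) 0 := by fun_prop
  have hκ0 : 0 < κ := by
    have h1 : ∫ y in closedBall (0 : Euc N) (1 / 2), (1 : ℝ) ≤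
        ∫ y in closedBall (0 : Euc N) (1 / 2), 4 * max (1 - ‖y‖ ^ 2) 0 := by
      refine setIntegral_mono_on (integrableOn_const (isCompact_closedBall _ _).measure_lt_top.ne)
        (hDc.continuousOn.integrableOn_compact (isCompact_closedBall _ _))
        measurableSet_closedBall fun y hy => ?_
      have hy' : ‖y‖ ≤ 1 / 2 := by simpa using hy
      have : 1 - ‖y‖ ^ 2 ≤ max (1 - ‖y‖ ^ 2) 0 := le_max_left _ _
      nlinarith [norm_nonneg y]
    have h2 : ∫ y in closedBall (0 : Euc N) (1 / 2), 4 * max (1 - ‖y‖ ^ 2) 0 ≤ κ :=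
      setIntegral_mono_set (hDc.continuousOn.integrableOn_compact (isCompact_closedBall _ _))
        (Filter.Eventually.of_forall fun y => by positivity)
        (closedBall_subset_closedBall (by norm_num)).eventuallyLE
    have h3 : 0 < ∫ y in closedBall (0 : Euc N) (1 / 2), (1 : ℝ) := by
      rw [setIntegral_const, smul_eq_mul, mul_one]
      exact ENNReal.toReal_pos (measure_closedBall_pos _ _ (by norm_num)).ne'
        (isCompact_closedBall _ _).measure_lt_top.ne
    linarith
  set Λ : ℝ := (ρ₀ ^ Module.finrank ℝ (Euc N))⁻¹ with hΛ
  have hΛ0 : 0 < Λ := by positivity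
  refine ⟨324 / κ * (Real.exp 1 * 4 * Λ), by positivity, ?_⟩
  intro U hU hU0 x₁ c hS
  set a := x₁ - 1 / 2 with ha
  set b := x₁ + 1 / 2 with hb
  have hab : a ≤ b := by linarith
  have hUc := hU.continuous
  set m : ℝ → ℝ → ℝ := fun ρ x => max (1 / 6 + c₂ * ρ ^ 2 - (x - x₁) ^ 2) 0 with hm
  have hm0 : ∀ ρ x, 0 ≤ m ρ x := fun _ _ => le_max_right _ _
  have hρsq : ∀ ρ ∈ Icc 0 ρ₀, c₂ * ρ ^ 2 ≤ 1 / 12 := by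
    intro ρ hρ
    have h1 : c₂ * ρ ^ 2 ≤ c₂ * (ρ₀ * ρ₀) := by
      have := hρ.1
      have := hρ.2
      rw [sq]
      gcongr
    have h2 : c₂ * (ρ₀ * ρ₀) = ρ₀ / 4 := by linear_combination (ρ₀ / 4) * hρc
    linarith
  have hmz : ∀ ρ ∈ Icc 0 ρ₀, ∀ x ∉ Icc a b, m ρ x = 0 := by
    intro ρ hρ x hx
    have h1 := hρsq ρ hρ
    have h2 : 1 / 4 ≤ (x - x₁) ^ 2 := by
      rw [mem_Icc, not_and_or, not_le, not_le] at hx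
      rcases hx with hx | hx <;> nlinarith
    exact max_eq_right (by linarith)
  have hmc : Continuous fun q : ℝ × ℝ => m q.1 q.2 := by
    simp only [hm]; fun_prop
  set Q : Set (ℝ × Euc N) := Icc a b ×ˢ closedBall (0 : Euc N) 1 with hQ
  have hQc : IsCompact Q := isCompact_Icc.prod (isCompact_closedBall _ _)
  have hQm : MeasurableSet Q := hQc.measurableSet
  set η : ℝ → ℝ → ℝ := fun ρ x => Real.exp (ρ ^ 2 / 8) * m ρ x ^ 2 with hη
  set θ : ℝ → ℝ → ℝ := fun ρ x =>
    Real.exp (ρ ^ 2 / 8) * (ρ / 4 * m ρ x ^ 2 + 4 * c₂ * ρ * m ρ x) with hθ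
  have hηc : Continuous fun q : ℝ × ℝ => η q.1 q.2 := by
    simp only [hη]; fun_prop
  have hθc : Continuous fun q : ℝ × ℝ => θ q.1 q.2 := by
    simp only [hθ]; fun_prop
  have hηρ : ∀ ρ x, HasDerivAt (fun ρ => η ρ x) (θ ρ x) ρ := by
    intro ρ x
    have h1 : HasDerivAt (fun ρ : ℝ => 1 / 6 + c₂ * ρ ^ 2 - (x - x₁) ^ 2) (c₂ * (2 * ρ)) ρ := by
      have := (((hasDerivAt_pow 2 ρ).const_mul c₂).const_add (1 / 6)).sub_const ((x - x₁) ^ 2)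
      refine this.congr_deriv ?_
      norm_num
    have h2 := (hasDerivAt_max_zero_pow 0 (1 / 6 + c₂ * ρ ^ 2 - (x - x₁) ^ 2)).comp ρ h1
    have h3 : HasDerivAt (fun ρ : ℝ => Real.exp (ρ ^ 2 / 8))
        (Real.exp (ρ ^ 2 / 8) * (ρ / 4)) ρ := by
      have := ((hasDerivAt_pow 2 ρ).div_const 8).exp
      refine this.congr_deriv ?_
      norm_num
      ring_nf
    refine (h3.mul h2).congr_deriv ?_
    simp only [hθ, hm, Function.comp]
    push_cast
    ring
  have hηx : ∀ ρ x, HasDerivAt (η ρ) (Real.exp (ρ ^ 2 / 8) * (-4 * (x - x₁) * m ρ x)) x := by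
    intro ρ x
    have h1 : HasDerivAt (fun x : ℝ => 1 / 6 + c₂ * ρ ^ 2 - (x - x₁) ^ 2) (-(2 * (x - x₁))) x := by
      have := (((hasDerivAt_id x).sub_const x₁).pow 2).const_sub (1 / 6 + c₂ * ρ ^ 2)
      refine this.congr_deriv ?_
      norm_num
    have h2 := (hasDerivAt_max_zero_pow 0 (1 / 6 + c₂ * ρ ^ 2 - (x - x₁) ^ 2)).comp x h1
    refine (h2.const_mul (Real.exp (ρ ^ 2 / 8))).congr_deriv ?_
    simp only [hm]
    push_cast
    ring
  set A : ℝ → ℝ := fun ρ => ∫ p in Q, η ρ p.1 * U (p.1, c + ρ • p.2) *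
    (4 * max (1 - ‖p.2‖ ^ 2) 0) with hA
  have hfd : Continuous (fderiv ℝ U) := hU.continuous_fderiv (by simp)
  have hAd : ∀ ρ, HasDerivAt A (∫ p in Q,
      (θ ρ p.1 * U (p.1, c + ρ • p.2) + η ρ p.1 * fderiv ℝ U (p.1, c + ρ • p.2) (0, p.2)) *
        (4 * max (1 - ‖p.2‖ ^ 2) 0)) ρ := by
    intro ρ
    refine hasDerivAt_setIntegral_of_continuousOn (μ := volume) hQc isOpen_univ
      (F := fun ρ p => η ρ p.1 * U (p.1, c + ρ • p.2) * (4 * max (1 - ‖p.2‖ ^ 2) 0))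
      (F' := fun ρ p => (θ ρ p.1 * U (p.1, c + ρ • p.2) +
        η ρ p.1 * fderiv ℝ U (p.1, c + ρ • p.2) (0, p.2)) * (4 * max (1 - ‖p.2‖ ^ 2) 0))
      (Continuous.continuousOn ?_) (Continuous.continuousOn ?_) (fun t _ p _ => ?_) (mem_univ ρ)
    · have : Continuous fun q : ℝ × (ℝ × Euc N) => η q.1 q.2.1 :=
        hηc.comp (by fun_prop : Continuous fun q : ℝ × (ℝ × Euc N) => (q.1, q.2.1))
      fun_prop
    · have h1 : Continuous fun q : ℝ × (ℝ × Euc N) => η q.1 q.2.1 :=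
        hηc.comp (by fun_prop : Continuous fun q : ℝ × (ℝ × Euc N) => (q.1, q.2.1))
      have h2 : Continuous fun q : ℝ × (ℝ × Euc N) => θ q.1 q.2.1 :=
        hθc.comp (by fun_prop : Continuous fun q : ℝ × (ℝ × Euc N) => (q.1, q.2.1))
      have h3 : Continuous fun q : ℝ × (ℝ × Euc N) =>
          fderiv ℝ U (q.2.1, c + q.1 • q.2.2) (0, q.2.2) :=
        (hfd.comp (by fun_prop)).clm_apply (by fun_prop)
      fun_prop
    · have h1 : HasDerivAt (fun t : ℝ => (p.1, c + t • p.2)) ((0 : ℝ), p.2) t := by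
        refine HasDerivAt.prodMk (hasDerivAt_const _ _) ?_
        simpa using ((hasDerivAt_id t).smul_const p.2).const_add c
      have h2 := ((hU.differentiable (by simp)) (p.1, c + t • p.2)).hasFDerivAt.comp_hasDerivAt t h1
      exact ((hηρ t p.1).mul h2).mul_const _
  have hmono : A 0 ≤ A ρ₀ := by
    refine monotoneOn_of_deriv_nonneg (convex_Icc 0 ρ₀)
      (fun ρ _ => (hAd ρ).continuousAt.continuousWithinAt)
      (fun ρ _ => (hAd ρ).differentiableAt.differentiableWithinAt) (fun ρ hρ => ?_)
      (left_mem_Icc.2 hρ₀0.le) (right_mem_Icc.2 hρ₀0.le) hρ₀0.le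
    rw [interior_Icc] at hρ
    have hρI := Ioo_subset_Icc_self hρ
    rw [(hAd ρ).deriv]
    have hcx : Continuous (m ρ) := by simp only [hm]; fun_prop
    refine integral_dilation_deriv_nonneg hβ hB hU hU0 hρ.1.le c (fun x hx y hy => hS x hx y
      (closedBall_subset_closedBall (by linarith [hρ.2]) hy)) (hηx ρ) (by fun_prop)
      (by simp only [hθ]; fun_prop) (fun x => by simp only [hη]; positivity)
      (fun x hx => by simp [hη, hmz ρ hρI x hx]) (fun x hx => by simp [hmz ρ hρI x hx])
      (fun x hx => ?_)
    have h1 : |Real.exp (ρ ^ 2 / 8) * (-4 * (x - x₁) * m ρ x)| ≤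
        Real.exp (ρ ^ 2 / 8) * (2 * m ρ x) := by
      have : |x - x₁| ≤ 1 / 2 := abs_le.2 ⟨by linarith [hx.1], by linarith [hx.2]⟩
      rw [abs_mul, abs_mul, abs_mul, Real.abs_exp, abs_of_nonneg (hm0 ρ x)]
      norm_num
      have h0 := hm0 ρ x
      have h2 : 4 * |x - x₁| ≤ 2 := by linarith
      gcongr
    have h2 := mul_le_mul_of_nonneg_left h1 (mul_nonneg hρ.1.le hB0)
    have h3 : 0 ≤ ρ * Real.exp (ρ ^ 2 / 8) * m ρ x :=
      mul_nonneg (mul_nonneg hρ.1.le (Real.exp_pos _).le) (hm0 ρ x)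
    have h4 : B = 8 * (c₂ - 1) := by rw [hc₂]; ring
    simp only [hθ, hη]
    rw [h4] at h2 ⊢
    linarith
  have hUx : Continuous fun x : ℝ => U (x, c) := by fun_prop
  have hη0c : Continuous (η 0) := hηc.comp (by fun_prop : Continuous fun x : ℝ => ((0 : ℝ), x))
  have hA0 : κ / 324 * ∫ s in (-z)..z, U (x₁ + s, c) ≤ A 0 := by
    have e : A 0 = (∫ x in Icc a b, η 0 x * U (x, c)) * κ := by
      simp only [hA, zero_smul, add_zero]
      exact setIntegral_prod_mul (μ := volume) (ν := volume) (fun x : ℝ => η 0 x * U (x, c))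
        (fun y : Euc N => 4 * max (1 - ‖y‖ ^ 2) 0) (Icc a b) (closedBall 0 1)
    have h1 : ∫ s in (-z)..z, U (x₁ + s, c) = ∫ x in (x₁ - z)..(x₁ + z), U (x, c) := by
      rw [intervalIntegral.integral_comp_add_left (fun x => U (x, c)), sub_eq_add_neg]
    have h2 : ∫ x in (x₁ - z)..(x₁ + z), 1 / 324 * U (x, c) ≤
        ∫ x in (x₁ - z)..(x₁ + z), η 0 x * U (x, c) := by
      refine intervalIntegral.integral_mono_on (by linarith)
        (Continuous.intervalIntegrable (by fun_prop) _ _)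
        (Continuous.intervalIntegrable (by fun_prop) _ _) fun x hx => ?_
      refine mul_le_mul_of_nonneg_right ?_ (hU0 _)
      have hx2 : (x - x₁) ^ 2 ≤ 1 / 9 := by
        have : |x - x₁| ≤ 1 / 3 := abs_le.2 ⟨by linarith [hx.1], by linarith [hx.2]⟩
        rw [← sq_abs]
        nlinarith [abs_nonneg (x - x₁)]
      have h3 : 1 / 18 ≤ m 0 x := le_max_of_le_left (by norm_num; linarith)
      simp only [hη]
      norm_num
      nlinarith
    have h3 : ∫ x in (x₁ - z)..(x₁ + z), η 0 x * U (x, c) ≤ ∫ x in a..b, η 0 x * U (x, c) := by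
      refine intervalIntegral.integral_mono_interval (by linarith) (by linarith) (by linarith)
        (Filter.Eventually.of_forall fun x => mul_nonneg (by simp only [hη]; positivity) (hU0 _))
        (Continuous.intervalIntegrable (by fun_prop) _ _)
    rw [intervalIntegral.integral_const_mul] at h2
    rw [e, h1, integral_Icc_eq_integral_Ioc, ← intervalIntegral.integral_of_le hab]
    have := mul_le_mul_of_nonneg_right (h2.trans h3) hκ0.le
    linarith
  have hA1 : A ρ₀ ≤ Real.exp 1 * 4 * Λ *
      ∫ x in a..b, ∫ y in closedBall c (1 / 2), U (x, y) := by
    have hUd : Continuous fun p : ℝ × Euc N => U (p.1, c + ρ₀ • p.2) := by fun_prop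
    have h1 : A ρ₀ ≤ ∫ p in Q, Real.exp 1 * 4 * U (p.1, c + ρ₀ • p.2) := by
      have hc1 : Continuous fun p : ℝ × Euc N => η ρ₀ p.1 :=
        hηc.comp (by fun_prop : Continuous fun p : ℝ × Euc N => (ρ₀, p.1))
      refine setIntegral_mono_on ((Continuous.continuousOn ?_).integrableOn_compact hQc)
        ((Continuous.continuousOn ?_).integrableOn_compact hQc) hQm fun p hp => ?_
      · fun_prop
      · fun_prop
      have e1 : m ρ₀ p.1 ≤ 1 := max_le (by
        nlinarith [hρsq ρ₀ (right_mem_Icc.2 hρ₀0.le), sq_nonneg (p.1 - x₁)]) zero_le_one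
      have e2 : η ρ₀ p.1 ≤ Real.exp 1 * 1 := by
        simp only [hη]
        have := hm0 ρ₀ p.1
        refine mul_le_mul (Real.exp_le_exp.2 (by nlinarith)) (pow_le_one₀ this e1) (by positivity)
          (Real.exp_pos 1).le
      have e3 : max (1 - ‖p.2‖ ^ 2) 0 ≤ 1 :=
        max_le (by nlinarith [sq_nonneg ‖p.2‖]) zero_le_one
      have e4 : η ρ₀ p.1 * (4 * max (1 - ‖p.2‖ ^ 2) 0) ≤ Real.exp 1 * 1 * (4 * 1) :=
        mul_le_mul e2 (by linarith) (by positivity) (by positivity)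
      have := mul_le_mul_of_nonneg_right e4 (hU0 (p.1, c + ρ₀ • p.2))
      linarith
    have h2 : ∫ p in Q, Real.exp 1 * 4 * U (p.1, c + ρ₀ • p.2) =
        Real.exp 1 * 4 * Λ * ∫ x in a..b, ∫ y in closedBall c ρ₀, U (x, y) := by
      rw [integral_const_mul]
      have := setIntegral_prod (μ := (volume : Measure ℝ)) (ν := (volume : Measure (Euc N)))
        (fun p : ℝ × Euc N => U (p.1, c + ρ₀ • p.2)) (s := Icc a b) (t := closedBall 0 1)
        (hUd.continuousOn.integrableOn_compact hQc)
      rw [hQ, Measure.volume_eq_prod, this, integral_Icc_eq_integral_Ioc,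
        ← intervalIntegral.integral_of_le hab]
      simp_rw [fun x : ℝ => setIntegral_closedBall_dilation (fun y => U (x, y)) c hρ₀0]
      rw [intervalIntegral.integral_const_mul]
      ring
    have h3 : ∫ x in a..b, ∫ y in closedBall c ρ₀, U (x, y) ≤
        ∫ x in a..b, ∫ y in closedBall c (1 / 2), U (x, y) := by
      refine intervalIntegral.integral_mono_on hab
        ((continuous_slice_integral hUc (isCompact_closedBall _ _)).intervalIntegrable _ _)
        ((continuous_slice_integral hUc (isCompact_closedBall _ _)).intervalIntegrable _ _)
        fun x _ => ?_
      refine setIntegral_mono_set ?_ (Filter.Eventually.of_forall fun y => hU0 _)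
        (closedBall_subset_closedBall (by linarith)).eventuallyLE
      exact (Continuous.continuousOn (by fun_prop)).integrableOn_compact (isCompact_closedBall _ _)
    rw [h2] at h1
    exact h1.trans (mul_le_mul_of_nonneg_left h3 (by positivity))
  have := (hA0.trans hmono).trans hA1
  have h5 := mul_le_mul_of_nonneg_left this (by positivity : 0 ≤ 324 / κ)
  have h6 : 324 / κ * (κ / 324 * ∫ s in (-z)..z, U (x₁ + s, c)) =
      ∫ s in (-z)..z, U (x₁ + s, c) := by
    field_simp
  rw [h6] at h5
  linarith

end MeanValue

section Chain
variable {N : ℕ}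

theorem fderiv_comp_reflection {U : ℝ × Euc N → ℝ} (hU : Differentiable ℝ U)
    (p v : ℝ × Euc N) :
    fderiv ℝ (fun p : ℝ × Euc N => U (-p.1, p.2)) p v = fderiv ℝ U (-p.1, p.2) (-v.1, v.2) := by
  have h1 : HasFDerivAt (fun p : ℝ × Euc N => (-p.1, p.2))
      ((-ContinuousLinearMap.fst ℝ ℝ (Euc N)).prod (ContinuousLinearMap.snd ℝ ℝ (Euc N))) p :=
    hasFDerivAt_fst.neg.prodMk hasFDerivAt_snd
  have h2 := (hU (-p.1, p.2)).hasFDerivAt.comp p h1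
  rw [HasFDerivAt.fderiv (f := fun p : ℝ × Euc N => U (-p.1, p.2)) h2]
  simp

theorem dX_comp_reflection {U : ℝ × Euc N → ℝ} (hU : Differentiable ℝ U) (p : ℝ × Euc N) :
    dX (fun p : ℝ × Euc N => U (-p.1, p.2)) p = -dX U (-p.1, p.2) := by
  rw [dX, dX, fderiv_comp_reflection hU, ← map_neg]
  simp

theorem lapY_comp_reflection {U : ℝ × Euc N → ℝ} (hU : ContDiff ℝ (⊤ : ℕ∞) U)
    (p : ℝ × Euc N) :
    lapY (fun p : ℝ × Euc N => U (-p.1, p.2)) p = lapY U (-p.1, p.2) := by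
  refine Finset.sum_congr rfl fun i _ => ?_
  have h1 := contDiff_fderiv_apply_const hU ((0 : ℝ), EuclideanSpace.single i (1 : ℝ))
  have e : (fun q => fderiv ℝ (fun p : ℝ × Euc N => U (-p.1, p.2)) q
      ((0 : ℝ), EuclideanSpace.single i (1 : ℝ))) =
      fun q => (fun q => fderiv ℝ U q ((0 : ℝ), EuclideanSpace.single i (1 : ℝ))) (-q.1, q.2) := by
    funext q
    rw [fderiv_comp_reflection (hU.differentiable (by simp))]
    simp
  rw [e, fderiv_comp_reflection (h1.differentiable (by simp))]
  simp

/-- The reflection in `x` of `exists_mass_le_value`. -/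
theorem exists_mass_le_value_of_neg {β : Euc N → ℝ} (hβ : Continuous β) {L B d δ T r₀ : ℝ}
    (hL : 0 ≤ L) (hLip : ∀ y y', |β y - β y'| ≤ L * ‖y - y'‖) (hB : ∀ y, |β y| ≤ B)
    (hd : 0 < d) (hr₀ : 0 < r₀) {c : Euc N} (hβd : ∀ y ∈ closedBall c r₀, d ≤ -β y)
    (hδ : 0 < δ) (hT : 0 < T) :
    ∃ r > 0, r ≤ r₀ ∧ ∃ C > (0 : ℝ), ∀ U : ℝ × Euc N → ℝ, ContDiff ℝ (⊤ : ℕ∞) U →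
      (∀ p, 0 ≤ U p) → ∀ p q : ℝ, (∀ x ∈ Ioo p q, ∀ y ∈ closedBall c r₀,
        lapY U (x, y) + β y * dX U (x, y) ≤ U (x, y)) →
      ∀ x₀ a b : ℝ, x₀ ≤ q → b + δ ≤ x₀ → a ≤ b → p < a → x₀ - a ≤ T →
      ∀ y₀ ∈ closedBall c r,
        ∫ x in a..b, ∫ y in closedBall c r, U (x, y) ≤ C * U (x₀, y₀) := by
  obtain ⟨r, hr, hrr, C, hC, H⟩ := exists_mass_le_value (β := fun y => -β y) hβ.neg hL
    (fun y y' => by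
      have := hLip y y'
      rwa [show -β y - -β y' = -(β y - β y') by ring, abs_neg])
    (fun y => by simpa using hB y) hd hr₀ hβd hδ hT
  refine ⟨r, hr, hrr, C, hC, fun U hU hU0 p q hS x₀ a b hxq hbx hab hpa hxT y₀ hy₀ => ?_⟩
  have hV : ContDiff ℝ (⊤ : ℕ∞) fun p : ℝ × Euc N => U (-p.1, p.2) :=
    hU.comp (contDiff_fst.neg.prodMk contDiff_snd)
  have := H (fun p => U (-p.1, p.2)) hV (fun _ => hU0 _) (-q) (-p) (fun x hx y hy => by
    rw [lapY_comp_reflection hU, dX_comp_reflection (hU.differentiable (by simp))]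
    have := hS (-x) ⟨by linarith [hx.2], by linarith [hx.1]⟩ y hy
    simp only
    linarith) (-x₀) (-b) (-a) (by linarith) (by linarith) (by linarith) (by linarith)
    (by linarith) y₀ hy₀
  rw [intervalIntegral.integral_comp_neg (fun x => ∫ y in closedBall c r, U (x, y))] at this
  simpa using this

/-- A pointwise lower bound near a point of the unit ball spreads to the ball of radius `5/2`. -/
theorem exists_le_of_le_near {β : Euc N → ℝ} {B : ℝ}
    (hB : ∀ y, |β y| ≤ B) {c : Euc N} (hc : ‖c‖ < 1) {r : ℝ} (hr : 0 < r) (hr1 : r ≤ 1) :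
    ∃ ε > (0 : ℝ), ∀ (a b : ℝ) (U : ℝ × Euc N → ℝ), ContDiff ℝ (⊤ : ℕ∞) U →
      (∀ p, 0 ≤ U p) → (∀ x ∈ Icc (a - 1 / 5) (b + 1 / 5), ∀ y ∈ closedBall (0 : Euc N) (14 / 5),
        lapY U (x, y) + β y * dX U (x, y) ≤ U (x, y)) →
      ∀ m ≥ 0, (∀ x ∈ Icc (a - 1 / 5) (b + 1 / 5), ∀ y ∈ closedBall c r, m ≤ U (x, y)) →
      ∀ x ∈ Icc a b, ∀ y ∈ closedBall (0 : Euc N) (5 / 2), ε * m ≤ U (x, y) := by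
  obtain ⟨ε₁, hε₁, H₁⟩ := exists_le_of_le_on_smaller_ball hB c (δ := 1 / 10) (r := r)
    (R := 9 / 5) (R' := 6 / 5) hr (by linarith) (by norm_num) (by norm_num) (by norm_num)
  obtain ⟨ε₂, hε₂, H₂⟩ := exists_le_of_le_on_smaller_ball hB (0 : Euc N) (δ := 1 / 10)
    (r := 1 / 10) (R := 14 / 5) (R' := 5 / 2) (by norm_num) (by norm_num) (by norm_num)
    (by norm_num) (by norm_num)
  refine ⟨ε₂ * ε₁, by positivity, fun a b U hU hU0 hS m hm hmU => ?_⟩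
  have h1 := H₁ (a - 1 / 10) (b + 1 / 10) U hU hU0 (fun x hx y hy => hS x
    ⟨by linarith [hx.1], by linarith [hx.2]⟩ y
    (closedBall_subset_closedBall' (by rw [dist_zero_right]; linarith) hy)) m hm
    (fun x hx y hy => hmU x ⟨by linarith [hx.1], by linarith [hx.2]⟩ y hy)
  have h2 := H₂ a b U hU hU0 (fun x hx y hy => hS x
    ⟨by linarith [hx.1], by linarith [hx.2]⟩ y hy) (ε₁ * m) (by positivity)
    (fun x hx y hy => h1 x hx y
    (closedBall_subset_closedBall' (by rw [dist_zero_left]; linarith) hy))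
  intro x hx y hy
  rw [mul_assoc]
  exact h2 x hx y hy

theorem exists_closedBall_le {β : Euc N → ℝ} (hβ : Continuous β) {d : ℝ} {c : Euc N}
    (hc : d < β c) : ∃ r > 0, r ≤ 1 ∧ ∀ y ∈ closedBall c r, d ≤ β y := by
  obtain ⟨ε, hε, h⟩ := Metric.nhds_basis_closedBall.mem_iff.1
    ((isOpen_lt continuous_const hβ).mem_nhds hc)
  exact ⟨min ε 1, by positivity, min_le_right _ _, fun y hy =>
    (h (closedBall_subset_closedBall (min_le_left _ _) hy)).le⟩

theorem integral_slab_mono {U : ℝ × Euc N → ℝ} (hU : Continuous U) (hU0 : ∀ p, 0 ≤ U p)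
    {a b a' b' r r' : ℝ} {c c' : Euc N} (ha : a' ≤ a) (hab : a ≤ b) (hb : b ≤ b')
    (hcr : closedBall c r ⊆ closedBall c' r') :
    ∫ x in a..b, ∫ y in closedBall c r, U (x, y) ≤
      ∫ x in a'..b', ∫ y in closedBall c' r', U (x, y) := by
  have hcs := fun (c : Euc N) (r : ℝ) =>
    continuous_slice_integral hU (isCompact_closedBall c r)
  refine (intervalIntegral.integral_mono_on (g := fun x => ∫ y in closedBall c' r', U (x, y)) hab
    ((hcs c r).intervalIntegrable _ _)
    ((hcs c' r').intervalIntegrable _ _) fun x _ => ?_).trans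
    (intervalIntegral.integral_mono_interval ha hab hb
      (Filter.Eventually.of_forall fun x =>
        setIntegral_nonneg measurableSet_closedBall fun y _ => hU0 _)
      ((hcs c' r').intervalIntegrable _ _))
  refine setIntegral_mono_set ?_ (Filter.Eventually.of_forall fun y => hU0 _) hcr.eventuallyLE
  exact (Continuous.continuousOn (by fun_prop)).integrableOn_compact (isCompact_closedBall _ _)

/-- The comparison of averages and values for smooth functions with `|Δ_y U + β U_x| ≤ U`. -/
theorem exists_average_le_value {β : Euc N → ℝ} (hβ : Continuous β) {L B d z : ℝ}
    (hL : 0 ≤ L) (hLip : ∀ y y', |β y - β y'| ≤ L * ‖y - y'‖) (hB : ∀ y, |β y| ≤ B)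
    (hd : 0 < d) (hz0 : 0 < z) (hz : z ≤ 1 / 3) {c₁ c₂ : Euc N} (hc₁ : ‖c₁‖ < 1)
    (hc₂ : ‖c₂‖ < 1) (hβ₁ : d < β c₁) (hβ₂ : d < -β c₂) :
    ∃ C > (0 : ℝ), ∀ U : ℝ × Euc N → ℝ, ContDiff ℝ (⊤ : ℕ∞) U → (∀ p, 0 ≤ U p) →
      (∀ x ∈ Ioo (-49 / 10 : ℝ) (59 / 10), ∀ y ∈ closedBall (0 : Euc N) (14 / 5),
        |lapY U (x, y) + β y * dX U (x, y)| ≤ U (x, y)) →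
      ∀ x₁ ∈ Icc (-1 : ℝ) 2, ∀ y₁ ∈ closedBall (0 : Euc N) 2,
      ∀ x₀ ∈ Icc (0 : ℝ) 1, ∀ y₀ ∈ closedBall (0 : Euc N) 2,
      ∫ s in (-z)..z, U (x₁ + s, y₁) ≤ C * U (x₀, y₀) := by
  obtain ⟨r₁', hr₁'0, hr₁'1, hβr₁⟩ := exists_closedBall_le hβ hβ₁
  obtain ⟨r₂', hr₂'0, hr₂'1, hβr₂⟩ := exists_closedBall_le hβ.neg hβ₂
  obtain ⟨r₁, hr₁0, hr₁', C₄, hC₄, H₄⟩ := exists_mass_le_value hβ hL hLip hB hd hr₁'0 hβr₁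
    (δ := 1 / 10) (T := 10) (by norm_num) (by norm_num)
  obtain ⟨r₂, hr₂0, hr₂', C₅, hC₅, H₅⟩ := exists_mass_le_value_of_neg hβ hL hLip hB hd hr₂'0 hβr₂
    (δ := 1 / 10) (T := 10) (by norm_num) (by norm_num)
  obtain ⟨C₁, hC₁, H₁⟩ := exists_average_le_integral hβ hB hz0 hz
  obtain ⟨C₂, hC₂, H₂⟩ := exists_integral_le_integral_smaller_ball hβ hB (0 : Euc N)
    (r := 1 / 10) (R := 14 / 5) (R' := 5 / 2) (a := -3 / 2) (b := 5 / 2) (δ := 1 / 10)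
    (by norm_num) (by norm_num) (by norm_num) (by norm_num) (by norm_num) (by norm_num)
  obtain ⟨C₃, hC₃, H₃⟩ := exists_integral_le_integral_smaller_ball hβ hB c₁
    (r := r₁) (R := 9 / 5) (R' := 6 / 5) (a := -3 / 2 - 1 / 10) (b := 5 / 2 + 1 / 10)
    (δ := 1 / 10) hr₁0 (by linarith) (by norm_num) (by norm_num) (by norm_num) (by norm_num)
  obtain ⟨ε₁, hε₁, K₁⟩ := exists_le_of_le_near hB hc₁ hr₁0 (hr₁'.trans hr₁'1)
  obtain ⟨ε₂, hε₂, K₂⟩ := exists_le_of_le_near hB hc₂ hr₂0 (hr₂'.trans hr₂'1)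
  set V : ℝ := volume.real (closedBall c₂ r₂) with hV
  have hV0 : 0 < V := ENNReal.toReal_pos (measure_closedBall_pos _ _ hr₂0).ne'
    (isCompact_closedBall _ _).measure_lt_top.ne
  set k₁ : ℝ := ε₁ / (C₂ * C₃ * C₄) with hk₁
  set k₂ : ℝ := ε₂ * (2 * V * k₁ / C₅) with hk₂
  have hk₁0 : 0 < k₁ := by positivity
  have hk₂0 : 0 < k₂ := by positivity
  refine ⟨C₁ / k₂, by positivity, fun U hU hU0 hS x₁ hx₁ y₁ hy₁ x₀ hx₀ y₀ hy₀ => ?_⟩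
  have hUc := hU.continuous
  have hsup : ∀ x ∈ Ioo (-49 / 10 : ℝ) (59 / 10), ∀ y ∈ closedBall (0 : Euc N) (14 / 5),
      lapY U (x, y) + β y * dX U (x, y) ≤ U (x, y) := fun x hx y hy =>
    (le_abs_self _).trans (hS x hx y hy)
  have hball : ∀ {c : Euc N} {R : ℝ}, ‖c‖ < 1 → R ≤ 9 / 5 → ∀ y ∈ closedBall c R,
      y ∈ closedBall (0 : Euc N) (14 / 5) := fun {c R} hc hR y hy =>
    closedBall_subset_closedBall' (by rw [dist_zero_right]; linarith) hy
  set M : ℝ := ∫ x in (-3 / 2)..(5 / 2), ∫ y in closedBall (0 : Euc N) (5 / 2), U (x, y) with hM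
  have hM0 : 0 ≤ M := intervalIntegral.integral_nonneg (by norm_num) fun x _ =>
    setIntegral_nonneg measurableSet_closedBall fun y _ => hU0 _
  have hy₁' : ‖y₁‖ ≤ 2 := by simpa using hy₁
  have h1 : ∫ s in (-z)..z, U (x₁ + s, y₁) ≤ C₁ * M := by
    refine (H₁ U hU hU0 x₁ y₁ fun x hx y hy => ?_).trans
      (mul_le_mul_of_nonneg_left (integral_slab_mono hUc hU0 (by linarith [hx₁.1]) (by linarith)
        (by linarith [hx₁.2])
        (closedBall_subset_closedBall' (by rw [dist_zero_right]; linarith))) hC₁.le)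
    refine neg_le_of_abs_le (hS x ⟨by linarith [hx.1, hx₁.1], by linarith [hx.2, hx₁.2]⟩ y ?_)
    exact closedBall_subset_closedBall' (by rw [dist_zero_right]; linarith) hy
  have h2 : M ≤ C₂ * (C₃ * ∫ x in (-3 / 2 - 1 / 10 - 1 / 10)..(5 / 2 + 1 / 10 + 1 / 10),
      ∫ y in closedBall c₁ r₁, U (x, y)) := by
    refine (H₂ U hU hU0 fun x hx y hy => hsup x
      ⟨by linarith [hx.1], by linarith [hx.2]⟩ y hy).trans (mul_le_mul_of_nonneg_left ?_ hC₂.le)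
    refine (integral_slab_mono (c' := c₁) (r' := 6 / 5) hUc hU0 le_rfl (by norm_num) le_rfl
      (closedBall_subset_closedBall' (by rw [dist_zero_left]; linarith))).trans ?_
    exact H₃ U hU hU0 fun x hx y hy => hsup x
      ⟨by linarith [hx.1], by linarith [hx.2]⟩ y (hball hc₁ le_rfl y hy)
  have h3 : ∀ x ∈ Icc (-9 / 2 : ℝ) (-2), ∀ y ∈ closedBall c₁ r₁,
      M / (C₂ * C₃ * C₄) ≤ U (x, y) := by
    intro x hx y hy
    have := H₄ U hU hU0 (-49 / 10) (59 / 10) (fun x hx y hy => hsup x hx y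
      (hball hc₁ (by linarith) y hy)) x (-3 / 2 - 1 / 10 - 1 / 10) (5 / 2 + 1 / 10 + 1 / 10)
      (by linarith [hx.1]) (by linarith [hx.2]) (by norm_num) (by norm_num) (by linarith [hx.1])
      y hy
    rw [div_le_iff₀ (by positivity)]
    have e := mul_le_mul_of_nonneg_left this (mul_nonneg hC₂.le hC₃.le)
    linarith
  have h4 : ∀ x ∈ Icc (-43 / 10 : ℝ) (-22 / 10), ∀ y ∈ closedBall (0 : Euc N) (5 / 2),
      k₁ * M ≤ U (x, y) := by
    intro x hx y hy
    have := K₁ (-43 / 10) (-22 / 10) U hU hU0 (fun x hx y hy => hsup x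
      ⟨by linarith [hx.1], by linarith [hx.2]⟩ y hy) (M / (C₂ * C₃ * C₄)) (by positivity)
      (fun x hx y hy => h3 x ⟨by linarith [hx.1], by linarith [hx.2]⟩ y hy) x hx y hy
    calc k₁ * M = ε₁ * (M / (C₂ * C₃ * C₄)) := by rw [hk₁]; ring
      _ ≤ _ := this
  have h5 : 2 * V * (k₁ * M) ≤
      ∫ x in (-43 / 10)..(-22 / 10), ∫ y in closedBall c₂ r₂, U (x, y) := by
    have e1 : ∫ x in (-43 / 10 : ℝ)..(-22 / 10), V * (k₁ * M) ≤
        ∫ x in (-43 / 10)..(-22 / 10), ∫ y in closedBall c₂ r₂, U (x, y) := by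
      refine intervalIntegral.integral_mono_on (by norm_num) intervalIntegrable_const
        ((continuous_slice_integral hUc (isCompact_closedBall _ _)).intervalIntegrable _ _)
        fun x hx => ?_
      have e2 : ∫ y in closedBall c₂ r₂, k₁ * M ≤ ∫ y in closedBall c₂ r₂, U (x, y) := by
        refine setIntegral_mono_on
          (integrableOn_const (isCompact_closedBall _ _).measure_lt_top.ne)
          ((Continuous.continuousOn (by fun_prop)).integrableOn_compact
            (isCompact_closedBall _ _)) measurableSet_closedBall fun y hy => ?_
        exact h4 x hx y (closedBall_subset_closedBall' (by rw [dist_zero_right]; linarith) hy)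
      rwa [setIntegral_const, smul_eq_mul] at e2
    rw [intervalIntegral.integral_const, smul_eq_mul] at e1
    have : 0 ≤ V * (k₁ * M) := by positivity
    linarith
  have h6 : ∀ x ∈ Icc (-2 : ℝ) 5, ∀ y ∈ closedBall c₂ r₂,
      2 * V * k₁ / C₅ * M ≤ U (x, y) := by
    intro x hx y hy
    have := H₅ U hU hU0 (-49 / 10) (59 / 10) (fun x hx y hy => hsup x hx y
      (hball hc₂ (by linarith) y hy)) x (-43 / 10) (-22 / 10)
      (by linarith [hx.2]) (by linarith [hx.1]) (by norm_num) (by norm_num) (by linarith [hx.2])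
      y hy
    rw [div_mul_eq_mul_div, div_le_iff₀ hC₅]
    linarith
  have h7 : k₂ * M ≤ U (x₀, y₀) := by
    have := K₂ 0 1 U hU hU0 (fun x hx y hy => hsup x
      ⟨by linarith [hx.1], by linarith [hx.2]⟩ y hy) (2 * V * k₁ / C₅ * M) (by positivity)
      (fun x hx y hy => h6 x ⟨by linarith [hx.1], by linarith [hx.2]⟩ y hy) x₀ hx₀ y₀
      (closedBall_subset_closedBall (by norm_num) hy₀)
    rw [hk₂, mul_assoc]
    exact this
  refine h1.trans ?_
  rw [div_mul_eq_mul_div, le_div_iff₀ hk₂0]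
  have := mul_le_mul_of_nonneg_left h7 hC₁.le
  linarith

end Chain

section Mollification
variable {N : ℕ}

theorem fderiv_integral_mul_comp_sub {w ρ : ℝ × Euc N → ℝ} (hw : LocallyIntegrable w)
    (hρ : ContDiff ℝ (⊤ : ℕ∞) ρ) (hρc : HasCompactSupport ρ) (p v : ℝ × Euc N) :
    fderiv ℝ (fun p => ∫ q, w q * ρ (p - q)) p v = ∫ q, w q * fderiv ℝ ρ (p - q) v := by
  have : (volume : Measure (ℝ × Euc N)).IsAddHaarMeasure :=
    Measure.prod.instIsAddHaarMeasure _ _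
  have h := hρc.hasFDerivAt_convolution_right (ContinuousLinearMap.mul ℝ ℝ) hw
    (hρ.of_le (by simp)) p
  have h2 := h.fderiv
  have h3 := convolution_precompR_apply (ContinuousLinearMap.mul ℝ ℝ) hw (hρc.fderiv ℝ)
    (hρ.continuous_fderiv (by simp)) p v
  rw [← h2] at h3
  exact h3

theorem contDiff_integral_mul_comp_sub {w ρ : ℝ × Euc N → ℝ} (hw : LocallyIntegrable w)
    (hρ : ContDiff ℝ (⊤ : ℕ∞) ρ) (hρc : HasCompactSupport ρ) :
    ContDiff ℝ (⊤ : ℕ∞) fun p => ∫ q, w q * ρ (p - q) := by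
  have : (volume : Measure (ℝ × Euc N)).IsAddHaarMeasure :=
    Measure.prod.instIsAddHaarMeasure _ _
  exact hρc.contDiff_convolution_right (ContinuousLinearMap.mul ℝ ℝ) hw hρ

theorem dX_integral_mul_comp_sub {w ρ : ℝ × Euc N → ℝ} (hw : LocallyIntegrable w)
    (hρ : ContDiff ℝ (⊤ : ℕ∞) ρ) (hρc : HasCompactSupport ρ) (p : ℝ × Euc N) :
    dX (fun p => ∫ q, w q * ρ (p - q)) p = ∫ q, w q * dX ρ (p - q) :=
  fderiv_integral_mul_comp_sub hw hρ hρc p _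

theorem HasCompactSupport.lapY {ρ : ℝ × Euc N → ℝ} (hρc : HasCompactSupport ρ) :
    HasCompactSupport (lapY ρ) := by
  refine HasCompactSupport.intro hρc.isCompact fun q hq => Finset.sum_eq_zero fun i _ => ?_
  have h : q ∉ tsupport fun q => fderiv ℝ (fun q => fderiv ℝ ρ q
      ((0 : ℝ), EuclideanSpace.single i (1 : ℝ))) q ((0 : ℝ), EuclideanSpace.single i (1 : ℝ)) :=
    fun h => hq (tsupport_fderiv_apply_subset ℝ _ (tsupport_fderiv_apply_subset ℝ _ h))
  have h2 := image_eq_zero_of_notMem_tsupport h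
  exact h2

theorem integrable_mul_comp_sub {w f : ℝ × Euc N → ℝ} (hw : LocallyIntegrable w)
    (hf : Continuous f) (hfc : HasCompactSupport f) (p : ℝ × Euc N) :
    Integrable fun q => w q * f (p - q) := by
  have : (volume : Measure (ℝ × Euc N)).IsAddHaarMeasure :=
    Measure.prod.instIsAddHaarMeasure _ _
  exact hfc.convolutionExists_right (ContinuousLinearMap.mul ℝ ℝ) hw hf p

theorem lapY_integral_mul_comp_sub {w ρ : ℝ × Euc N → ℝ} (hw : LocallyIntegrable w)
    (hρ : ContDiff ℝ (⊤ : ℕ∞) ρ) (hρc : HasCompactSupport ρ) (p : ℝ × Euc N) :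
    lapY (fun p => ∫ q, w q * ρ (p - q)) p = ∫ q, w q * lapY ρ (p - q) := by
  have e : ∀ i : Fin (N - 1), fderiv ℝ (fun q => fderiv ℝ (fun p => ∫ q, w q * ρ (p - q)) q
      ((0 : ℝ), EuclideanSpace.single i (1 : ℝ))) p ((0 : ℝ), EuclideanSpace.single i (1 : ℝ)) =
      ∫ q, w q * fderiv ℝ (fun q => fderiv ℝ ρ q ((0 : ℝ), EuclideanSpace.single i (1 : ℝ)))
        (p - q) ((0 : ℝ), EuclideanSpace.single i (1 : ℝ)) := by
    intro i
    simp_rw [fderiv_integral_mul_comp_sub hw hρ hρc]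
    exact fderiv_integral_mul_comp_sub hw (contDiff_fderiv_apply_const hρ _)
      (hρc.fderiv_apply ℝ _) p _
  simp only [lapY, e, Finset.mul_sum]
  rw [integral_finsetSum]
  exact fun i _ => integrable_mul_comp_sub hw
    (contDiff_fderiv_apply_const (contDiff_fderiv_apply_const hρ _) _).continuous
    ((hρc.fderiv_apply ℝ _).fderiv_apply ℝ _) p

theorem fderiv_comp_const_sub_apply {ρ : ℝ × Euc N → ℝ} (hρ : Differentiable ℝ ρ)
    (p q v : ℝ × Euc N) : fderiv ℝ (fun q => ρ (p - q)) q v = -fderiv ℝ ρ (p - q) v := by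
  have h := (hρ (p - q)).hasFDerivAt.comp q ((hasFDerivAt_id q).const_sub p)
  rw [HasFDerivAt.fderiv (f := fun q => ρ (p - q)) h]
  simp

theorem dX_comp_const_sub {ρ : ℝ × Euc N → ℝ} (hρ : Differentiable ℝ ρ) (p q : ℝ × Euc N) :
    dX (fun q => ρ (p - q)) q = -dX ρ (p - q) :=
  fderiv_comp_const_sub_apply hρ p q _

theorem lapY_comp_const_sub {ρ : ℝ × Euc N → ℝ} (hρ : ContDiff ℝ (⊤ : ℕ∞) ρ)
    (p q : ℝ × Euc N) : lapY (fun q => ρ (p - q)) q = lapY ρ (p - q) := by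
  refine Finset.sum_congr rfl fun i _ => ?_
  simp_rw [fderiv_comp_const_sub_apply (hρ.differentiable (by simp))]
  rw [fderiv_fun_neg, neg_apply, fderiv_comp_const_sub_apply
    ((contDiff_fderiv_apply_const hρ _).differentiable (by simp)), neg_neg]

theorem dX_add_const (U : ℝ × Euc N → ℝ) (c : ℝ) (p : ℝ × Euc N) :
    dX (fun p => U p + c) p = dX U p := by
  simp [dX]

theorem lapY_add_const (U : ℝ × Euc N → ℝ) (c : ℝ) (p : ℝ × Euc N) :
    lapY (fun p => U p + c) p = lapY U p := by
  simp [lapY]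

theorem isOpen_cylD : IsOpen (cylD N) := isOpen_Ioo.prod isOpen_ball

theorem volume_cylD_ne_top : volume (cylD N) ≠ ⊤ := by
  refine ne_top_of_le_ne_top
    ((isCompact_Icc (a := (-5 : ℝ)) (b := 6)).prod (isCompact_closedBall (0 : Euc N) 3)).measure_lt_top.ne
    (measure_mono (prod_mono Ioo_subset_Icc_self ball_subset_closedBall))

theorem integrableOn_cylD {u : ℝ × Euc N → ℝ} {K : ℝ} (hu : ContinuousOn u (cylD N))
    (hu0 : ∀ p ∈ cylD N, 0 ≤ u p) (huK : ∀ p ∈ cylD N, u p ≤ K) :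
    IntegrableOn u (cylD N) :=
  IntegrableOn.of_bound volume_cylD_ne_top.lt_top
    (hu.aestronglyMeasurable isOpen_cylD.measurableSet)
    K ((ae_restrict_iff' isOpen_cylD.measurableSet).2 (Filter.Eventually.of_forall fun q hq => by
      rw [Real.norm_eq_abs, abs_of_nonneg (hu0 q hq)]; exact huK q hq))

/-- The mollification of a bounded distributional solution is an approximate solution. -/
theorem abs_operator_mollification_le {β b : Euc N → ℝ} {γ u ρ : ℝ × Euc N → ℝ}
    {K L B ε : ℝ}
    (hβc : ContinuousOn β (ball (0 : Euc N) 3)) (hβB : ∀ y ∈ ball (0 : Euc N) 3, |β y| ≤ B)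
    (hb : ∀ y ∈ ball (0 : Euc N) (29 / 10), b y = β y)
    (hLip : ∀ y y', |b y - b y'| ≤ L * ‖y - y'‖) (hL : 0 ≤ L) (hγ : Measurable γ)
    (hγ1 : ∀ᵐ p ∂(volume.restrict (cylD N)), |γ p| ≤ 1) (hu : ContinuousOn u (cylD N))
    (hu0 : ∀ p ∈ cylD N, 0 ≤ u p) (huK : ∀ p ∈ cylD N, u p ≤ K)
    (hsol : IsDistribSolution (cylD N) β γ u) (hρ : ContDiff ℝ (⊤ : ℕ∞) ρ)
    (hρc : HasCompactSupport ρ) (hρ0 : ∀ p, 0 ≤ ρ p)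
    (hρs : tsupport ρ ⊆ closedBall (0 : ℝ) (1 / 10) ×ˢ closedBall (0 : Euc N) ε)
    (hε : ε < 1 / 10) {p : ℝ × Euc N} (hp1 : p.1 ∈ Ioo (-49 / 10 : ℝ) (59 / 10))
    (hp2 : p.2 ∈ closedBall (0 : Euc N) (14 / 5)) :
    |lapY (fun p => ∫ q, (cylD N).indicator u q * ρ (p - q)) p +
      b p.2 * dX (fun p => ∫ q, (cylD N).indicator u q * ρ (p - q)) p| ≤
      K * L * ε * (∫ q, |dX ρ q|) + ∫ q, (cylD N).indicator u q * ρ (p - q) := by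
  have : (volume : Measure (ℝ × Euc N)).IsAddHaarMeasure :=
    Measure.prod.instIsAddHaarMeasure _ _
  have hS := (isOpen_cylD (N := N)).measurableSet
  have hum : AEStronglyMeasurable u (volume.restrict (cylD N)) := hu.aestronglyMeasurable hS
  have hub : ∀ᵐ q ∂(volume.restrict (cylD N)), ‖u q‖ ≤ K :=
    (ae_restrict_iff' hS).2 (Filter.Eventually.of_forall fun q hq => by
      rw [Real.norm_eq_abs, abs_of_nonneg (hu0 q hq)]; exact huK q hq)
  have hp0 : p ∈ cylD N := ⟨⟨by linarith [hp1.1], by linarith [hp1.2]⟩,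
    closedBall_subset_ball (by norm_num) hp2⟩
  have hK0 : 0 ≤ K := (hu0 p hp0).trans (huK p hp0)
  have huint := integrableOn_cylD hu hu0 huK
  have hw : LocallyIntegrable ((cylD N).indicator u) :=
    ((integrable_indicator_iff hS).2 huint).locallyIntegrable
  have hind : ∀ f : ℝ × Euc N → ℝ, ∫ q, (cylD N).indicator u q * f q =
      ∫ q in cylD N, u q * f q := by
    intro f
    rw [← integral_indicator hS]
    congr 1
    funext q
    rw [indicator_mul_left]
  have hdc := hρc.fderiv_apply ℝ ((1 : ℝ), (0 : Euc N))
  have hdcont := continuous_dX hρ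
  have hlc := HasCompactSupport.lapY hρc
  have hlcont := continuous_lapY hρ
  have hcomp : ∀ {f : ℝ × Euc N → ℝ}, Continuous f → HasCompactSupport f →
      Integrable fun q => f (p - q) := fun {f} hf hfc =>
    (hf.integrable_of_hasCompactSupport hfc).comp_sub_left p
  have hmem : ∀ q, p - q ∈ tsupport ρ → |p.1 - q.1| ≤ 1 / 10 ∧ ‖p.2 - q.2‖ ≤ ε := by
    intro q hq
    have h := hρs hq
    refine ⟨?_, ?_⟩
    · simpa [Real.dist_eq] using h.1
    · simpa using h.2
  have hball : ∀ q, p - q ∈ tsupport ρ → q.2 ∈ ball (0 : Euc N) (29 / 10) := by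
    intro q hq
    have h1 := (hmem q hq).2
    have h2 : ‖p.2‖ ≤ 14 / 5 := by simpa using hp2
    have h3 : ‖q.2‖ ≤ ‖p.2‖ + ‖p.2 - q.2‖ := by
      have := norm_sub_le p.2 (p.2 - q.2)
      rwa [sub_sub_cancel] at this
    rw [mem_ball_zero_iff]
    linarith
  have htest := hsol (fun q => ρ (p - q)) (hρ.comp (contDiff_const.sub contDiff_id))
    (hρc.comp_homeomorph (Homeomorph.subLeft p)) (by
      intro q hq
      have hq' : p - q ∈ tsupport ρ := by
        have := tsupport_comp_subset_preimage ρ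
          (show Continuous fun q : ℝ × Euc N => p - q by fun_prop) hq
        exact this
      have h1 := abs_le.1 (hmem q hq').1
      exact ⟨⟨by linarith [hp1.1, h1.2], by linarith [hp1.2, h1.1]⟩,
        ball_subset_ball (by norm_num) (hball q hq')⟩)
  have i1 : IntegrableOn (fun q => u q * lapY ρ (p - q)) (cylD N) :=
    (hcomp hlcont hlc).integrableOn.bdd_mul hum hub
  have i2 : IntegrableOn (fun q => u q * dX ρ (p - q)) (cylD N) :=
    (hcomp hdcont hdc).integrableOn.bdd_mul hum hub
  have hβm : AEStronglyMeasurable (fun q : ℝ × Euc N => β q.2) (volume.restrict (cylD N)) :=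
    (hβc.comp continuous_snd.continuousOn fun q hq => hq.2).aestronglyMeasurable hS
  have i3 : IntegrableOn (fun q => β q.2 * (u q * dX ρ (p - q))) (cylD N) :=
    i2.bdd_mul hβm ((ae_restrict_iff' hS).2 (Filter.Eventually.of_forall fun q hq =>
      hβB q.2 hq.2))
  have i4 : IntegrableOn (fun q => γ q * (u q * ρ (p - q))) (cylD N) :=
    ((hcomp hρ.continuous hρc).integrableOn.bdd_mul hum hub).bdd_mul
      hγ.aestronglyMeasurable hγ1
  have htest2 : ∫ q in cylD N, u q * lapY ρ (p - q) + β q.2 * (u q * dX ρ (p - q)) +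
      γ q * (u q * ρ (p - q)) = 0 := by
    rw [← htest]
    congr 1
    funext q
    rw [lapY_comp_const_sub hρ, dX_comp_const_sub (hρ.differentiable (by simp))]
    ring
  have i5 : IntegrableOn (fun q => u q * lapY ρ (p - q) + b p.2 * (u q * dX ρ (p - q)))
      (cylD N) := i1.add (i2.const_mul _)
  have i6 : IntegrableOn (fun q => u q * lapY ρ (p - q) + β q.2 * (u q * dX ρ (p - q)) +
      γ q * (u q * ρ (p - q))) (cylD N) := (i1.add i3).add i4
  have hop : lapY (fun p => ∫ q, (cylD N).indicator u q * ρ (p - q)) p +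
      b p.2 * dX (fun p => ∫ q, (cylD N).indicator u q * ρ (p - q)) p =
      ∫ q in cylD N, (b p.2 - β q.2) * (u q * dX ρ (p - q)) - γ q * (u q * ρ (p - q)) := by
    rw [lapY_integral_mul_comp_sub hw hρ hρc, dX_integral_mul_comp_sub hw hρ hρc,
      hind (fun q => lapY ρ (p - q)), hind (fun q => dX ρ (p - q)), ← integral_const_mul,
      ← integral_add i1 (i2.const_mul _), ← sub_zero (∫ q in cylD N, _ + _), ← htest2,
      ← integral_sub i5 i6]
    congr 1
    funext q
    ring
  have j1 : Integrable fun q => K * L * ε * |dX ρ (p - q)| :=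
    ((hcomp hdcont hdc).abs).const_mul _
  have j2 : Integrable fun q => (cylD N).indicator u q * ρ (p - q) :=
    integrable_mul_comp_sub hw hρ.continuous hρc p
  have hpt : ∀ q ∈ cylD N, |(b p.2 - β q.2) * (u q * dX ρ (p - q))| ≤
      K * L * ε * |dX ρ (p - q)| := by
    intro q hq
    by_cases h : p - q ∈ tsupport ρ
    · have h1 : |b p.2 - β q.2| ≤ L * ε := by
        rw [← hb q.2 (hball q h)]
        exact (hLip _ _).trans (mul_le_mul_of_nonneg_left (hmem q h).2 hL)
      rw [abs_mul, abs_mul, abs_of_nonneg (hu0 q hq)]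
      have h2 := mul_le_mul_of_nonneg_right (huK q hq) (abs_nonneg (dX ρ (p - q)))
      have h3 := mul_le_mul h1 h2 (mul_nonneg (hu0 q hq) (abs_nonneg _))
        ((abs_nonneg _).trans h1)
      linarith
    · have : dX ρ (p - q) = 0 := image_eq_zero_of_notMem_tsupport
        (fun h' => h (tsupport_fderiv_apply_subset ℝ ((1 : ℝ), (0 : Euc N)) h'))
      simp [this]
  have hnn : ∀ q, 0 ≤ K * L * ε * |dX ρ (p - q)| := by
    intro q
    by_cases h : p - q ∈ tsupport ρ
    · have : 0 ≤ ε := (norm_nonneg _).trans (hmem q h).2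
      positivity
    · have : dX ρ (p - q) = 0 := image_eq_zero_of_notMem_tsupport
        (fun h' => h (tsupport_fderiv_apply_subset ℝ ((1 : ℝ), (0 : Euc N)) h'))
      simp [this]
  rw [hop, ← Real.norm_eq_abs]
  have hbound : ∀ᵐ q ∂(volume.restrict (cylD N)),
      ‖(b p.2 - β q.2) * (u q * dX ρ (p - q)) - γ q * (u q * ρ (p - q))‖ ≤
      K * L * ε * |dX ρ (p - q)| + (cylD N).indicator u q * ρ (p - q) := by
    filter_upwards [hγ1, ae_restrict_mem hS] with q hγq hq
    rw [indicator_of_mem hq]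
    refine (norm_sub_le _ _).trans (add_le_add (hpt q hq) ?_)
    have h0 : 0 ≤ u q * ρ (p - q) := mul_nonneg (hu0 q hq) (hρ0 _)
    rw [norm_mul, Real.norm_eq_abs, Real.norm_eq_abs, abs_of_nonneg h0]
    exact mul_le_of_le_one_left h0 hγq
  refine (norm_integral_le_of_norm_le (j1.add j2).integrableOn hbound).trans ?_
  refine (setIntegral_le_integral (j1.add j2) (Filter.Eventually.of_forall fun q => ?_)).trans ?_
  · exact add_nonneg (hnn q) (mul_nonneg (indicator_nonneg hu0 q) (hρ0 _))
  · simp only [Pi.add_apply]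
    rw [integral_add j1 j2, integral_const_mul,
      integral_sub_left_eq_self (fun q => |dX ρ q|) volume p]

/-- The tensor product of two normalized bump functions. -/
def tensorBump (f : ContDiffBump (0 : ℝ)) (g : ContDiffBump (0 : Euc N)) (p : ℝ × Euc N) : ℝ :=
  f.normed volume p.1 * g.normed volume p.2

variable (f : ContDiffBump (0 : ℝ)) (g : ContDiffBump (0 : Euc N))

theorem contDiff_tensorBump : ContDiff ℝ (⊤ : ℕ∞) (tensorBump f g) :=
  (f.contDiff_normed.comp contDiff_fst).mul (g.contDiff_normed.comp contDiff_snd)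

theorem tensorBump_nonneg (p : ℝ × Euc N) : 0 ≤ tensorBump f g p :=
  mul_nonneg (f.nonneg_normed _) (g.nonneg_normed _)

theorem support_tensorBump :
    Function.support (tensorBump f g) = ball (0 : ℝ) f.rOut ×ˢ ball (0 : Euc N) g.rOut := by
  ext p
  rw [mem_prod, ← f.support_normed_eq (μ := volume), ← g.support_normed_eq (μ := volume)]
  simp [tensorBump]

theorem tsupport_tensorBump :
    tsupport (tensorBump f g) =
      closedBall (0 : ℝ) f.rOut ×ˢ closedBall (0 : Euc N) g.rOut := by
  rw [tsupport, support_tensorBump, closure_prod_eq, closure_ball _ f.rOut_pos.ne',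
    closure_ball _ g.rOut_pos.ne']

theorem hasCompactSupport_tensorBump : HasCompactSupport (tensorBump f g) := by
  rw [HasCompactSupport, tsupport_tensorBump]
  exact (isCompact_closedBall _ _).prod (isCompact_closedBall _ _)

theorem integral_tensorBump : ∫ p, tensorBump f g p = 1 := by
  have h := integral_prod_mul (μ := (volume : Measure ℝ)) (ν := (volume : Measure (Euc N)))
    (f.normed volume) (g.normed volume)
  rw [f.integral_normed, g.integral_normed, mul_one] at h
  exact h

theorem dX_tensorBump (p : ℝ × Euc N) :
    dX (tensorBump f g) p = deriv (f.normed volume) p.1 * g.normed volume p.2 := by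
  have h := hasDerivAt_fst_slice ((contDiff_tensorBump f g).differentiable (by simp)) p.1 p.2
  have h2 : HasDerivAt (fun x => tensorBump f g (x, p.2))
      (deriv (f.normed volume) p.1 * g.normed volume p.2) p.1 :=
    (((f.contDiff_normed (μ := volume) (n := (⊤ : ℕ∞))).differentiable (by simp)
      p.1).hasDerivAt).mul_const (g.normed volume p.2)
  exact h.unique h2

theorem integral_abs_dX_tensorBump :
    ∫ p, |dX (tensorBump f g) p| = ∫ x, |deriv (f.normed volume) x| := by
  have h := integral_prod_mul (μ := (volume : Measure ℝ)) (ν := (volume : Measure (Euc N)))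
    (fun x => |deriv (f.normed volume) x|) (g.normed volume)
  rw [g.integral_normed, mul_one] at h
  rw [← h]
  refine integral_congr_ae (Filter.Eventually.of_forall fun p => ?_)
  simp only [dX_tensorBump, abs_mul, abs_of_nonneg (g.nonneg_normed p.2)]

/-- Nonnegative bounded solutions are uniformly approximated by smooth positive approximate
solutions. -/
theorem exists_smooth_approximation {β b : Euc N → ℝ} {γ u : ℝ × Euc N → ℝ} {K L B η : ℝ}
    (hβc : ContinuousOn β (ball (0 : Euc N) 3)) (hβB : ∀ y ∈ ball (0 : Euc N) 3, |β y| ≤ B)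
    (hb : ∀ y ∈ ball (0 : Euc N) (29 / 10), b y = β y)
    (hLip : ∀ y y', |b y - b y'| ≤ L * ‖y - y'‖) (hL : 0 ≤ L) (hγ : Measurable γ)
    (hγ1 : ∀ᵐ p ∂(volume.restrict (cylD N)), |γ p| ≤ 1) (hu : ContinuousOn u (cylD N))
    (hu0 : ∀ p ∈ cylD N, 0 ≤ u p) (huK : ∀ p ∈ cylD N, u p ≤ K)
    (hsol : IsDistribSolution (cylD N) β γ u) (hη : 0 < η) :
    ∃ U : ℝ × Euc N → ℝ, ContDiff ℝ (⊤ : ℕ∞) U ∧ (∀ p, 0 ≤ U p) ∧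
      (∀ x ∈ Ioo (-49 / 10 : ℝ) (59 / 10), ∀ y ∈ closedBall (0 : Euc N) (14 / 5),
        |lapY U (x, y) + b y * dX U (x, y)| ≤ U (x, y)) ∧
      ∀ x ∈ Icc (-2 : ℝ) 3, ∀ y ∈ closedBall (0 : Euc N) 2, |U (x, y) - u (x, y)| ≤ 2 * η := by
  have : (volume : Measure (ℝ × Euc N)).IsAddHaarMeasure :=
    Measure.prod.instIsAddHaarMeasure _ _
  have hS := (isOpen_cylD (N := N)).measurableSet
  have hK0 : 0 ≤ K := (hu0 (0, 0) (by simp [cylD])).trans (huK (0, 0) (by simp [cylD]))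
  have hcpt : IsCompact (Icc (-3 : ℝ) 4 ×ˢ closedBall (0 : Euc N) (5 / 2)) :=
    isCompact_Icc.prod (isCompact_closedBall _ _)
  have hsub : Icc (-3 : ℝ) 4 ×ˢ closedBall (0 : Euc N) (5 / 2) ⊆ cylD N :=
    prod_mono (fun x hx => ⟨by linarith [hx.1], by linarith [hx.2]⟩)
      (closedBall_subset_ball (by norm_num))
  obtain ⟨δ, hδ, hδu⟩ := Metric.uniformContinuousOn_iff.1
    (hcpt.uniformContinuousOn_of_continuous (hu.mono hsub)) η hη
  obtain ⟨r, hr0, hrδ, hr1⟩ : ∃ r > 0, r ≤ δ ∧ r < 1 / 10 :=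
    ⟨min δ (1 / 20), by positivity, min_le_left _ _, (min_le_right _ _).trans_lt (by norm_num)⟩
  let f : ContDiffBump (0 : ℝ) := ⟨r / 2, r, by linarith, by linarith⟩
  set J := ∫ x, |deriv (f.normed volume) x| with hJ
  have hJ0 : 0 ≤ J := integral_nonneg fun _ => abs_nonneg _
  obtain ⟨ε, hε0, hεr, hεη⟩ : ∃ ε > 0, ε ≤ r ∧ K * L * ε * J ≤ η := by
    refine ⟨min r (η / (K * L * J + 1)), by positivity, min_le_left _ _, ?_⟩
    have h1 : 0 ≤ K * L * J := by positivity
    have h2 := min_le_right r (η / (K * L * J + 1))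
    rw [le_div_iff₀ (by positivity)] at h2
    have h3 : 0 ≤ min r (η / (K * L * J + 1)) := by positivity
    linarith
  let g : ContDiffBump (0 : Euc N) := ⟨ε / 2, ε, by linarith, by linarith⟩
  have hw : LocallyIntegrable ((cylD N).indicator u) :=
    ((integrable_indicator_iff hS).2 (integrableOn_cylD hu hu0 huK)).locallyIntegrable
  have hρ := contDiff_tensorBump f g
  have hρc := hasCompactSupport_tensorBump f g
  have hρ0 := tensorBump_nonneg f g
  have hρs : tsupport (tensorBump f g) ⊆
      closedBall (0 : ℝ) (1 / 10) ×ˢ closedBall (0 : Euc N) ε := by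
    rw [tsupport_tensorBump]
    exact prod_mono (closedBall_subset_closedBall hr1.le) Subset.rfl
  have hW0 : ∀ p, 0 ≤ ∫ q, (cylD N).indicator u q * tensorBump f g (p - q) := fun p =>
    integral_nonneg fun q => mul_nonneg (indicator_nonneg hu0 q) (hρ0 _)
  refine ⟨fun p => (∫ q, (cylD N).indicator u q * tensorBump f g (p - q)) + η,
    (contDiff_integral_mul_comp_sub hw hρ hρc).add contDiff_const,
    fun p => add_nonneg (hW0 p) hη.le, ?_, ?_⟩
  · intro x hx y hy
    rw [lapY_add_const, dX_add_const]
    have h := abs_operator_mollification_le hβc hβB hb hLip hL hγ hγ1 hu hu0 huK hsol hρ hρc hρ0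
      hρs (hεr.trans_lt hr1) (p := (x, y)) hx hy
    rw [integral_abs_dX_tensorBump] at h
    simp only at h ⊢
    linarith
  · intro x hx y hy
    have hmem : ∀ q ∈ ball (x, y) r, q ∈ Icc (-3 : ℝ) 4 ×ˢ closedBall (0 : Euc N) (5 / 2) := by
      intro q hq
      rw [mem_ball, Prod.dist_eq, max_lt_iff, Real.dist_eq, abs_lt] at hq
      rw [mem_closedBall_zero_iff] at hy
      refine ⟨⟨by linarith [hq.1.1, hx.1], by linarith [hq.1.2, hx.2]⟩, ?_⟩
      rw [mem_closedBall_zero_iff]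
      have h2 := hq.2
      rw [dist_eq_norm, norm_sub_rev] at h2
      simp only at h2
      have h3 : ‖q.2‖ ≤ ‖y‖ + ‖y - q.2‖ := by
        have := norm_sub_le y (y - q.2)
        rwa [sub_sub_cancel] at this
      linarith
    have hsupp : Function.support (tensorBump f g) ⊆ ball (0 : ℝ × Euc N) r := by
      rw [support_tensorBump, ← Prod.mk_zero_zero, ← ball_prod_same]
      exact prod_mono Subset.rfl (ball_subset_ball hεr)
    have h := dist_convolution_le (μ := (volume : Measure (ℝ × Euc N)))
      (g := (cylD N).indicator u) (x₀ := (x, y)) (z₀ := u (x, y)) hη.le hsupp hρ0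
      (integral_tensorBump f g) hw.aestronglyMeasurable (by
        intro q hq
        rw [indicator_of_mem (hsub (hmem q hq))]
        exact (hδu q (hmem q hq) (x, y) (hmem _ (mem_ball_self hr0))
          ((mem_ball.1 hq).trans_le hrδ)).le)
    rw [convolution_lsmul_swap, Real.dist_eq] at h
    simp only [smul_eq_mul] at h
    have h2 : ∫ q, (cylD N).indicator u q * tensorBump f g ((x, y) - q) =
        ∫ q, tensorBump f g ((x, y) - q) * (cylD N).indicator u q := by
      simp only [mul_comm]
    simp only [h2]
    rw [abs_le] at h ⊢
    constructor <;> linarith [h.1, h.2]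

end Mollification

section Extension
variable {N : ℕ}

/-- A smooth function on `B_3(0)` agrees on `B_{29/10}(0)` with a bounded Lipschitz function. -/
theorem exists_lipschitz_extension {β : Euc N → ℝ}
    (hβ : ContDiffOn ℝ (⊤ : ℕ∞) β (ball (0 : Euc N) 3)) :
    ∃ b : Euc N → ℝ, Continuous b ∧ (∃ L, 0 ≤ L ∧ ∀ y y', |b y - b y'| ≤ L * ‖y - y'‖) ∧
      (∃ B, ∀ y, |b y| ≤ B) ∧ ∀ y ∈ ball (0 : Euc N) (29 / 10), b y = β y := by
  let χ : ContDiffBump (0 : Euc N) := ⟨29 / 10, 59 / 20, by norm_num, by norm_num⟩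
  have hts : tsupport χ ⊆ ball (0 : Euc N) 3 := by
    rw [χ.tsupport_eq]
    exact closedBall_subset_ball (by norm_num [χ])
  have hsm : ContDiff ℝ (⊤ : ℕ∞) fun y => χ y * β y := by
    rw [contDiff_iff_contDiffAt]
    intro y
    by_cases hy : y ∈ tsupport χ
    · exact χ.contDiff.contDiffAt.mul (hβ.contDiffAt (isOpen_ball.mem_nhds (hts hy)))
    · have h : (fun y => χ y * β y) =ᶠ[nhds y] fun _ => 0 := by
        filter_upwards [(isClosed_tsupport χ).isOpen_compl.mem_nhds hy] with w hw
        rw [image_eq_zero_of_notMem_tsupport hw, zero_mul]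
      exact contDiffAt_const.congr_of_eventuallyEq h
  have hc : HasCompactSupport fun y => χ y * β y := χ.hasCompactSupport.mul_right
  obtain ⟨L, hL⟩ := hsm.lipschitzWith_of_hasCompactSupport hc (by simp)
  obtain ⟨B, hB⟩ := hc.exists_bound_of_continuous hsm.continuous
  refine ⟨_, hsm.continuous, ⟨L, L.2, fun y y' => ?_⟩, ⟨B, hB⟩, fun y hy => ?_⟩
  · have h := hL.dist_le_mul y y'
    rwa [Real.dist_eq, dist_eq_norm] at h
  · rw [χ.one_of_mem_closedBall (ball_subset_closedBall hy), one_mul]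

end Extension

/-- In the normalized setting, fix `z ∈ (0,1/3]`, let `v(x,y) := ∫_{−z}^{z} u(x+s,y) ds`, and
let `d > 0` be such that `A_d^+` and `A_d^−` are nonempty.  Then there is `C > 0`, depending
only on `N`, `z`, `d` and `β` (not on `γ` or `u`), with
`sup_{[−1,2]×B̄_2(0)} v ≤ C · inf_{[0,1]×B̄_2(0)} u`. -/
theorem sup_average_le_inf_bigger
    (N : ℕ) (hN : 2 ≤ N)
    (β : Euc N → ℝ) (hβsmooth : ContDiffOn ℝ (⊤ : ℕ∞) β (ball (0 : Euc N) 3))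
    (hβbdd : ∀ k : ℕ, ∃ M : ℝ, ∀ y ∈ ball (0 : Euc N) 3,
      ‖iteratedFDerivWithin ℝ k β (ball (0 : Euc N) 3) y‖ ≤ M)
    (hβneg : ∃ y ∈ ball (0 : Euc N) 1, β y < 0)
    (hβpos : ∃ y ∈ ball (0 : Euc N) 1, 0 < β y)
    (z : ℝ) (hz : z ∈ Ioc (0 : ℝ) (1 / 3))
    (d : ℝ) (hd : 0 < d) (hAp : (Aplus β d).Nonempty) (hAm : (Aminus β d).Nonempty) :
    ∃ C > (0 : ℝ),
      ∀ γ : ℝ × Euc N → ℝ, Measurable γ →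
        (∀ᵐ p ∂(volume.restrict (cylD N)), |γ p| ≤ 1) →
      ∀ u : ℝ × Euc N → ℝ, ContinuousOn u (cylD N) →
        (∀ p ∈ cylD N, 0 ≤ u p) →
        (∃ K : ℝ, ∀ p ∈ cylD N, u p ≤ K) →
        IsDistribSolution (cylD N) β γ u →
        sSup ((fun p : ℝ × Euc N => ∫ s in (-z)..z, u (p.1 + s, p.2)) ''
            (Icc (-1 : ℝ) 2 ×ˢ closedBall (0 : Euc N) 2))
          ≤ C * sInf (u '' (Icc (0 : ℝ) 1 ×ˢ closedBall (0 : Euc N) 2)) := by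
  obtain ⟨b, hbc, ⟨L, hL, hLip⟩, ⟨B, hB⟩, hbβ⟩ := exists_lipschitz_extension hβsmooth
  obtain ⟨M, hM⟩ := hβbdd 0
  have hβM : ∀ y ∈ ball (0 : Euc N) 3, |β y| ≤ M := fun y hy => by
    have h := hM y hy
    rwa [norm_iteratedFDerivWithin_zero] at h
  obtain ⟨c₁, hc₁, hβ₁⟩ := hAp
  obtain ⟨c₂, hc₂, hβ₂⟩ := hAm
  rw [← hbβ c₁ (ball_subset_ball (by norm_num) hc₁)] at hβ₁
  rw [← hbβ c₂ (ball_subset_ball (by norm_num) hc₂)] at hβ₂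
  obtain ⟨C, hC, hCU⟩ := exists_average_le_value hbc hL hLip hB hd hz.1 hz.2
    (mem_ball_zero_iff.1 hc₁) (mem_ball_zero_iff.1 hc₂) hβ₁ hβ₂
  refine ⟨C, hC, fun γ hγ hγ1 u hu hu0 ⟨K, huK⟩ hsol => ?_⟩
  have key : ∀ x₁ ∈ Icc (-1 : ℝ) 2, ∀ y₁ ∈ closedBall (0 : Euc N) 2, ∀ x₀ ∈ Icc (0 : ℝ) 1,
      ∀ y₀ ∈ closedBall (0 : Euc N) 2, ∫ s in (-z)..z, u (x₁ + s, y₁) ≤ C * u (x₀, y₀) := by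
    intro x₁ hx₁ y₁ hy₁ x₀ hx₀ y₀ hy₀
    refine le_of_forall_pos_le_add fun ε hε => ?_
    have hpos : 0 < 2 * C + 4 * z := by linarith [hz.1]
    obtain ⟨U, hU, hU0, hUop, hUu⟩ := exists_smooth_approximation hβsmooth.continuousOn hβM hbβ
      hLip hL hγ hγ1 hu hu0 huK hsol (η := ε / (2 * C + 4 * z)) (by positivity)
    set η := ε / (2 * C + 4 * z) with hη
    have hηε : (2 * C + 4 * z) * η = ε := mul_div_cancel₀ _ hpos.ne'
    have hs : ∀ s ∈ Icc (-z) z, x₁ + s ∈ Icc (-2 : ℝ) 3 := fun s hs =>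
      ⟨by linarith [hs.1, hx₁.1, hz.2], by linarith [hs.2, hx₁.2, hz.2]⟩
    have hz' : -z ≤ z := by linarith [hz.1]
    have hui : IntervalIntegrable (fun s => u (x₁ + s, y₁)) volume (-z) z := by
      refine ContinuousOn.intervalIntegrable ?_
      rw [uIcc_of_le hz']
      refine hu.comp (Continuous.continuousOn (by fun_prop)) fun s h => ?_
      have := hs s h
      exact ⟨⟨by linarith [this.1], by linarith [this.2]⟩,
        closedBall_subset_ball (by norm_num) hy₁⟩
    have hUc : IntervalIntegrable (fun s => U (x₁ + s, y₁)) volume (-z) z :=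
      (hU.continuous.comp (by fun_prop)).intervalIntegrable _ _
    have hηi : IntervalIntegrable (fun _ => 2 * η) volume (-z) z :=
      continuous_const.intervalIntegrable _ _
    have h1 : ∫ s in (-z)..z, u (x₁ + s, y₁) ≤ ∫ s in (-z)..z, (U (x₁ + s, y₁) + 2 * η) :=
      intervalIntegral.integral_mono_on hz' hui (hUc.add hηi) fun s h => by
        linarith [(abs_le.1 (hUu _ (hs s h) y₁ hy₁)).1]
    rw [intervalIntegral.integral_add hUc hηi, intervalIntegral.integral_const,
      smul_eq_mul] at h1
    have h2 := hCU U hU hU0 hUop x₁ hx₁ y₁ hy₁ x₀ hx₀ y₀ hy₀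
    have h3 := (abs_le.1 (hUu x₀ ⟨by linarith [hx₀.1], by linarith [hx₀.2]⟩ y₀ hy₀)).2
    have h4 := mul_le_mul_of_nonneg_left h3 hC.le
    linarith
  have hne0 : (0 : Euc N) ∈ closedBall (0 : Euc N) 2 := by simp
  refine csSup_le ⟨_, mem_image_of_mem _ (mk_mem_prod (a := (0 : ℝ)) (by norm_num) hne0)⟩ ?_
  rintro _ ⟨p, hp, rfl⟩
  rw [← div_le_iff₀' hC]
  refine le_csInf ⟨_, mem_image_of_mem _ (mk_mem_prod (a := (0 : ℝ)) (by norm_num) hne0)⟩ ?_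
  rintro _ ⟨q, hq, rfl⟩
  rw [div_le_iff₀' hC]
  exact key p.1 hp.1 p.2 hp.2 q.1 hq.1 q.2 hq.2
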